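/- arXiv:math/0510001 — 3 statements merged into one kernel-verified Lean document; each statement's English description precedes it below -/
import Mathlib

section
/- Let S be a subset of ℤ, and let h be a function from S to the positive integers whose values are all powers of 3. For a positive real x let S(x) := {a ∈ S : |a| < x}, and for a non-negative integer k let S_k(x) := {a ∈ S(x) : h(a) ≤ 3^k} and δ_k(x) := #S_k(x)/#S(x). If lim_{x→∞} (1/#S(x)) Σ_{a ∈ S(x)} h(a) = B for some positive real number B, then for every non-negative integer k, liminf_{x→∞} δ_k(x) ≥ (3^{k+1} − B)/(3^{k+1} − 1). -/
open Filter

/-- Lemma 2.1: let `S ⊆ ℤ` and let `h` take values in the powers of `3` on `S`.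
If the average of `h` over `S(x) = {a ∈ S : |a| < x}` tends to `B > 0` as `x → ∞`, then
for every `k`, the lower density `liminf_x #{a ∈ S(x) : h a ≤ 3^k} / #S(x)` is at least
`(3^{k+1} - B) / (3^{k+1} - 1)`. -/
theorem liminf_density_of_average_limit
    (S : Set ℤ) (h : ℤ → ℕ) (hpow : ∀ a ∈ S, ∃ j : ℕ, h a = 3 ^ j)
    (B : ℝ) (hB : 0 < B)
    (hlim : Tendsto (fun x : ℝ =>
        (∑ᶠ a ∈ {a ∈ S | |(a : ℝ)| < x}, (h a : ℝ)) /
          (Nat.card {a ∈ S | |(a : ℝ)| < x} : ℝ)) atTop (nhds B))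
    (k : ℕ) :
    ((3 : ℝ) ^ (k + 1) - B) / ((3 : ℝ) ^ (k + 1) - 1) ≤
      liminf (fun x : ℝ =>
        (Nat.card {a ∈ S | |(a : ℝ)| < x ∧ h a ≤ 3 ^ k} : ℝ) /
          (Nat.card {a ∈ S | |(a : ℝ)| < x} : ℝ)) atTop := by
  have hq : (1 : ℝ) < 3 ^ (k + 1) := one_lt_pow₀ (by norm_num) (by omega)
  have hfin : ∀ x : ℝ, {a ∈ S | |(a : ℝ)| < x}.Finite := by
    intro x
    refine (Set.finite_Icc (-⌈x⌉) ⌈x⌉).subset ?_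
    rintro a ⟨-, ha⟩
    rw [abs_lt] at ha
    have hx := Int.le_ceil x
    constructor
    · have : (-(⌈x⌉ : ℝ)) ≤ a := by linarith
      exact_mod_cast this
    · have : (a : ℝ) ≤ ⌈x⌉ := by linarith
      exact_mod_cast this
  have ht : Tendsto (fun x : ℝ => ((3 : ℝ) ^ (k + 1) -
      (∑ᶠ a ∈ {a ∈ S | |(a : ℝ)| < x}, (h a : ℝ)) /
          (Nat.card {a ∈ S | |(a : ℝ)| < x} : ℝ)) / ((3 : ℝ) ^ (k + 1) - 1)) atTop
      (nhds (((3 : ℝ) ^ (k + 1) - B) / ((3 : ℝ) ^ (k + 1) - 1))) :=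
    (tendsto_const_nhds.sub hlim).div_const _
  have hsub : ∀ x : ℝ, Nat.card {a ∈ S | |(a : ℝ)| < x ∧ h a ≤ 3 ^ k} ≤
      Nat.card {a ∈ S | |(a : ℝ)| < x} := fun x =>
    Nat.card_mono (hfin x) (fun a ha => ⟨ha.1, ha.2.1⟩)
  rw [← ht.liminf_eq]
  refine liminf_le_liminf ?_ ht.isBoundedUnder_ge ?_
  · filter_upwards [hlim.eventually (lt_mem_nhds hB)] with x hx
    have hN : (0 : ℝ) < (Nat.card {a ∈ S | |(a : ℝ)| < x} : ℝ) := by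
      rcases (Nat.cast_nonneg (α := ℝ) (Nat.card {a ∈ S | |(a : ℝ)| < x})).lt_or_eq with h0 | h0
      · exact h0
      · rw [← h0] at hx
        simp at hx
    have key : (Nat.card {a ∈ S | |(a : ℝ)| < x ∧ h a ≤ 3 ^ k} : ℝ) + 3 ^ (k + 1) *
        ((Nat.card {a ∈ S | |(a : ℝ)| < x} : ℝ) -
          (Nat.card {a ∈ S | |(a : ℝ)| < x ∧ h a ≤ 3 ^ k} : ℝ)) ≤
        ∑ᶠ a ∈ {a ∈ S | |(a : ℝ)| < x}, (h a : ℝ) := by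
      classical
      set T := (hfin x).toFinset with hT
      have e1 : Nat.card {a ∈ S | |(a : ℝ)| < x} = T.card :=
        Nat.card_eq_card_finite_toFinset (hfin x)
      have e2 : Nat.card {a ∈ S | |(a : ℝ)| < x ∧ h a ≤ 3 ^ k} =
          (T.filter (fun a => h a ≤ 3 ^ k)).card := by
        rw [← Nat.card_eq_finsetCard]
        apply Nat.card_congr
        apply Equiv.setCongr
        ext a
        simp [hT, and_assoc]
      rw [e1, e2, finsum_mem_eq_finite_toFinset_sum _ (hfin x), ← hT]
      have e3 : ((T.filter (fun a => h a ≤ 3 ^ k)).card : ℝ) + 3 ^ (k + 1) *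
          ((T.card : ℝ) - ((T.filter (fun a => h a ≤ 3 ^ k)).card : ℝ)) =
          ∑ a ∈ T, (if h a ≤ 3 ^ k then (1 : ℝ) else 3 ^ (k + 1)) := by
        rw [← Finset.card_filter_add_card_filter_not (s := T) (fun a => h a ≤ 3 ^ k),
          Finset.sum_ite]
        simp
        ring
      rw [e3]
      refine Finset.sum_le_sum fun a ha => ?_
      have haS : a ∈ S := by
        have := (hfin x).mem_toFinset.1 ha
        exact this.1
      obtain ⟨j, hj⟩ := hpow a haS
      split_ifs with hc
      · rw [hj]
        exact_mod_cast Nat.one_le_pow _ _ (by norm_num)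
      · rw [hj] at hc ⊢
        have : k < j := by
          by_contra hjk
          exact hc (Nat.pow_le_pow_right (by norm_num) (by omega))
        exact_mod_cast Nat.pow_le_pow_right (by norm_num) this
    simp only [Set.mem_setOf_eq] at key ⊢
    rw [div_le_div_iff₀ (by linarith) hN, sub_mul, div_mul_cancel₀ _ hN.ne']
    linarith
  · refine IsBoundedUnder.isCoboundedUnder_ge ⟨1, ?_⟩
    rw [eventually_map]
    refine Eventually.of_forall fun x => ?_
    exact div_le_one_of_le₀ (by exact_mod_cast hsub x) (by positivity)
end

section
/- Let A be a positive square-free integer with A ≡ 1 (mod 12), and let m := 48A² − 4A. Then lim_{X→∞} #N⁻(X,m,48A²) / #T(X/(4A)) = (1/8) · ∏_{p | A, p prime} p/((p−1)(p+1)). -/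
open Filter

/-- An integer is a fundamental discriminant if it is the discriminant of a quadratic
number field: `Δ ≠ 1` and either `Δ` is square-free with `Δ ≡ 1 (mod 4)`, or `Δ = 4·m'`
with `m'` square-free and `m' ≡ 2` or `3 (mod 4)`. -/
def IsFundamentalDiscriminant (Δ : ℤ) : Prop :=
  Δ ≠ 1 ∧ ((Squarefree Δ ∧ Δ % 4 = 1) ∨
    ∃ m' : ℤ, Δ = 4 * m' ∧ Squarefree m' ∧ (m' % 4 = 2 ∨ m' % 4 = 3))

/-- `Nminus X m N` is the set of fundamental discriminants `Δ` with `-X < Δ < 0` and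
`Δ ≡ m (mod N)`. -/
def Nminus (X : ℝ) (m N : ℤ) : Set ℤ :=
  {Δ : ℤ | -X < (Δ : ℝ) ∧ Δ < 0 ∧ IsFundamentalDiscriminant Δ ∧ Δ ≡ m [ZMOD N]}

/-- `T Y` is the set of positive square-free integers less than `Y`. -/
def T (Y : ℝ) : Set ℤ := {D : ℤ | 0 < D ∧ (D : ℝ) < Y ∧ Squarefree D}

lemma dsq_dvd_aux {d b a : ℕ} (hb : b ≠ 0) (ha : Squarefree a) (h : d ^ 2 ∣ b ^ 2 * a) : d ∣ b := by
  have hg : 0 < Nat.gcd d b := Nat.gcd_pos_of_pos_right _ (Nat.pos_of_ne_zero hb)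
  obtain ⟨g, d', b', hg0, hco, hd, hb'⟩ := Nat.exists_coprime' hg
  subst hd hb'
  have h1 : d' ^ 2 ∣ b' ^ 2 * a := by
    have h2 : g ^ 2 * d' ^ 2 ∣ g ^ 2 * (b' ^ 2 * a) := by
      convert h using 1 <;> ring
    exact Nat.dvd_of_mul_dvd_mul_left (by positivity) h2
  have h3 : d' ^ 2 ∣ a := (Nat.Coprime.pow 2 2 hco).dvd_of_dvd_mul_left h1
  have h4 : IsUnit d' := ha d' (by rwa [← sq])
  rw [Nat.isUnit_iff] at h4
  subst h4
  simp

lemma sqf_indicator {n M : ℕ} (hn : n ≠ 0) (hM : n ≤ M) :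
    ∑ d ∈ (Finset.Ioc 0 M).filter (fun d => d ^ 2 ∣ n), ArithmeticFunction.moebius d
      = if Squarefree n then 1 else 0 := by
  obtain ⟨a, b, hab, ha⟩ := Nat.sq_mul_squarefree n
  have hb : b ≠ 0 := by rintro rfl; simp at hab; omega
  have hset : (Finset.Ioc 0 M).filter (fun d => d ^ 2 ∣ n) = b.divisors := by
    ext d
    simp only [Finset.mem_filter, Finset.mem_Ioc, Nat.mem_divisors]
    constructor
    · rintro ⟨_, h⟩
      rw [← hab] at h
      exact ⟨dsq_dvd_aux hb ha h, hb⟩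
    · rintro ⟨h, _⟩
      have h2 : d ^ 2 ∣ n := by rw [← hab]; exact (pow_dvd_pow_of_dvd h 2).mul_right a
      have hd : 0 < d := Nat.pos_of_dvd_of_pos h (Nat.pos_of_ne_zero hb)
      have h3 := Nat.le_of_dvd (Nat.pos_of_ne_zero hn) h2
      exact ⟨⟨hd, by nlinarith⟩, h2⟩
  rw [hset]
  have h1 := congrArg (fun f => f b) ArithmeticFunction.moebius_mul_coe_zeta
  simp only [ArithmeticFunction.coe_mul_zeta_apply] at h1
  rw [h1, ArithmeticFunction.one_apply]
  by_cases hb1 : b = 1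
  · subst hb1
    have : n = a := by rw [← hab]; simp
    subst this
    simp [ha]
  · rw [if_neg hb1, if_neg]
    intro hs
    apply hb1
    have := hs b (by rw [← sq, ← hab]; exact dvd_mul_right _ _)
    simpa using this

/-- Squarefree numbers in `(0, M]` congruent to `1` mod `q`. -/
noncomputable def sqfCls (q M : ℕ) : Finset ℕ := by
  classical
  exact (Finset.Ioc 0 M).filter (fun n => Squarefree n ∧ n ≡ 1 [MOD q])

noncomputable def dsqCls (q d M : ℕ) : Finset ℕ := 
  (Finset.Ioc 0 M).filter (fun n => d ^ 2 ∣ n ∧ n ≡ 1 [MOD q])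

lemma dsqCls_le (q d M : ℕ) : (dsqCls q d M).card ≤ M / d ^ 2 := by
  rw [← Nat.Ioc_filter_dvd_card_eq_div]
  apply Finset.card_le_card
  intro n
  simp only [dsqCls, Finset.mem_filter]
  tauto

lemma sqfCls_card (q M : ℕ) :
    ((sqfCls q M).card : ℝ) =
      ∑' d : ℕ, (ArithmeticFunction.moebius d : ℝ) * ((dsqCls q d M).card : ℝ) := by
  classical
  rw [tsum_eq_sum (s := Finset.Ioc 0 M)]
  · have : ((sqfCls q M).card : ℤ) =
      ∑ d ∈ Finset.Ioc 0 M, (ArithmeticFunction.moebius d) * ((dsqCls q d M).card : ℤ) := by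
      have h1 : ((sqfCls q M).card : ℤ) = ∑ n ∈ Finset.Ioc 0 M, if n ≡ 1 [MOD q] then
          ∑ d ∈ (Finset.Ioc 0 M), (if d ^ 2 ∣ n then ArithmeticFunction.moebius d else 0) else 0 := by
        rw [sqfCls, Finset.card_filter]
        push_cast
        apply Finset.sum_congr rfl
        intro n hn
        rw [Finset.mem_Ioc] at hn
        rw [← Finset.sum_filter, sqf_indicator (by omega) hn.2]
        split_ifs <;> tauto
      rw [h1]
      have h2 : ∀ d, ((dsqCls q d M).card : ℤ) = ∑ n ∈ Finset.Ioc 0 M,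
          if d ^ 2 ∣ n ∧ n ≡ 1 [MOD q] then 1 else 0 := by
        intro d
        rw [dsqCls, Finset.card_filter]; push_cast; rfl
      simp_rw [h2, Finset.mul_sum]
      rw [Finset.sum_comm]
      apply Finset.sum_congr rfl
      intro n hn
      split_ifs with h
      · apply Finset.sum_congr rfl
        intro d _
        simp [h]
      · simp [h]
    exact_mod_cast this
  · intro d hd
    rw [Finset.mem_Ioc] at hd
    by_cases h0 : d = 0
    · subst h0; simp
    · have : (dsqCls q d M).card = 0 := by
        apply Nat.eq_zero_of_le_zero
        refine (dsqCls_le q d M).trans ?_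
        rw [Nat.div_eq_of_lt]
        have : M < d := by omega
        nlinarith
      rw [this]; simp

lemma dsqCls_tendsto {q d : ℕ} (hq : 0 < q) (hd : 0 < d) :
    Tendsto (fun M : ℕ => ((dsqCls q d M).card : ℝ) / M) atTop
      (nhds (if d.Coprime q then 1 / ((d:ℝ) ^ 2 * q) else 0)) := by
  split_ifs with hco
  · have hco2 : Nat.Coprime (d ^ 2) q := Nat.Coprime.pow_left 2 hco
    obtain ⟨c, hc⟩ := Nat.chineseRemainder hco2 0 1
    have hr : 0 < d ^ 2 * q := by positivity
    have heq : ∀ M, dsqCls q d M = (Finset.Ioc 0 M).filter (fun n => n ≡ c [MOD (d ^ 2 * q)]) := by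
      intro M
      apply Finset.filter_congr
      intro n _
      rw [← Nat.modEq_and_modEq_iff_modEq_mul hco2, ← Nat.modEq_zero_iff_dvd]
      constructor
      · rintro ⟨h1, h2⟩; exact ⟨h1.trans hc.1.symm, h2.trans hc.2.symm⟩
      · rintro ⟨h1, h2⟩; exact ⟨h1.trans hc.1, h2.trans hc.2⟩
    have hbd : ∀ M : ℕ, |((dsqCls q d M).card : ℝ) - M * (1 / ((d:ℝ) ^ 2 * q))| ≤ 1 := by
      intro M
      have h1 := Nat.Ioc_filter_modEq_card 0 M hr c
      rw [← heq] at h1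
      set r : ℕ := d ^ 2 * q with hrdef
      have hrR : (d:ℝ) ^ 2 * q = ((r:ℚ):ℝ) := by rw [hrdef]; push_cast; ring
      have key : |((dsqCls q d M).card : ℚ) - M * (1 / (r:ℚ))| ≤ 1 := by
        have e1 := Int.floor_le (((M:ℚ) - c) / r)
        have e2 := Int.lt_floor_add_one (((M:ℚ) - c) / r)
        have e3 := Int.floor_le ((((0:ℕ):ℚ) - c) / r)
        have e4 := Int.lt_floor_add_one ((((0:ℕ):ℚ) - c) / r)
        have hmono : ⌊(((0:ℕ):ℚ) - c) / r⌋ ≤ ⌊((M:ℚ) - c) / r⌋ := by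
          apply Int.floor_le_floor
          gcongr
          simp
        rw [max_eq_left (by omega)] at h1
        have h1' : ((dsqCls q d M).card : ℚ) = ⌊((M:ℚ) - c) / r⌋ - ⌊(((0:ℕ):ℚ) - c) / r⌋ := by
          exact_mod_cast h1
        have e5 : ((M:ℚ) - c) / r - (((0:ℕ):ℚ) - c) / r = M * (1 / (r:ℚ)) := by
          push_cast; ring
        rw [h1', abs_le]
        constructor <;> linarith
      rw [hrR]
      exact_mod_cast key
    rw [tendsto_iff_dist_tendsto_zero]
    refine squeeze_zero' (g := fun M : ℕ => 1 / (M:ℝ)) (Eventually.of_forall fun _ => dist_nonneg) ?_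
      tendsto_one_div_atTop_nhds_zero_nat
    filter_upwards [eventually_gt_atTop 0] with M hM
    have hM' : (0:ℝ) < M := by exact_mod_cast hM
    rw [Real.dist_eq]
    have : ((dsqCls q d M).card : ℝ) / M - 1 / ((d:ℝ) ^ 2 * q)
        = (((dsqCls q d M).card : ℝ) - M * (1 / ((d:ℝ) ^ 2 * q))) / M := by
      field_simp
    rw [this, abs_div, abs_of_pos hM']
    gcongr
    exact hbd M
  · have : ∀ M, dsqCls q d M = ∅ := by
      intro M
      apply Finset.filter_eq_empty_iff.mpr
      rintro n _ ⟨h1, h2⟩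
      apply hco
      have h3 : Nat.Coprime n q := by
        have := h2.gcd_eq
        rw [Nat.Coprime, this]; simp
      exact Nat.Coprime.coprime_dvd_left ((dvd_pow_self d two_ne_zero).trans h1) h3
    simp [this]

/-- Moebius weights over `d ^ 2`, restricted to `d` coprime to `q`. -/
noncomputable def mobq (q d : ℕ) : ℝ :=
  if d.Coprime q then (ArithmeticFunction.moebius d : ℝ) / (d:ℝ) ^ 2 else 0

lemma abs_mob_le (d : ℕ) : |(ArithmeticFunction.moebius d : ℝ)| ≤ 1 := by
  exact_mod_cast ArithmeticFunction.abs_moebius_le_one (n := d)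

lemma mobq_le (q d : ℕ) : ‖mobq q d‖ ≤ 1 / (d:ℝ) ^ 2 := by
  rw [mobq]
  split_ifs
  · rw [Real.norm_eq_abs, abs_div, abs_of_nonneg (by positivity : (0:ℝ) ≤ (d:ℝ)^2)]
    gcongr
    exact abs_mob_le d
  · simp

lemma sqfCls_tendsto {q : ℕ} (hq : 0 < q) :
    Tendsto (fun M : ℕ => ((sqfCls q M).card : ℝ) / M) atTop (nhds ((∑' d, mobq q d) / q)) := by
  simp_rw [sqfCls_card, ← tsum_div_const]
  refine tendsto_tsum_of_dominated_convergence (bound := fun d : ℕ => 1 / (d:ℝ) ^ 2) ?_ ?_ ?_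
  · exact Real.summable_one_div_nat_pow.mpr one_lt_two
  · intro d
    rcases Nat.eq_zero_or_pos d with rfl | hd
    · simp [mobq]
    · have := (dsqCls_tendsto hq hd).const_mul (ArithmeticFunction.moebius d : ℝ)
      convert this using 2
      · ring
      · rw [mobq]
        split_ifs
        · field_simp
        · simp
  · filter_upwards [eventually_gt_atTop 0] with M hM d
    have hM' : (0:ℝ) < M := by exact_mod_cast hM
    have h1 : ((dsqCls q d M).card : ℝ) ≤ (M:ℝ) / (d:ℝ) ^ 2 := by
      have := Nat.cast_div_le (α := ℝ) (m := M) (n := d ^ 2)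
      push_cast at this
      refine le_trans ?_ this
      exact_mod_cast dsqCls_le q d M
    rw [Real.norm_eq_abs, abs_div, abs_mul, abs_of_pos hM', Nat.abs_cast, div_le_iff₀ hM']
    calc _ ≤ 1 * ((M:ℝ) / (d:ℝ) ^ 2) := by
          gcongr
          exact abs_mob_le d
      _ = _ := by ring

lemma mobq_hasProd (q : ℕ) : HasProd (fun p : Nat.Primes =>
    if (p:ℕ).Coprime q then 1 - 1 / ((p:ℕ):ℝ) ^ 2 else 1) (∑' d, mobq q d) := by
  have h := EulerProduct.eulerProduct_hasProd (f := mobq q) (by simp [mobq]) ?_ ?_ (by simp [mobq])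
  · have e : (fun p : Nat.Primes => if (p:ℕ).Coprime q then 1 - 1 / ((p:ℕ):ℝ) ^ 2 else 1) =
        fun p : Nat.Primes => ∑' e : ℕ, mobq q ((p:ℕ) ^ e) := ?_
    · rw [e]; exact h
    funext p
    have hp := p.2
    rw [tsum_eq_sum (s := Finset.range 2)]
    · rw [Finset.sum_range_succ, Finset.sum_range_one]
      simp only [mobq, pow_zero, pow_one, ArithmeticFunction.moebius_apply_prime hp,
        if_pos (Nat.coprime_one_left q)]
      split_ifs <;> simp
      ring
    · intro e he
      have he : 2 ≤ e := by
        have := Finset.mem_range.not.mp he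
        omega
      have hm : ArithmeticFunction.moebius ((p:ℕ) ^ e) = 0 := by
        rw [ArithmeticFunction.moebius_apply_prime_pow hp (by omega), if_neg (by omega)]
      simp [mobq, hm]
  · intro m n hmn
    simp only [mobq, Nat.coprime_mul_iff_left,
      ArithmeticFunction.isMultiplicative_moebius.map_mul_of_coprime hmn]
    push_cast
    split_ifs <;> first | (exfalso; tauto) | (simp; done) | ring
  · exact Summable.of_nonneg_of_le (fun _ => norm_nonneg _) (mobq_le q)
      (Real.summable_one_div_nat_pow.mpr one_lt_two)

lemma mobq_rel {q : ℕ} (hq : 0 < q) :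
    ∑' d, mobq 1 d = (∑' d, mobq q d) * ∏ p ∈ q.primeFactors, (1 - 1 / (p:ℝ) ^ 2) := by
  have h1 := mobq_hasProd 1
  have h2 := mobq_hasProd q
  have h3 : HasProd (fun p : Nat.Primes => if (p:ℕ) ∣ q then 1 - 1 / ((p:ℕ):ℝ) ^ 2 else 1)
      (∏ p ∈ q.primeFactors, (1 - 1 / (p:ℝ) ^ 2)) := by
    obtain ⟨s, hs⟩ : ∃ s : Finset Nat.Primes, ∀ p : Nat.Primes, p ∈ s ↔ (p:ℕ) ∈ q.primeFactors :=
      ⟨q.primeFactors.subtype Nat.Prime, fun p => Finset.mem_subtype⟩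
    have := hasProd_prod_of_ne_finset_one (L := SummationFilter.unconditional _)
      (s := s)
      (f := fun p : Nat.Primes => if (p:ℕ) ∣ q then 1 - 1 / ((p:ℕ):ℝ) ^ 2 else 1) ?_
    · convert this using 1
      symm
      refine Finset.prod_bij (fun (p : Nat.Primes) _ => (p:ℕ)) ?_ ?_ ?_ ?_
      · intro p hp
        exact (hs p).mp hp
      · intro a _ b _ h
        exact Subtype.ext h
      · intro b hb
        exact ⟨⟨b, Nat.prime_of_mem_primeFactors hb⟩, (hs _).mpr hb, rfl⟩
      · intro p hp
        have : (p:ℕ) ∈ q.primeFactors := (hs p).mp hp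
        rw [if_pos (Nat.dvd_of_mem_primeFactors this)]
    · intro p hp
      rw [if_neg]
      intro h
      apply hp
      rw [hs]
      exact Nat.mem_primeFactors.mpr ⟨p.2, h, hq.ne'⟩
  refine h1.unique ?_
  convert h2.mul h3 using 2 with p
  have := p.2.coprime_iff_not_dvd (n := q)
  by_cases h : (p:ℕ) ∣ q <;> simp [this, h]

lemma mob1_ne : ∑' d, mobq 1 d ≠ 0 := by
  intro h
  have h1 := LSeries_one_mul_Lseries_moebius (s := 2) (by norm_num)
  have h2 : LSeries (fun n => ((ArithmeticFunction.moebius n : ℤ) : ℂ)) 2 = ((∑' d, mobq 1 d : ℝ) : ℂ) := by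
    rw [LSeries, Complex.ofReal_tsum]
    congr 1
    ext n
    rcases Nat.eq_zero_or_pos n with rfl | hn
    · simp [mobq]
    · rw [LSeries.term_of_ne_zero hn.ne']
      simp [mobq]
  rw [h2, h] at h1
  simp at h1

lemma ratio_tendsto {q : ℕ} (hq : 0 < q) :
    Tendsto (fun M : ℕ => ((sqfCls q M).card : ℝ) / ((sqfCls 1 M).card : ℝ)) atTop
      (nhds (1 / (q * ∏ p ∈ q.primeFactors, (1 - 1 / (p:ℝ) ^ 2)))) := by
  have h1 := (sqfCls_tendsto hq).div (sqfCls_tendsto one_pos) (by simpa using mob1_ne)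
  have hne := mob1_ne
  have hrel := mobq_rel hq
  have hlim : (∑' d, mobq q d) / q / ((∑' d, mobq 1 d) / ((1:ℕ):ℝ))
      = 1 / (q * ∏ p ∈ q.primeFactors, (1 - 1 / (p:ℝ) ^ 2)) := by
    rw [hrel] at hne ⊢
    have ha := left_ne_zero_of_mul hne
    have hb := right_ne_zero_of_mul hne
    have : (q:ℝ) ≠ 0 := by positivity
    push_cast
    field_simp
  rw [hlim] at h1
  refine h1.congr' ?_
  filter_upwards [eventually_gt_atTop 0] with M hM
  have hM' : (M:ℝ) ≠ 0 := by positivity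
  simp only [Pi.div_apply]
  rw [div_div_div_cancel_right₀ hM']

lemma euler_const {a : ℕ} (ha0 : 0 < a) (ha : Squarefree a) (h12 : a % 12 = 1) :
    1 / (((12 * a : ℕ) : ℝ) * ∏ p ∈ (12 * a).primeFactors, (1 - 1 / (p:ℝ) ^ 2)) =
    (1 / 8 : ℝ) * ∏ p ∈ a.primeFactors, (p : ℝ) / (((p : ℝ) - 1) * ((p : ℝ) + 1)) := by
  have hco : Nat.Coprime 12 a := by
    rw [Nat.coprime_iff_gcd_eq_one, Nat.gcd_rec, h12]; simp
  have h12p : (12:ℕ).primeFactors = {2, 3} := by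
    rw [show 12 = 2 ^ 2 * 3 by norm_num, Nat.primeFactors_mul (by norm_num) (by norm_num),
      Nat.primeFactors_prime_pow (by norm_num) Nat.prime_two, Nat.prime_three.primeFactors]
    rfl
  rw [hco.primeFactors_mul, Finset.prod_union hco.disjoint_primeFactors, h12p,
    Finset.prod_pair (by norm_num)]
  have hprod : (a:ℝ) = ∏ p ∈ a.primeFactors, (p:ℝ) := by
    rw [← Nat.cast_prod, Nat.prod_primeFactors_of_squarefree ha]
  have hX : ∏ p ∈ a.primeFactors, (p : ℝ) / (((p : ℝ) - 1) * ((p : ℝ) + 1)) =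
      1 / ((a:ℝ) * ∏ p ∈ a.primeFactors, (1 - 1 / (p:ℝ) ^ 2)) := by
    rw [hprod, ← Finset.prod_mul_distrib, one_div, ← Finset.prod_inv_distrib]
    apply Finset.prod_congr rfl
    intro p hp
    have h2 : (2:ℝ) ≤ p := by exact_mod_cast (Nat.prime_of_mem_primeFactors hp).two_le
    have e1 : (p:ℝ) - 1 ≠ 0 := by linarith
    have e2 : (p:ℝ) + 1 ≠ 0 := by linarith
    have e3 : (p:ℝ) ≠ 0 := by linarith
    have e4 : (p:ℝ) * (1 - 1 / (p:ℝ) ^ 2) = ((p:ℝ) - 1) * (p + 1) / p := by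
      field_simp
      ring
    rw [e4, inv_div]
  rw [hX]
  push_cast
  generalize ∏ p ∈ a.primeFactors, (1 - 1 / (p:ℝ) ^ 2) = P
  rw [div_mul_div_comm, one_mul]
  congr 1
  ring

lemma lt_iff_le_ceil {n : ℕ} (hn : 0 < n) (Y : ℝ) : (n:ℝ) < Y ↔ n ≤ ⌈Y⌉₊ - 1 := by
  rw [← Nat.lt_ceil]; omega

lemma T_card (Y : ℝ) : Nat.card (T Y) = (sqfCls 1 (⌈Y⌉₊ - 1)).card := by
  have : T Y = (fun n : ℕ => (n:ℤ)) '' (sqfCls 1 (⌈Y⌉₊ - 1) : Set ℕ) := by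
    ext D
    simp only [T, sqfCls, Set.mem_ofPred_eq, Set.mem_image, Finset.coe_filter, Finset.mem_Ioc]
    constructor
    · rintro ⟨h1, h2, h3⟩
      lift D to ℕ using h1.le
      have h1' : 0 < D := by exact_mod_cast h1
      refine ⟨D, ⟨⟨h1', ?_⟩, ?_, Nat.modEq_one⟩, rfl⟩
      · rw [← lt_iff_le_ceil h1']; exact_mod_cast h2
      · rw [← Int.squarefree_natAbs] at h3
        simpa using h3
    · rintro ⟨n, ⟨⟨h1, h2⟩, h3, _⟩, rfl⟩
      rw [← lt_iff_le_ceil h1] at h2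
      refine ⟨by exact_mod_cast h1, by exact_mod_cast h2, ?_⟩
      rw [← Int.squarefree_natAbs]
      simpa using h3
  rw [this, Nat.card_image_of_injective (fun a b h => by simpa using h)]
  simp

lemma N_card (a : ℕ) (ha0 : 0 < a) (ha : Squarefree a) (h12 : a % 12 = 1) (X : ℝ) :
    Nat.card (Nminus X (48 * (a:ℤ) ^ 2 - 4 * (a:ℤ)) (48 * (a:ℤ) ^ 2)) =
      (sqfCls (12 * a) (⌈X / (4 * (a:ℝ))⌉₊ - 1)).card := by
  have ha0R : (0:ℝ) < a := by exact_mod_cast ha0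
  have hlt : ∀ n : ℕ, (-X < (((-4 * (a:ℤ) * (n:ℤ) : ℤ)) : ℝ)) ↔ (n:ℝ) < X / (4 * (a:ℝ)) := by
    intro n
    rw [lt_div_iff₀ (by positivity)]
    push_cast
    constructor <;> intro h <;> linarith
  have : Nminus X (48 * (a:ℤ) ^ 2 - 4 * (a:ℤ)) (48 * (a:ℤ) ^ 2) =
      (fun n : ℕ => -4 * (a:ℤ) * (n:ℤ)) '' (sqfCls (12 * a) (⌈X / (4 * (a:ℝ))⌉₊ - 1) : Set ℕ) := by
    ext D
    simp only [Nminus, sqfCls, Set.mem_ofPred_eq, Set.mem_image, Finset.coe_filter, Finset.mem_Ioc]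
    constructor
    · rintro ⟨h1, h2, ⟨_, h3⟩, h4⟩
      obtain ⟨t, ht⟩ := h4.dvd
      have hk : D = -4 * (a:ℤ) * (1 + 12 * a * (t - 1)) := by linear_combination -ht
      obtain ⟨k, hkdef⟩ : ∃ k : ℤ, k = 1 + 12 * a * (t - 1) := ⟨_, rfl⟩
      rw [← hkdef] at hk
      have hkpos : 0 < k := by
        by_contra hcon
        push Not at hcon
        have : (0:ℤ) < a := by exact_mod_cast ha0
        nlinarith
      lift k to ℕ using hkpos.le
      have hk0 : 0 < k := by exact_mod_cast hkpos
      refine ⟨k, ⟨⟨hk0, ?_⟩, ?_, ?_⟩, hk.symm⟩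
      · rw [← lt_iff_le_ceil hk0, ← hlt, ← hk]; exact h1
      · rcases h3 with ⟨_, h3⟩ | ⟨m', hm, hsf, _⟩
        · exfalso
          have : D = 4 * (-(a:ℤ) * k) := by rw [hk]; ring
          omega
        · have : m' = -(a * k : ℕ) := by
            push_cast
            linarith
          rw [this, ← Int.squarefree_natAbs, Int.natAbs_neg, Int.natAbs_natCast] at hsf
          exact hsf.of_mul_right
      · rw [← Int.natCast_modEq_iff, Int.modEq_comm]
        apply Int.modEq_of_dvd
        push_cast
        exact ⟨t - 1, by rw [hkdef]; ring⟩
    · rintro ⟨k, ⟨⟨h1, h2⟩, h3, h4⟩, rfl⟩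
      have hkm4 : (a * k) % 4 = 1 := by
        have e1 : k % 4 = 1 := Nat.ModEq.of_dvd (show 4 ∣ 12 * a from ⟨3 * a, by ring⟩) h4
        have e2 : a % 4 = 1 := by omega
        rw [Nat.mul_mod, e1, e2]
      have hkco : Nat.Coprime a k := by
        have : k ≡ 1 [MOD a] := h4.of_dvd ⟨12, by ring⟩
        have := this.gcd_eq
        rw [Nat.Coprime, Nat.gcd_comm, this]; simp
      have hneg : -4 * (a:ℤ) * (k:ℤ) < 0 := by
        have : (0:ℤ) < a * k := by positivity
        linarith
      refine ⟨?_, hneg, ⟨by omega, Or.inr ⟨-(a * k : ℕ), by push_cast; ring, ?_, by right; omega⟩⟩, ?_⟩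
      · rw [hlt, lt_iff_le_ceil h1]; exact h2
      · rw [← Int.squarefree_natAbs, Int.natAbs_neg, Int.natAbs_natCast]
        exact (Nat.squarefree_mul hkco).mpr ⟨ha, h3⟩
      · rw [← Int.natCast_modEq_iff, Int.modEq_comm] at h4
        obtain ⟨t, ht⟩ := h4.dvd
        apply Int.modEq_of_dvd
        refine ⟨1 + t, ?_⟩
        push_cast at ht
        linear_combination 4 * (a:ℤ) * ht
  rw [this, Nat.card_image_of_injective]
  · simp
  · intro x y h
    simpa [ha0.ne'] using h

/-- For a positive square-free integer `A ≡ 1 (mod 12)` and `m = 48A² - 4A`, the ratio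
`#N⁻(X, m, 48A²) / #T(X/(4A))` tends to `(1/8) · ∏_{p ∣ A} p / ((p-1)(p+1))` as
`X → ∞`. -/
theorem density_of_twisted_discriminants
    (A : ℤ) (hApos : 0 < A) (hAsf : Squarefree A) (hAmod : A % 12 = 1) :
    Tendsto (fun X : ℝ =>
        (Nat.card (Nminus X (48 * A ^ 2 - 4 * A) (48 * A ^ 2)) : ℝ) /
          (Nat.card (T (X / (4 * (A : ℝ)))) : ℝ))
      atTop
      (nhds ((1 / 8 : ℝ) *
        ∏ p ∈ A.natAbs.primeFactors, (p : ℝ) / (((p : ℝ) - 1) * ((p : ℝ) + 1)))) := by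
  lift A to ℕ using hApos.le
  have ha0 : 0 < A := by exact_mod_cast hApos
  have ha : Squarefree A := by
    rw [← Int.squarefree_natAbs] at hAsf
    simpa using hAsf
  have h12 : A % 12 = 1 := by omega
  simp only [Int.natAbs_natCast, Int.cast_natCast]
  rw [← euler_const ha0 ha h12]
  simp_rw [N_card A ha0 ha h12, T_card]
  have ha0R : (0:ℝ) < A := by exact_mod_cast ha0
  have hlim : Tendsto (fun X : ℝ => ⌈X / (4 * (A:ℝ))⌉₊ - 1) atTop atTop :=
    (tendsto_sub_atTop_nat 1).comp
      (tendsto_nat_ceil_atTop.comp (tendsto_id.atTop_div_const (by positivity)))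
  exact (ratio_tendsto (q := 12 * A) (by positivity)).comp hlim
end

section
/- Let A be a positive square-free integer with A ≡ 1 or 25 (mod 36) such that dim_{𝔽₃} Cl(ℚ(√(−A)))[3] = 0. Then there exist a real number ε with 0 < ε < 1 and a constant c > 0 such that for all sufficiently large X, #{D ∈ ℤ : 0 < D < X, D is cube-free, and rank E^D(ℚ) = 0} ≥ c·X/(log X)^ε, where E^D is the cubic twist given by y² = x³ − A·D². -/
open Filter IntermediateField

/-- The Mordell curve `y² = x³ + a` as a Weierstrass curve over `ℚ`. -/
noncomputable def MordellCurve (a : ℤ) : WeierstrassCurve ℚ :=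
  { a₁ := 0, a₂ := 0, a₃ := 0, a₄ := 0, a₆ := (a : ℚ) }

/-- The Mordell–Weil rank of `y² = x³ + a` over `ℚ`. -/
noncomputable def mordellRank (a : ℤ) : ℕ :=
  Module.finrank ℤ (MordellCurve a).toAffine.Point

/-- A square root of the integer `m` in `ℂ`. -/
noncomputable def sqrtC (m : ℤ) : ℂ := (m : ℂ) ^ (2⁻¹ : ℂ)

/-- The quadratic field `ℚ(√m)`, realized as a subfield of `ℂ`. -/
noncomputable def quadField (m : ℤ) : IntermediateField ℚ ℂ := ℚ⟮sqrtC m⟯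

/-- An integer `D` is cube-free if no cube of a prime divides it. -/
def IsCubeFree (D : ℤ) : Prop := ∀ p : ℕ, p.Prime → ¬ ((p : ℤ) ^ 3 ∣ D)


/-- Conditions on the twisting parameter `D` under which the descent works. -/
structure GoodTwist (A D : ℤ) : Prop where
  Apos : 0 < A
  Asf : Squarefree A
  A4 : A % 4 = 1
  A3 : A % 3 = 1
  D0 : D ≠ 0
  two : D % 2 = 1 ∨ ∃ d, D = 4 * d ∧ d % 2 = 1
  h9 : (A * D ^ 2) % 9 = 7
  copA : IsCoprime D A
  sq : ∀ p : ℤ, Prime p → p ∣ D → ¬ (2 ∣ p) → ¬ (p ^ 2 ∣ D)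
  inert : ∀ p : ℤ, Prime p → p ∣ D → ¬ (2 ∣ p) → ∀ x y : ℤ, p ∣ x ^ 2 + A * y ^ 2 → p ∣ x ∧ p ∣ y
  inert' : ∀ p : ℤ, Prime p → p ∣ D → ¬ (2 ∣ p) →
    ∀ x y : ℤ, p ∣ x ^ 2 - 3 * A * y ^ 2 → p ∣ x ∧ p ∣ y

lemma isCoprime_of_no_prime {a b : ℤ} (h0 : a ≠ 0 ∨ b ≠ 0)
    (h : ∀ p : ℤ, Prime p → p ∣ a → p ∣ b → False) : IsCoprime a b := by
  apply isCoprime_of_prime_dvd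
  · tauto
  · intro p hp ha hb
    exact h p hp ha hb

lemma prime_even_dvd {p n : ℤ} (hp : Prime p) (h2 : 2 ∣ p) (h : p ∣ n) : 2 ∣ n :=
  h2.trans h

lemma prime_even_of_dvd {p n : ℤ} (hp : Prime p) (h2 : 2 ∣ p) (h : 2 ∣ n) : p ∣ n := by
  have : Associated (2 : ℤ) p := (Int.prime_two.dvd_prime_iff_associated hp).1 h2
  exact this.symm.dvd.trans h

namespace GoodTwist
variable {A D : ℤ}

lemma not_three_dvd_D (g : GoodTwist A D) : ¬ (3 ∣ D) := by
  rintro ⟨d, rfl⟩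
  have := g.h9
  have h : A * (3 * d) ^ 2 = 9 * (A * d ^ 2) := by ring
  rw [h] at this
  omega

/-- parity argument for `m ^ 2 + B * (D z) ^ 2 = x ^ 3`, `B ≡ 1 mod 4`. -/
lemma odd_aux (g : GoodTwist A D) {B m z x : ℤ} (hB : B % 4 = 1) (hxz : IsCoprime x z)
    (h : m ^ 2 + B * D ^ 2 * z ^ 6 = x ^ 3) : ¬ (2 ∣ x) := by
  intro hx
  have hz : z % 2 = 1 := by
    by_contra hz
    have h2z : (2:ℤ) ∣ z := by omega
    have := hxz.isUnit_of_dvd' hx h2z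
    exact Int.prime_two.not_isUnit this
  obtain ⟨x1, rfl⟩ := hx
  have key : ∀ n w : ℤ, w % 2 = 1 → (n ^ 2 + B * w ^ 2) % 4 ≠ 0 := by
    intro n w hw
    have hw2 : w ^ 2 % 4 = 1 := Int.sq_mod_four_eq_one_of_odd (Int.odd_iff.2 hw)
    have hB2 : (B * w ^ 2) % 4 = 1 := by rw [Int.mul_emod, hB, hw2]; rfl
    rcases Int.even_or_odd n with hn | hn
    · obtain ⟨k, rfl⟩ := hn
      have : (k + k) ^ 2 = 4 * k ^ 2 := by ring
      omega
    · have := Int.sq_mod_four_eq_one_of_odd hn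
      omega
  have hz3 : z ^ 3 % 2 = 1 := Int.odd_iff.1 ((Int.odd_iff.2 hz).pow)
  rcases g.two with hD | ⟨d, rfl, hd⟩
  · apply key m (D * z ^ 3)
    · rw [Int.mul_emod, hD, hz3]; rfl
    · have : m ^ 2 + B * (D * z ^ 3) ^ 2 = 4 * (2 * x1 ^ 3) := by
        linear_combination h
      omega
  · -- m even, etc.
    have h1 : (2:ℤ) ∣ m ^ 2 := ⟨4 * x1 ^ 3 - 8 * B * d ^ 2 * z ^ 6, by linear_combination h⟩
    obtain ⟨m1, rfl⟩ := Int.prime_two.dvd_of_dvd_pow h1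
    have h2 : (2:ℤ) ∣ m1 ^ 2 := ⟨x1 ^ 3 - 2 * B * d ^ 2 * z ^ 6, by linarith⟩
    obtain ⟨m2, rfl⟩ := Int.prime_two.dvd_of_dvd_pow h2
    have h3 : (2:ℤ) ∣ x1 ^ 3 := ⟨m2 ^ 2 + B * d ^ 2 * z ^ 6, by linarith⟩
    obtain ⟨x2, rfl⟩ := Int.prime_two.dvd_of_dvd_pow h3
    apply key m2 (d * z ^ 3)
    · rw [Int.mul_emod, hd, hz3]; rfl
    · have : m2 ^ 2 + B * (d * z ^ 3) ^ 2 = 4 * x2 ^ 3 := by linarith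
      omega

/-- On `Y² + A D² Z⁶ = X³`, the number `X` is coprime to `2AD`. -/
lemma coprime_X (g : GoodTwist A D) {X Y Z : ℤ} (hXZ : IsCoprime X Z)
    (h : Y ^ 2 + A * D ^ 2 * Z ^ 6 = X ^ 3) : IsCoprime X (2 * A * D) := by
  apply isCoprime_of_no_prime
  · right; have := g.D0; have := g.Apos.ne'; positivity
  intro p hp hpX hpD
  have hpZ : ¬ p ∣ Z := fun hz => hp.not_isUnit (hXZ.isUnit_of_dvd' hpX hz)
  have h2 : ¬ (2 ∣ p) := fun h2 => g.odd_aux g.A4 hXZ h (h2.trans hpX)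
  have hp2 : ¬ p ∣ 2 := by
    intro hh
    have : Associated p 2 := (hp.dvd_prime_iff_associated Int.prime_two).1 hh
    exact h2 this.symm.dvd
  rcases hp.dvd_or_dvd hpD with hp2A | hpD
  · rcases hp.dvd_or_dvd hp2A with h | hpA
    · exact hp2 h
    · have hY : p ∣ Y ^ 2 := by
        have : Y ^ 2 = X ^ 3 - A * D ^ 2 * Z ^ 6 := by linarith
        rw [this]
        exact dvd_sub (dvd_pow hpX (by norm_num)) ((hpA.mul_right _).mul_right _)
      have hY := hp.dvd_of_dvd_pow hY
      obtain ⟨a, ha⟩ := hpA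
      obtain ⟨x, rfl⟩ := hpX
      obtain ⟨y, rfl⟩ := hY
      have h3 : p ∣ a * (D ^ 2 * Z ^ 6) := by
        refine ⟨p * x ^ 3 - y ^ 2, ?_⟩
        have hp0 := hp.ne_zero
        apply mul_left_cancel₀ hp0
        rw [ha] at h
        linear_combination h
      rcases hp.dvd_or_dvd h3 with h4 | h4
      · have := g.Asf p (by rw [ha]; exact mul_dvd_mul_left p h4)
        exact hp.not_isUnit this
      · rcases hp.dvd_or_dvd h4 with h5 | h5
        · exact hp.not_isUnit (g.copA.isUnit_of_dvd' (hp.dvd_of_dvd_pow h5) (by rw [ha]; exact dvd_mul_right _ _))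
        · exact hpZ (hp.dvd_of_dvd_pow h5)
  · obtain ⟨d, hd⟩ := id hpD
    have hY : p ∣ Y ^ 2 := by
      have : Y ^ 2 = X ^ 3 - A * D ^ 2 * Z ^ 6 := by linarith
      rw [this]
      exact dvd_sub (dvd_pow hpX (by norm_num)) (((dvd_pow hpD two_ne_zero).mul_left _).mul_right _)
    have hY := hp.dvd_of_dvd_pow hY
    obtain ⟨x, rfl⟩ := hpX
    obtain ⟨y, rfl⟩ := hY
    have h3 : p ∣ y ^ 2 + A * (d * Z ^ 3) ^ 2 := by
      refine ⟨x ^ 3, ?_⟩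
      have hp0 : p ^ 2 ≠ 0 := pow_ne_zero 2 hp.ne_zero
      apply mul_left_cancel₀ hp0
      rw [hd] at h
      linear_combination h
    have h4 := (g.inert p hp hpD h2 _ _ h3).2
    rcases hp.dvd_or_dvd h4 with h5 | h5
    · apply g.sq p hp hpD h2
      rw [hd, pow_two]; exact mul_dvd_mul_left p h5
    · exact hpZ (hp.dvd_of_dvd_pow h5)

/-- On `a² - 27 A D² z⁶ = w³` with `3 ∤ a`, the number `w` is coprime to `6ADz`. -/
lemma coprime_w (g : GoodTwist A D) {a z w : ℤ} (haz : IsCoprime a z) (h3 : ¬ 3 ∣ a)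
    (h : a ^ 2 - 27 * A * D ^ 2 * z ^ 6 = w ^ 3) : IsCoprime w (6 * A * D * z) := by
  have hp3 : Prime (3:ℤ) := Int.prime_three
  have h3w : ¬ 3 ∣ w := by
    rintro ⟨k, rfl⟩
    exact h3 (hp3.dvd_of_dvd_pow (n := 2) ⟨9 * k ^ 3 + 9 * A * D ^ 2 * z ^ 6, by linear_combination h⟩)
  have hwz : IsCoprime w z := by
    apply isCoprime_of_no_prime
    · left; rintro rfl; simp at h3w
    intro p hp hpw hpz
    have : p ∣ a ^ 2 := by
      have : a ^ 2 = w ^ 3 + 27 * A * D ^ 2 * z ^ 6 := by linarith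
      rw [this]
      exact dvd_add (dvd_pow hpw (by norm_num)) ((dvd_pow hpz (by norm_num)).mul_left _)
    exact hp.not_isUnit (haz.isUnit_of_dvd' (hp.dvd_of_dvd_pow this) hpz)
  have h' : a ^ 2 + (-27 * A) * D ^ 2 * z ^ 6 = w ^ 3 := by linarith
  have hw2 : ¬ 2 ∣ w := g.odd_aux (by have := g.A4; omega) hwz h'
  apply isCoprime_of_no_prime
  · left; rintro rfl; simp at h3w
  intro p hp hpX hpD
  have hpZ : ¬ p ∣ z := fun hz => hp.not_isUnit (hwz.isUnit_of_dvd' hpX hz)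
  have h2 : ¬ (2 ∣ p) := fun h2 => hw2 (h2.trans hpX)
  have hp2 : ¬ p ∣ 2 := by
    intro hh
    have : Associated p 2 := (hp.dvd_prime_iff_associated Int.prime_two).1 hh
    exact h2 this.symm.dvd
  have hpp3 : ¬ p ∣ 3 := by
    intro hh
    have : Associated p 3 := (hp.dvd_prime_iff_associated Int.prime_three).1 hh
    exact h3w (this.symm.dvd.trans hpX)
  have hp27 : ¬ p ∣ 27 := fun hh => hpp3 (hp.dvd_of_dvd_pow (n := 3) (by norm_num; exact hh))
  rcases hp.dvd_or_dvd hpD with hpD | hpz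
  swap
  · exact hpZ hpz
  rcases hp.dvd_or_dvd hpD with hp2A | hpD
  · rcases hp.dvd_or_dvd hp2A with h | hpA
    · have : p ∣ 2 * 3 := by norm_num; exact h
      rcases hp.dvd_or_dvd this with h | h
      · exact hp2 h
      · exact hpp3 h
    · have hY : p ∣ a ^ 2 := by
        have : a ^ 2 = w ^ 3 + 27 * A * D ^ 2 * z ^ 6 := by linarith
        rw [this]
        exact dvd_add (dvd_pow hpX (by norm_num)) (((hpA.mul_left _).mul_right _).mul_right _)
      have hY := hp.dvd_of_dvd_pow hY
      obtain ⟨A1, ha⟩ := hpA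
      obtain ⟨x, rfl⟩ := hpX
      obtain ⟨y, rfl⟩ := hY
      have h3 : p ∣ 27 * (A1 * (D ^ 2 * z ^ 6)) := by
        refine ⟨y ^ 2 - p * x ^ 3, ?_⟩
        have hp0 := hp.ne_zero
        apply mul_left_cancel₀ hp0
        rw [ha] at h
        linear_combination -h
      rcases hp.dvd_or_dvd h3 with h4 | h4
      · exact hp27 h4
      rcases hp.dvd_or_dvd h4 with h4 | h4
      · have := g.Asf p (by rw [ha]; exact mul_dvd_mul_left p h4)
        exact hp.not_isUnit this
      · rcases hp.dvd_or_dvd h4 with h5 | h5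
        · exact hp.not_isUnit (g.copA.isUnit_of_dvd' (hp.dvd_of_dvd_pow h5) (by rw [ha]; exact dvd_mul_right _ _))
        · exact hpZ (hp.dvd_of_dvd_pow h5)
  · obtain ⟨d, hd⟩ := id hpD
    have hY : p ∣ a ^ 2 := by
      have : a ^ 2 = w ^ 3 + 27 * A * D ^ 2 * z ^ 6 := by linarith
      rw [this]
      exact dvd_add (dvd_pow hpX (by norm_num)) (((dvd_pow hpD two_ne_zero).mul_left _).mul_right _)
    have hY := hp.dvd_of_dvd_pow hY
    obtain ⟨x, rfl⟩ := hpX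
    obtain ⟨y, rfl⟩ := hY
    have h3 : p ∣ y ^ 2 - 3 * A * (3 * d * z ^ 3) ^ 2 := by
      refine ⟨x ^ 3, ?_⟩
      have hp0 : p ^ 2 ≠ 0 := pow_ne_zero 2 hp.ne_zero
      apply mul_left_cancel₀ hp0
      rw [hd] at h
      linear_combination h
    have h4 := (g.inert' p hp hpD h2 _ _ h3).2
    rcases hp.dvd_or_dvd h4 with h5 | h5
    · rcases hp.dvd_or_dvd h5 with h5 | h5
      · exact hpp3 h5
      apply g.sq p hp hpD h2
      rw [hd, pow_two]; exact mul_dvd_mul_left p h5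
    · exact hpZ (hp.dvd_of_dvd_pow h5)

lemma val_two_aux (g : GoodTwist A D) {v n Z : ℤ} (hv : v % 2 = 1) (hn : n % 4 = 2) (h : D * Z ^ 3 = v * n) : False := by
  have h1 : (v * n) % 4 = 2 := by
    obtain ⟨k, hk⟩ : ∃ k, v = 2 * k + 1 := ⟨v / 2, by omega⟩
    obtain ⟨l, hl⟩ : ∃ l, n = 4 * l + 2 := ⟨n / 4, by omega⟩
    have : v * n = 4 * (2 * k * l + k + l) + 2 := by rw [hk, hl]; ring
    omega
  rcases g.two with hD | ⟨d, rfl, hd⟩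
  · have hZ : 2 ∣ D * Z ^ 3 := by omega
    have h2D : ¬ (2:ℤ) ∣ D := by omega
    obtain ⟨z, rfl⟩ := Int.prime_two.dvd_of_dvd_pow ((Int.prime_two.dvd_or_dvd hZ).resolve_left h2D)
    have : D * (2 * z) ^ 3 = 4 * (2 * D * z ^ 3) := by ring
    omega
  · have : 4 * d * Z ^ 3 = 4 * (d * Z ^ 3) := by ring
    omega

/-- First half of the descent. -/
lemma descent_one (g : GoodTwist A D) {a b Z : ℤ} (hab : IsCoprime a b) (hZ : Z ≠ 0)
    (h : D * Z ^ 3 = b * (3 * a ^ 2 - A * b ^ 2)) :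
    ∃ z w : ℤ, a ^ 2 - 27 * A * D ^ 2 * z ^ 6 = w ^ 3 ∧ ¬ 3 ∣ a ∧ IsCoprime a z ∧ Z = 3 * z * w := by
  have hp3 : Prime (3:ℤ) := Int.prime_three
  have hA4 := g.A4
  have hcop : IsCoprime D (3 * a ^ 2 - A * b ^ 2) := by
    apply isCoprime_of_no_prime (Or.inl g.D0)
    intro p hp hpD hpn
    by_cases h2 : 2 ∣ p
    · have h2n : 2 ∣ 3 * a ^ 2 - A * b ^ 2 := h2.trans hpn
      have hb : b % 2 = 1 := by
        by_contra hb
        obtain ⟨c, rfl⟩ : 2 ∣ b := by omega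
        have : (2:ℤ) ∣ a ^ 2 := by
          have : A * (2 * c) ^ 2 = 2 * (2 * A * c ^ 2) := by ring
          omega
        exact Int.prime_two.not_isUnit (hab.isUnit_of_dvd' (Int.prime_two.dvd_of_dvd_pow this)
          (dvd_mul_right _ _))
      have hb2 : b ^ 2 % 4 = 1 := Int.sq_mod_four_eq_one_of_odd (Int.odd_iff.2 hb)
      have hAb : (A * b ^ 2) % 4 = 1 := by rw [Int.mul_emod, hA4, hb2]; rfl
      have ha : a % 2 = 1 := by
        by_contra ha
        obtain ⟨c, rfl⟩ : 2 ∣ a := by omega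
        have : 3 * (2 * c) ^ 2 = 4 * (3 * c ^ 2) := by ring
        omega
      have ha2 : a ^ 2 % 4 = 1 := Int.sq_mod_four_eq_one_of_odd (Int.odd_iff.2 ha)
      exact g.val_two_aux hb (n := 3 * a ^ 2 - A * b ^ 2) (by omega) h
    · have h3 : p ∣ (3 * a) ^ 2 - 3 * A * b ^ 2 := by
        have : (3 * a) ^ 2 - 3 * A * b ^ 2 = 3 * (3 * a ^ 2 - A * b ^ 2) := by ring
        rw [this]; exact hpn.mul_left _
      obtain ⟨h4, h5⟩ := g.inert' p hp hpD h2 _ _ h3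
      rcases hp.dvd_or_dvd h4 with h6 | h6
      · have : Associated p 3 := (hp.dvd_prime_iff_associated Int.prime_three).1 h6
        exact g.not_three_dvd_D (this.symm.dvd.trans hpD)
      · exact hp.not_isUnit (hab.isUnit_of_dvd' h6 h5)
  obtain ⟨c, rfl⟩ : D ∣ b := hcop.dvd_of_dvd_mul_right ⟨Z ^ 3, h.symm⟩
  have h1 : c * (3 * a ^ 2 - A * D ^ 2 * c ^ 2) = Z ^ 3 := by
    apply mul_left_cancel₀ g.D0
    linear_combination -h
  have hac : IsCoprime a c := hab.of_mul_right_right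
  by_cases hc : 3 ∣ c
  · have h3a : ¬ 3 ∣ a := fun h3a => hp3.not_isUnit (hac.isUnit_of_dvd' h3a hc)
    obtain ⟨e, rfl⟩ := hc
    obtain ⟨Y, rfl⟩ : 3 ∣ Z := hp3.dvd_of_dvd_pow (n := 3)
      ⟨3 * (e * (a ^ 2 - 3 * A * D ^ 2 * e ^ 2)), by linear_combination -h1⟩
    have h2 : e * (a ^ 2 - 3 * A * D ^ 2 * e ^ 2) = 3 * Y ^ 3 := by linarith
    have h3e : 3 ∣ e := by
      have : 3 ∣ e * (a ^ 2 - 3 * A * D ^ 2 * e ^ 2) := ⟨_, h2⟩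
      rcases hp3.dvd_or_dvd this with h | h
      · exact h
      · exfalso
        apply h3a
        apply hp3.dvd_of_dvd_pow (n := 2)
        obtain ⟨k, hk⟩ := h
        exact ⟨k + A * D ^ 2 * e ^ 2, by linarith⟩
    obtain ⟨f, rfl⟩ := h3e
    have h4 : f * (a ^ 2 - 27 * A * D ^ 2 * f ^ 2) = Y ^ 3 := by linarith
    have haf : IsCoprime a f := hac.of_mul_right_right.of_mul_right_right
    have hcf : IsCoprime f (a ^ 2 - 27 * A * D ^ 2 * f ^ 2) := by
      have : IsCoprime f (a ^ 2) := (haf.pow_left).symm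
      have h6 := this.add_mul_left_right (-27 * A * D ^ 2 * f)
      have e : a ^ 2 + f * (-27 * A * D ^ 2 * f) = a ^ 2 - 27 * A * D ^ 2 * f ^ 2 := by ring
      rwa [e] at h6
    obtain ⟨z, hz⟩ := Int.eq_pow_of_mul_eq_pow_odd_left hcf (by decide : Odd 3) h4
    obtain ⟨w, hw⟩ := Int.eq_pow_of_mul_eq_pow_odd_right hcf (by decide : Odd 3) h4
    refine ⟨z, w, ?_, h3a, ?_, ?_⟩
    · rw [← hw, hz]; ring
    · rw [hz] at haf
      exact (IsCoprime.pow_right_iff (by norm_num)).1 haf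
    · rw [hw, hz, ← mul_pow] at h4
      have := (Odd.pow_injective (R := ℤ) (by decide : Odd 3)) h4
      rw [← this]; ring
  · exfalso
    have hcf : IsCoprime c (3 * a ^ 2 - A * D ^ 2 * c ^ 2) := by
      have h5 : IsCoprime c (3 * a ^ 2) := by
        refine IsCoprime.mul_right ?_ (hac.pow_left).symm
        exact ((Prime.coprime_iff_not_dvd hp3).2 hc).symm
      have h6 := h5.add_mul_left_right (-(A * D ^ 2 * c))
      have e : 3 * a ^ 2 + c * (-(A * D ^ 2 * c)) = 3 * a ^ 2 - A * D ^ 2 * c ^ 2 := by ring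
      rwa [e] at h6
    obtain ⟨z, hz⟩ := Int.eq_pow_of_mul_eq_pow_odd_left hcf (by decide : Odd 3) h1
    obtain ⟨w, hw⟩ := Int.eq_pow_of_mul_eq_pow_odd_right hcf (by decide : Odd 3) h1
    have h9 := g.h9
    have hz3 : ¬ 3 ∣ z := fun h => hc (by rw [hz]; exact dvd_pow h (by norm_num))
    have hz6 : z ^ 6 % 9 = 1 := by
      have : z % 9 = 1 ∨ z % 9 = 2 ∨ z % 9 = 4 ∨ z % 9 = 5 ∨ z % 9 = 7 ∨ z % 9 = 8 := by omega
      rcases this with h | h | h | h | h | h <;> simp [pow_succ, Int.mul_emod, h]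
    have e1 : (A * D ^ 2 * c ^ 2) % 9 = 7 := by
      have : A * D ^ 2 * c ^ 2 = (A * D ^ 2) * z ^ 6 := by rw [hz]; ring
      rw [this, Int.mul_emod, h9, hz6]; rfl
    have e2 : a ^ 2 % 3 = 0 ∨ a ^ 2 % 3 = 1 := by
      have : a % 3 = 0 ∨ a % 3 = 1 ∨ a % 3 = 2 := by omega
      rcases this with h | h | h <;> simp [pow_succ, Int.mul_emod, h]
    have e3 : w ^ 3 % 9 = 0 ∨ w ^ 3 % 9 = 1 ∨ w ^ 3 % 9 = 8 := by
      have : w % 9 = 0 ∨ w % 9 = 1 ∨ w % 9 = 2 ∨ w % 9 = 3 ∨ w % 9 = 4 ∨ w % 9 = 5 ∨ w % 9 = 6 ∨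
        w % 9 = 7 ∨ w % 9 = 8 := by omega
      rcases this with h | h | h | h | h | h | h | h | h <;> simp [pow_succ, Int.mul_emod, h]
    rw [← hw] at e3
    omega

/-- Second half of the descent. -/
lemma descent_two (g : GoodTwist A D) {u v z : ℤ} (huv : IsCoprime u v) (hz : z ≠ 0)
    (h : D * z ^ 3 = v * (u ^ 2 + A * v ^ 2)) :
    ∃ X Z : ℤ, u ^ 2 + A * D ^ 2 * Z ^ 6 = X ^ 3 ∧ IsCoprime X Z ∧ z = Z * X := by
  have hA4 := g.A4
  have hcop : IsCoprime D (u ^ 2 + A * v ^ 2) := by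
    apply isCoprime_of_no_prime (Or.inl g.D0)
    intro p hp hpD hpn
    by_cases h2 : 2 ∣ p
    · have h2n : 2 ∣ u ^ 2 + A * v ^ 2 := h2.trans hpn
      have hb : v % 2 = 1 := by
        by_contra hb
        obtain ⟨c, rfl⟩ : 2 ∣ v := by omega
        have : (2:ℤ) ∣ u ^ 2 := by
          have : A * (2 * c) ^ 2 = 2 * (2 * A * c ^ 2) := by ring
          omega
        exact Int.prime_two.not_isUnit (huv.isUnit_of_dvd' (Int.prime_two.dvd_of_dvd_pow this)
          (dvd_mul_right _ _))
      have hb2 : v ^ 2 % 4 = 1 := Int.sq_mod_four_eq_one_of_odd (Int.odd_iff.2 hb)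
      have hAb : (A * v ^ 2) % 4 = 1 := by rw [Int.mul_emod, hA4, hb2]; rfl
      have ha : u % 2 = 1 := by
        by_contra ha
        obtain ⟨c, rfl⟩ : 2 ∣ u := by omega
        have : (2 * c) ^ 2 = 4 * (c ^ 2) := by ring
        omega
      have ha2 : u ^ 2 % 4 = 1 := Int.sq_mod_four_eq_one_of_odd (Int.odd_iff.2 ha)
      exact g.val_two_aux hb (n := u ^ 2 + A * v ^ 2) (by omega) h
    · obtain ⟨h4, h5⟩ := g.inert p hp hpD h2 _ _ hpn
      exact hp.not_isUnit (huv.isUnit_of_dvd' h4 h5)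
  obtain ⟨c, rfl⟩ : D ∣ v := hcop.dvd_of_dvd_mul_right ⟨z ^ 3, h.symm⟩
  have h1 : c * (u ^ 2 + A * D ^ 2 * c ^ 2) = z ^ 3 := by
    apply mul_left_cancel₀ g.D0
    linear_combination -h
  have hac : IsCoprime u c := huv.of_mul_right_right
  have hcf : IsCoprime c (u ^ 2 + A * D ^ 2 * c ^ 2) := by
    have h6 := ((hac.pow_left (m := 2)).symm).add_mul_left_right (A * D ^ 2 * c)
    have e : u ^ 2 + c * (A * D ^ 2 * c) = u ^ 2 + A * D ^ 2 * c ^ 2 := by ring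
    rwa [e] at h6
  obtain ⟨Z, hZ⟩ := Int.eq_pow_of_mul_eq_pow_odd_left hcf (by decide : Odd 3) h1
  obtain ⟨X, hX⟩ := Int.eq_pow_of_mul_eq_pow_odd_right hcf (by decide : Odd 3) h1
  refine ⟨X, Z, ?_, ?_, ?_⟩
  · rw [← hX, hZ]; ring
  · rw [hX, hZ] at hcf
    exact ((IsCoprime.pow_iff (by norm_num) (by norm_num)).1 hcf).symm
  · rw [hX, hZ, ← mul_pow] at h1
    exact ((Odd.pow_injective (R := ℤ) (by decide : Odd 3)) h1).symm

/-- From an integral root of the resolvent cubic to a cube. -/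
lemma root_to_cube (g : GoodTwist A D) {a z w t : ℤ} (haz : IsCoprime a z)
    (hw : IsCoprime w (6 * A * D * z)) (hz : z ≠ 0)
    (h : a ^ 2 - 27 * A * D ^ 2 * z ^ 6 = w ^ 3) (ht : t ^ 3 - 3 * w * t - 2 * a = 0) :
    ∃ u v : ℤ, IsCoprime u v ∧ D * z ^ 3 = v * (u ^ 2 + A * v ^ 2) := by
  have hA4 := g.A4
  have h1 : (t ^ 2 - 4 * w) * (t ^ 2 - w) ^ 2 = 3 * A * (6 * D * z ^ 3) ^ 2 := by
    have ha : 2 * a = t ^ 3 - 3 * w * t := by linarith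
    have : 4 * a ^ 2 = (t ^ 3 - 3 * w * t) ^ 2 := by rw [← ha]; ring
    linear_combination 4 * h - this
  have hm0 : t ^ 2 - w ≠ 0 := by
    intro h0
    rw [h0] at h1
    have := g.Apos; have := g.D0
    have : 3 * A * (6 * D * z ^ 3) ^ 2 > 0 := by positivity
    simp at h1
    rcases h1 with h1 | h1 | h1 <;> simp_all
  -- 3A squarefree
  have hsf : Squarefree (3 * A) := by
    rw [squarefree_mul_iff]
    refine ⟨?_, Int.prime_three.squarefree, g.Asf⟩
    rw [isRelPrime_iff_isCoprime, Prime.coprime_iff_not_dvd Int.prime_three]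
    have := g.A3; omega
  -- (3A)(t²-4w) is a square times
  have h2 : (t ^ 2 - w) ^ 2 ∣ (3 * A * (6 * D * z ^ 3)) ^ 2 :=
    ⟨3 * A * (t ^ 2 - 4 * w), by linear_combination -3 * A * h1⟩
  obtain ⟨k, hk⟩ := (Int.pow_dvd_pow_iff two_ne_zero).1 h2
  have h3 : 3 * A * (t ^ 2 - 4 * w) = k ^ 2 := by
    apply mul_left_cancel₀ (pow_ne_zero 2 hm0)
    have : (3 * A * (6 * D * z ^ 3)) ^ 2 = ((t ^ 2 - w) * k) ^ 2 := by rw [hk]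
    linear_combination 3 * A * h1 + this
  have h4 : 3 * A ∣ k := by
    have : 3 * A ∣ k ^ 2 := ⟨_, h3.symm⟩
    exact (hsf.dvd_pow_iff_dvd two_ne_zero).1 this
  obtain ⟨s, rfl⟩ := h4
  have hA0 : 3 * A ≠ 0 := by have := g.Apos; omega
  have h5 : t ^ 2 - 4 * w = 3 * A * s ^ 2 := by
    apply mul_left_cancel₀ hA0
    linear_combination h3
  have h6 : (t ^ 2 - w) * s = 6 * D * z ^ 3 := by
    apply mul_left_cancel₀ hA0
    linear_combination -hk
  have hteven : t % 2 = 0 := by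
    by_contra hto
    have hto : t % 2 = 1 := by omega
    have ht2 : t ^ 2 % 4 = 1 := Int.sq_mod_four_eq_one_of_odd (Int.odd_iff.2 hto)
    rcases Int.even_or_odd s with hs | hs
    · obtain ⟨r, rfl⟩ := hs
      have : 3 * A * (r + r) ^ 2 = 4 * (3 * A * r ^ 2) := by ring
      omega
    · have hs2 : s ^ 2 % 4 = 1 := Int.sq_mod_four_eq_one_of_odd hs
      have : (A * s ^ 2) % 4 = 1 := by rw [Int.mul_emod, hA4, hs2]; rfl
      have : 3 * A * s ^ 2 = 3 * (A * s ^ 2) := by ring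
      omega
  have hseven : s % 2 = 0 := by
    by_contra hs
    have hs2 : s ^ 2 % 4 = 1 := Int.sq_mod_four_eq_one_of_odd (Int.odd_iff.2 (by omega))
    have : (A * s ^ 2) % 4 = 1 := by rw [Int.mul_emod, hA4, hs2]; rfl
    have : 3 * A * s ^ 2 = 3 * (A * s ^ 2) := by ring
    obtain ⟨r, rfl⟩ : 2 ∣ t := by omega
    have : (2 * r) ^ 2 = 4 * r ^ 2 := by ring
    omega
  obtain ⟨u, rfl⟩ : 2 ∣ t := by omega
  obtain ⟨v, rfl⟩ : 2 ∣ s := by omega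
  have hwv : w = u ^ 2 - 3 * A * v ^ 2 := by linarith
  have hDz : D * z ^ 3 = v * (u ^ 2 + A * v ^ 2) := by
    have e : (6:ℤ) ≠ 0 := by norm_num
    apply mul_left_cancel₀ e
    rw [hwv] at h6
    linear_combination -h6
  have hau : a = u ^ 3 + 9 * A * u * v ^ 2 := by
    rw [hwv] at ht
    linarith
  refine ⟨u, v, ?_, hDz⟩
  apply isCoprime_of_no_prime
  · right; rintro rfl
    simp at hDz
    rcases hDz with h | h
    · exact g.D0 h
    · exact hz h
  intro p hp hpu hpv
  have hpw : p ∣ w := by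
    rw [hwv]
    exact dvd_sub (dvd_pow hpu two_ne_zero) ((dvd_pow hpv two_ne_zero).mul_left _)
  have hpD : p ∣ 6 * A * D * z := by
    have : p ∣ D * z ^ 3 := by rw [hDz]; exact hpv.mul_right _
    rcases hp.dvd_or_dvd this with h | h
    · exact (h.mul_left _).mul_right _
    · exact (hp.dvd_of_dvd_pow h).mul_left _
  exact hp.not_isUnit (hw.isUnit_of_dvd' hpw hpD)

/-- The descent: no integral solutions, given the two cube properties. -/
theorem no_solution (g : GoodTwist A D)
    (HK : ∀ X Y Z : ℤ, IsCoprime X Z → Z ≠ 0 → Y ^ 2 + A * D ^ 2 * Z ^ 6 = X ^ 3 →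
      ∃ a b : ℤ, Y = a ^ 3 - 3 * A * a * b ^ 2 ∧ D * Z ^ 3 = b * (3 * a ^ 2 - A * b ^ 2))
    (HK' : ∀ a z w : ℤ, IsCoprime w (6 * A * D * z) → z ≠ 0 → ¬ 3 ∣ a →
      a ^ 2 - 27 * A * D ^ 2 * z ^ 6 = w ^ 3 → ∃ t : ℤ, t ^ 3 - 3 * w * t - 2 * a = 0) :
    ∀ n : ℕ, ∀ X Y Z : ℤ, Z.natAbs = n → IsCoprime X Z → Z ≠ 0 →
      Y ^ 2 + A * D ^ 2 * Z ^ 6 = X ^ 3 → False := by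
  intro n
  induction n using Nat.strong_induction_on with
  | _ n ih =>
  intro X Y Z hn hXZ hZ h
  obtain ⟨a, b, hY, hDZ⟩ := HK X Y Z hXZ hZ h
  have hX : X = a ^ 2 + A * b ^ 2 := by
    have : X ^ 3 = (a ^ 2 + A * b ^ 2) ^ 3 := by
      have e : A * D ^ 2 * Z ^ 6 = A * (D * Z ^ 3) ^ 2 := by ring
      rw [← h, e, hDZ, hY]; ring
    exact (Odd.pow_injective (R := ℤ) (by decide : Odd 3)) this
  have hcX := g.coprime_X hXZ h
  have hab : IsCoprime a b := by
    apply isCoprime_of_no_prime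
    · right; rintro rfl
      simp at hDZ
      rcases hDZ with h | h
      · exact g.D0 h
      · exact hZ h
    intro p hp hpa hpb
    have hpX : p ∣ X := by
      rw [hX]
      exact dvd_add (dvd_pow hpa two_ne_zero) ((dvd_pow hpb two_ne_zero).mul_left _)
    have : p ∣ D * Z ^ 3 := by rw [hDZ]; exact hpb.mul_right _
    rcases hp.dvd_or_dvd this with h | h
    · exact hp.not_isUnit (hcX.isUnit_of_dvd' hpX (h.mul_left _))
    · exact hp.not_isUnit (hXZ.isUnit_of_dvd' hpX (hp.dvd_of_dvd_pow h))
  obtain ⟨z, w, h1, h3a, haz, hZzw⟩ := g.descent_one hab hZ hDZ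
  have hz : z ≠ 0 := by rintro rfl; simp at hZzw; exact hZ hZzw
  have hw0 : w ≠ 0 := by rintro rfl; simp at hZzw; exact hZ hZzw
  have hcw := g.coprime_w haz h3a h1
  obtain ⟨t, ht⟩ := HK' a z w hcw hz h3a h1
  obtain ⟨u, v, huv, h2⟩ := g.root_to_cube haz hcw hz h1 ht
  obtain ⟨X', Z', h4, h5, h6⟩ := g.descent_two huv hz h2
  have hZ'0 : Z' ≠ 0 := by rintro rfl; simp at h6; exact hz h6
  have hX'0 : X' ≠ 0 := by rintro rfl; simp at h6; exact hz h6
  refine ih Z'.natAbs ?_ X' u Z' rfl h5 hZ'0 h4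
  rw [← hn, hZzw, h6]
  simp only [Int.natAbs_mul]
  have e1 : 0 < Z'.natAbs := Int.natAbs_pos.2 hZ'0
  have e2 : 0 < X'.natAbs := Int.natAbs_pos.2 hX'0
  have e3 : 0 < w.natAbs := Int.natAbs_pos.2 hw0
  have e4 : (3:ℤ).natAbs = 3 := rfl
  rw [e4]
  have : Z'.natAbs * 1 ≤ Z'.natAbs * X'.natAbs * w.natAbs := by
    rw [mul_assoc]; exact Nat.mul_le_mul_left _ (Nat.mul_pos e2 e3)
  have e5 : 3 * (Z'.natAbs * X'.natAbs) * w.natAbs = 3 * (Z'.natAbs * X'.natAbs * w.natAbs) := by ring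
  omega

end GoodTwist


theorem rat_point_to_int {B : ℤ} {x y : ℚ} (h : y ^ 2 = x ^ 3 - B) :
    ∃ X Y Z : ℤ, IsCoprime X Z ∧ Z ≠ 0 ∧ Y ^ 2 + B * Z ^ 6 = X ^ 3 := by
  have hden : y.den ^ 2 = x.den ^ 3 := by
    rw [← Rat.den_pow, ← Rat.den_pow, h]
    have := Rat.add_intCast_den (x ^ 3) (-B)
    rw [← this]; push_cast; rw [sub_eq_add_neg]
  have hd : x.den ∣ y.den := by
    have : x.den ^ 2 ∣ y.den ^ 2 := by rw [hden]; exact pow_dvd_pow _ (by norm_num)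
    exact (Nat.pow_dvd_pow_iff two_ne_zero).1 this
  obtain ⟨k, hk⟩ := hd
  have hx0 : x.den ≠ 0 := x.den_ne_zero
  have hk2 : x.den = k ^ 2 := by
    rw [hk] at hden
    have : x.den ^ 2 * k ^ 2 = x.den ^ 2 * x.den := by rw [← mul_pow, hden]; ring
    exact (Nat.eq_of_mul_eq_mul_left (by positivity) this).symm
  have hk3 : y.den = k ^ 3 := by rw [hk, hk2]; ring
  have hk0 : k ≠ 0 := by rintro rfl; simp at hk2
  refine ⟨x.num, y.num, k, ?_, by exact_mod_cast hk0, ?_⟩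
  · have := x.reduced
    rw [hk2] at this
    have h2 : Nat.Coprime x.num.natAbs k := (Nat.coprime_pow_right_iff (by norm_num) _ _).1 this
    rw [Int.isCoprime_iff_gcd_eq_one]
    simpa [Int.gcd] using h2
  · have hkq : (k:ℚ) ≠ 0 := by exact_mod_cast hk0
    have ex : x = x.num / (k:ℚ) ^ 2 := by
      conv_lhs => rw [← Rat.num_div_den x, hk2]
      push_cast; rfl
    have ey : y = y.num / (k:ℚ) ^ 3 := by
      conv_lhs => rw [← Rat.num_div_den y, hk3]
      push_cast; rfl
    have : ((y.num:ℚ)) ^ 2 + B * k ^ 6 = x.num ^ 3 := by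
      rw [ex, ey] at h
      field_simp at h
      linear_combination h
    exact_mod_cast this

theorem mordellRank_eq_zero {B : ℤ}
    (h : ∀ X Y Z : ℤ, IsCoprime X Z → Z ≠ 0 → Y ^ 2 + B * Z ^ 6 = X ^ 3 → False) :
    mordellRank (-B) = 0 := by
  have : Subsingleton (MordellCurve (-B)).toAffine.Point := by
    refine ⟨fun P Q => ?_⟩
    have key : ∀ P : (MordellCurve (-B)).toAffine.Point, P = 0 := by
      intro P
      rcases P with _ | ⟨x, y, hP⟩
      · rfl
      · exfalso
        have h1 := hP.1
        rw [WeierstrassCurve.Affine.equation_iff] at h1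
        have h2 : y ^ 2 = x ^ 3 - B := by
          simp [MordellCurve] at h1
          linarith
        obtain ⟨X, Y, Z, h3, h4, h5⟩ := rat_point_to_int h2
        exact h X Y Z h3 h4 h5
    rw [key P, key Q]
  exact Module.finrank_zero_of_subsingleton


section quad
open NumberField

lemma ideal_principal_of_cube {R : Type*} [CommRing R] [IsDedekindDomain R]
    (hcl : ∀ x : ClassGroup R, x ^ 3 = 1 → x = 1) {I : Ideal R} (hI0 : I ≠ 0)
    (hI : (I ^ 3).IsPrincipal) : I.IsPrincipal := by
  rw [← ClassGroup.mk0_eq_one_iff (pow_mem (mem_nonZeroDivisors_of_ne_zero hI0) 3)] at hI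
  rw [← ClassGroup.mk0_eq_one_iff (mem_nonZeroDivisors_of_ne_zero hI0)]
  apply hcl
  rwa [← map_pow, SubmonoidClass.mk_pow]

lemma exists_unit_mul_cube {R : Type*} [CommRing R] [IsDedekindDomain R]
    (hcl : ∀ x : ClassGroup R, x ^ 3 = 1 → x = 1) {α β γ : R} (h : α * β = γ ^ 3) (h0 : α ≠ 0)
    (hc : IsCoprime α β) : ∃ (u : Rˣ) (δ : R), α = u * δ ^ 3 := by
  classical
  have h1 : Ideal.span {α} * Ideal.span {β} = Ideal.span {γ} ^ 3 := by
    rw [Ideal.span_singleton_mul_span_singleton, h, Ideal.span_singleton_pow]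
  have h2 : IsCoprime (Ideal.span {α}) (Ideal.span {β}) := by
    rwa [Ideal.isCoprime_span_singleton_iff]
  obtain ⟨I, hI⟩ := exists_associated_pow_of_mul_eq_pow (α := Ideal R)
    (a := Ideal.span {α}) (b := Ideal.span {β}) (c := Ideal.span {γ}) (k := 3)
    (by
      apply isUnit_of_dvd_one
      obtain ⟨x, y, hxy⟩ := h2
      rw [← hxy]
      exact dvd_add (dvd_mul_of_dvd_right (gcd_dvd_left _ _) _)
        (dvd_mul_of_dvd_right (gcd_dvd_right _ _) _)) h1
  have hI' : I ^ 3 = Ideal.span {α} := associated_iff_eq.1 hI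
  have hI0 : I ≠ 0 := by
    rintro rfl
    rw [zero_pow (by norm_num)] at hI'
    have : Ideal.span {α} = ⊥ := hI'.symm
    rw [Ideal.span_singleton_eq_bot] at this
    exact h0 this
  obtain ⟨δ, hδ⟩ := (Submodule.isPrincipal_iff _).1 (ideal_principal_of_cube hcl hI0 ⟨⟨α, hI'⟩⟩)
  have : I = Ideal.span {δ} := hδ
  rw [this, Ideal.span_singleton_pow, Ideal.span_singleton_eq_span_singleton] at hI'
  obtain ⟨u, hu⟩ := hI'
  exact ⟨u, δ, by rw [← hu, mul_comm]⟩

/-- `K` is generated over the rationals by a square root `s` of `-A`. -/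
structure IsQuad (K : Type*) [Field K] [NumberField K] (A : ℤ) (s : K) : Prop where
  Apos : 0 < A
  Asf : Squarefree A
  A4 : A % 4 = 1
  hs : s ^ 2 = -(A : K)
  hK : ∀ x : K, ∃ p q : ℚ, x = p + q * s

variable {K : Type*} [Field K] [NumberField K] {A : ℤ} {s : K}

lemma IsQuad.re_zero (h : IsQuad K A s) (φ : K →+* ℂ) : (φ s).re = 0 ∧ (φ s).im ≠ 0 := by
  have h1 : (φ s) ^ 2 = -(A : ℂ) := by rw [← map_pow, h.hs]; simp
  have hA : (0 : ℝ) < A := by exact_mod_cast h.Apos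
  have h2 := congrArg Complex.re h1
  have h3 := congrArg Complex.im h1
  simp [pow_two] at h2 h3
  have h4 : (φ s).re * (φ s).im = 0 := by linarith
  rcases mul_eq_zero.1 h4 with h5 | h5
  · refine ⟨h5, fun h6 => ?_⟩
    rw [h5, h6] at h2; simp at h2; rw [h2] at hA; simp at hA
  · rw [h5] at h2; nlinarith [mul_self_nonneg (φ s).re]

lemma IsQuad.conj (h : IsQuad K A s) (φ : K →+* ℂ) :
    (starRingEnd ℂ) (φ s) = - φ s := by
  have := h.re_zero φ
  apply Complex.ext <;> simp [this.1]

lemma IsQuad.ext (h : IsQuad K A s) {p q p' q' : ℚ} (e : (p : K) + q * s = p' + q' * s) :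
    p = p' ∧ q = q' := by
  obtain ⟨φ⟩ : Nonempty (K →+* ℂ) := inferInstance
  have h1 := h.re_zero φ
  have h2 := congrArg φ e
  simp only [map_add, map_mul, map_ratCast] at h2
  have h3 := congrArg Complex.re h2
  have h4 := congrArg Complex.im h2
  simp [h1.1] at h3 h4
  refine ⟨h3, ?_⟩
  rcases h4 with h4 | h4
  · exact h4
  · exact absurd h4 h1.2

lemma IsQuad.ext_int (h : IsQuad K A s) {p q p' q' : ℤ} (e : (p : K) + q * s = p' + q' * s) :
    p = p' ∧ q = q' := by
  have := h.ext (p := p) (q := q) (p' := p') (q' := q') (by push_cast; exact e)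
  exact_mod_cast this

lemma rat_int_of_isIntegral {p : ℚ} (h : IsIntegral ℤ (p : ℂ)) : ∃ m : ℤ, p = m := by
  have h1 : IsIntegral ℤ p := by
    have : (p : ℂ) = algebraMap ℚ ℂ p := by simp
    rw [this] at h
    exact (isIntegral_algebraMap_iff (algebraMap ℚ ℂ).injective).1 h
  obtain ⟨m, hm⟩ := IsIntegrallyClosed.isIntegral_iff.1 h1
  exact ⟨m, by simpa using hm.symm⟩

lemma rat_int_of_sq {A n : ℤ} (hA : Squarefree A) (r : ℚ) (h : A * r ^ 2 = n) : ∃ m : ℤ, r = m := by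
  have hd : (r.den : ℚ) ≠ 0 := by exact_mod_cast r.den_nz
  have h1 : (A : ℚ) * r.num ^ 2 = n * r.den ^ 2 := by
    rw [← h]
    conv_rhs => rw [← Rat.num_div_den r]
    field_simp
    rw [Rat.num_div_den]
  have h2 : A * r.num ^ 2 = n * (r.den : ℤ) ^ 2 := by exact_mod_cast h1
  have hc : IsCoprime (r.den : ℤ) r.num := by
    rw [Int.isCoprime_iff_gcd_eq_one]
    have := r.reduced
    simpa [Int.gcd, Nat.Coprime, Nat.gcd_comm] using this
  have h3 : (r.den : ℤ) * r.den ∣ A := by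
    have : IsCoprime ((r.den : ℤ) ^ 2) (r.num ^ 2) := hc.pow
    rw [← pow_two]
    exact this.dvd_of_dvd_mul_right ⟨n, by rw [h2]; ring⟩
  have h4 := hA _ h3
  have h5 : r.den = 1 := by
    have := Int.isUnit_iff.1 h4
    omega
  exact ⟨r.num, by exact (Rat.den_eq_one_iff r).1 h5 |>.symm⟩

lemma IsQuad.int_coords (h : IsQuad K A s) (x : 𝓞 K) : ∃ a b : ℤ, (x : K) = a + b * s := by
  obtain ⟨φ⟩ : Nonempty (K →+* ℂ) := inferInstance
  obtain ⟨p, q, hx⟩ := h.hK x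
  have hi : IsIntegral ℤ (φ (x : K)) := (RingOfIntegers.isIntegral_coe x).map φ.toIntAlgHom
  have hi' : IsIntegral ℤ ((starRingEnd ℂ) (φ (x : K))) := hi.map (starRingEnd ℂ).toIntAlgHom
  have e1 : φ (x : K) = p + q * φ s := by rw [hx]; simp
  have e2 : (starRingEnd ℂ) (φ (x : K)) = p - q * φ s := by
    rw [e1]; simp [h.conj φ]; ring
  have e3 : (φ s) ^ 2 = -(A : ℂ) := by rw [← map_pow, h.hs]; simp
  obtain ⟨m, hm⟩ := rat_int_of_isIntegral (p := 2 * p) (by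
    have := hi.add hi'
    rw [e2, e1] at this
    push_cast
    rw [show (2 * (p:ℂ)) = (p + q * φ s) + (p - q * φ s) by ring]; exact this)
  obtain ⟨n, hn⟩ := rat_int_of_isIntegral (p := p ^ 2 + A * q ^ 2) (by
    have := hi.mul hi'
    rw [e2, e1] at this
    push_cast
    rw [show ((p:ℂ) ^ 2 + A * q ^ 2) = (p + q * φ s) * (p - q * φ s) by linear_combination (q:ℂ)^2 * e3]
    exact this)
  have h4 : (A : ℚ) * (2 * q) ^ 2 = ((4 * n - m ^ 2 : ℤ) : ℚ) := by
    push_cast; rw [← hn, ← hm]; ring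
  obtain ⟨r, hr⟩ := rat_int_of_sq h.Asf _ h4
  have h5 : A * r ^ 2 = 4 * n - m ^ 2 := by rw [hr] at h4; exact_mod_cast h4
  have h6 : m % 2 = 0 ∧ r % 2 = 0 := by
    obtain ⟨k, hk⟩ : ∃ k, A = 4 * k + 1 := ⟨A / 4, by have := h.A4; omega⟩
    rw [hk] at h5
    have h7 : r ^ 2 + m ^ 2 = 4 * (n - k * r ^ 2) := by linear_combination h5
    rcases Int.emod_two_eq_zero_or_one m with hm2 | hm2 <;>
    rcases Int.emod_two_eq_zero_or_one r with hr2 | hr2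
    · exact ⟨hm2, hr2⟩
    all_goals
      exfalso
      obtain ⟨m', hm'⟩ : ∃ m', m = 2 * m' + m % 2 := ⟨m / 2, by omega⟩
      obtain ⟨r', hr'⟩ : ∃ r', r = 2 * r' + r % 2 := ⟨r / 2, by omega⟩
      rw [hm2] at hm'; rw [hr2] at hr'
      rw [hm', hr'] at h7
      ring_nf at h7
      omega
  refine ⟨m / 2, r / 2, ?_⟩
  have hp : p = ((m / 2 : ℤ) : ℚ) := by
    have : (m : ℚ) = 2 * ((m / 2 : ℤ) : ℚ) := by exact_mod_cast (by omega : m = 2 * (m / 2))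
    linarith
  have hq : q = ((r / 2 : ℤ) : ℚ) := by
    have : (r : ℚ) = 2 * ((r / 2 : ℤ) : ℚ) := by exact_mod_cast (by omega : r = 2 * (r / 2))
    linarith
  rw [hx, hp, hq]; push_cast; rfl

lemma IsQuad.unit_pow_four (h : IsQuad K A s) (u : (𝓞 K)ˣ) : u ^ 4 = 1 := by
  obtain ⟨a, b, hu⟩ := h.int_coords u
  obtain ⟨c, d, hv⟩ := h.int_coords (u⁻¹ : (𝓞 K)ˣ)
  have e : ((u : 𝓞 K) : K) * ((u⁻¹ : (𝓞 K)ˣ) : 𝓞 K) = 1 := by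
    rw [← map_mul, Units.mul_inv, map_one]
  have e1 : ((a * c - A * b * d : ℤ) : K) + ((a * d + b * c : ℤ) : K) * s
      = ((1 : ℤ) : K) + ((0 : ℤ) : K) * s := by
    rw [hu, hv] at e
    push_cast
    linear_combination e - b * d * h.hs
  obtain ⟨h1, h2⟩ := h.ext_int e1
  have hA := h.Apos
  have h3 : (a ^ 2 + A * b ^ 2) * (c ^ 2 + A * d ^ 2) = 1 := by
    have : (a ^ 2 + A * b ^ 2) * (c ^ 2 + A * d ^ 2)
      = (a * c - A * b * d) ^ 2 + A * (a * d + b * c) ^ 2 := by ring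
    rw [this, h1, h2]; ring
  have h4 : a ^ 2 + A * b ^ 2 = 1 := Int.eq_one_of_mul_eq_one_right (by positivity) h3
  have hs4 := h.hs
  have key : ((a : K) + b * s) ^ 4 = 1 := by
    by_cases hb : b = 0
    · subst hb
      have ha : a ^ 2 = 1 := by simpa using h4
      have ha' : (a : K) ^ 2 = 1 := by exact_mod_cast ha
      simp only [Int.cast_zero, zero_mul, add_zero]
      linear_combination ((a : K) ^ 2 + 1) * ha'
    · have hb1 : 1 ≤ b ^ 2 := by have := sq_nonneg b; have := pow_ne_zero 2 hb; omega
      have hA1 : A = 1 := by nlinarith [sq_nonneg a]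
      have ha : a = 0 := by
        have : a ^ 2 ≤ 0 := by rw [hA1] at h4; linarith
        exact pow_eq_zero_iff (two_ne_zero) |>.1 (le_antisymm this (sq_nonneg a))
      have hb2 : b ^ 2 = 1 := by rw [hA1, ha] at h4; linarith
      have hb' : (b : K) ^ 2 = 1 := by exact_mod_cast hb2
      rw [hA1] at hs4
      have hs5 : s ^ 2 = -1 := by rw [hs4]; simp
      rw [ha]
      have : ((0 : ℤ) : K) + b * s = b * s := by simp
      rw [this, show ((b : K) * s) ^ 4 = (b ^ 2) ^ 2 * (s ^ 2) ^ 2 by ring, hb', hs5]; norm_num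
  apply Units.ext
  apply RingOfIntegers.ext
  simp [hu, key]

lemma IsQuad.isIntegral (h : IsQuad K A s) : IsIntegral ℤ s := by
  refine ⟨Polynomial.X ^ 2 + Polynomial.C A, ?_, ?_⟩
  · exact Polynomial.monic_X_pow_add_C _ (by norm_num)
  · have := h.hs
    simp [Polynomial.eval₂_add, -eq_intCast, -map_intCast]
    simp [h.hs]

lemma IsQuad.HK (h : IsQuad K A s) (hcl : ∀ x : ClassGroup (𝓞 K), x ^ 3 = 1 → x = 1)
    {X Y W : ℤ} (hW : W ≠ 0) (hc : IsCoprime X (2 * A * W)) (e : Y ^ 2 + A * W ^ 2 = X ^ 3) :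
    ∃ a b : ℤ, Y = a ^ 3 - 3 * A * a * b ^ 2 ∧ W = b * (3 * a ^ 2 - A * b ^ 2) := by
  let S : 𝓞 K := ⟨s, h.isIntegral⟩
  have hSs : algebraMap (𝓞 K) K S = s := rfl
  have hS : S ^ 2 = -(A : 𝓞 K) := by
    apply RingOfIntegers.ext; simp only [map_pow, map_neg, map_intCast, hSs]; exact h.hs
  have hmul : ((Y : 𝓞 K) + W * S) * (Y - W * S) = (X : 𝓞 K) ^ 3 := by
    have e' : (Y : 𝓞 K) ^ 2 + A * W ^ 2 = X ^ 3 := by exact_mod_cast e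
    linear_combination e' - W ^ 2 * hS
  have hco : IsCoprime ((Y : 𝓞 K) + W * S) (Y - W * S) := by
    have h1 : IsCoprime (X ^ 3) ((2 * A * W)) := hc.pow_left
    obtain ⟨x, y, hxy⟩ := h1
    have hxy' : (x : 𝓞 K) * X ^ 3 + y * (2 * A * W) = 1 := by exact_mod_cast hxy
    refine ⟨x * (Y - W * S) - y * S, y * S, ?_⟩
    linear_combination hxy' + x * hmul - 2 * y * W * hS
  have h0 : (Y : 𝓞 K) + W * S ≠ 0 := by
    intro h0
    have := congrArg (fun z : 𝓞 K => (z : K)) h0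
    have h2 := h.ext_int (p := Y) (q := W) (p' := 0) (q' := 0) (by simpa [map_add, map_mul, hSs] using this)
    exact hW h2.2
  obtain ⟨u, δ, hu⟩ := exists_unit_mul_cube hcl hmul h0 hco
  have hu4 : (u : 𝓞 K) ^ 4 = 1 := by rw [← Units.val_pow_eq_pow_val, h.unit_pow_four u, Units.val_one]
  obtain ⟨a, b, hab⟩ := h.int_coords ((u : 𝓞 K) ^ 3 * δ)
  have h1 : (Y : 𝓞 K) + W * S = ((u : 𝓞 K) ^ 3 * δ) ^ 3 := by
    rw [hu]
    linear_combination -(u : 𝓞 K) * δ ^ 3 * ((u : 𝓞 K) ^ 4 + 1) * hu4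
  have h2 := congrArg (fun z : 𝓞 K => (z : K)) h1
  simp only [map_pow, map_add, map_mul, map_intCast] at h2
  have h3 : ((Y : ℤ) : K) + ((W : ℤ) : K) * s = ((a ^ 3 - 3 * A * a * b ^ 2 : ℤ) : K) +
      ((b * (3 * a ^ 2 - A * b ^ 2) : ℤ) : K) * s := by
    have h4 : (Y : K) + W * s = (a + b * s) ^ 3 := by
      rw [← hab]; simpa [map_add, map_mul, hSs] using h2
    push_cast
    linear_combination h4 + (3 * a * b ^ 2 + b ^ 3 * s) * h.hs
  exact ⟨a, b, h.ext_int h3⟩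

end quad


lemma sqrtC_sq (m : ℤ) : sqrtC m ^ 2 = m := by
  unfold sqrtC
  rw [← Complex.cpow_nat_mul]; simp

lemma sqrtC_isIntegral (m : ℤ) : IsIntegral ℚ (sqrtC m) := by
  refine ⟨Polynomial.X ^ 2 - Polynomial.C (m : ℚ), ?_, ?_⟩
  · exact Polynomial.monic_X_pow_sub_C _ (by norm_num)
  · simp [sqrtC_sq, Polynomial.eval₂_sub, -eq_intCast, -map_intCast]

lemma quadField_numberField (m : ℤ) : NumberField (quadField m) where
  to_charZero := inferInstance
  to_finiteDimensional := by
    unfold quadField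
    exact IntermediateField.adjoin.finiteDimensional (sqrtC_isIntegral m)

lemma quadField_coords (m : ℤ) (x : ℂ) (hx : x ∈ quadField m) :
    ∃ p q : ℚ, x = p + q * sqrtC m := by
  unfold quadField at hx
  rw [← IntermediateField.mem_toSubalgebra,
    IntermediateField.adjoin_simple_toSubalgebra_of_isAlgebraic (sqrtC_isIntegral m).isAlgebraic] at hx
  induction hx using Algebra.adjoin_induction with
  | mem x hx => exact ⟨0, 1, by simp at hx; simp [hx]⟩
  | algebraMap r => exact ⟨r, 0, by simp⟩
  | add x y _ _ h1 h2 =>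
    obtain ⟨p, q, rfl⟩ := h1
    obtain ⟨p', q', rfl⟩ := h2
    exact ⟨p + p', q + q', by push_cast; ring⟩
  | mul x y _ _ h1 h2 =>
    obtain ⟨p, q, rfl⟩ := h1
    obtain ⟨p', q', rfl⟩ := h2
    refine ⟨p * p' + m * q * q', p * q' + q * p', ?_⟩
    push_cast
    linear_combination q * q' * sqrtC_sq m

lemma quadField_isQuad {A : ℤ} (hA : 0 < A) (hsf : Squarefree A) (h4 : A % 4 = 1) :
    letI := quadField_numberField (-A)
    IsQuad (quadField (-A)) A ⟨sqrtC (-A), IntermediateField.mem_adjoin_simple_self ℚ _⟩ := by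
  letI := quadField_numberField (-A)
  refine ⟨hA, hsf, h4, ?_, ?_⟩
  · apply Subtype.ext
    have := sqrtC_sq (-A)
    simpa using this
  · rintro ⟨x, hx⟩
    obtain ⟨p, q, h⟩ := quadField_coords _ x hx
    refine ⟨p, q, Subtype.ext ?_⟩
    simpa using h


section hilbert94

variable {R S : Type*} [CommRing R] [IsDedekindDomain R] [CommRing S] [IsDomain S]
  [Algebra R S]

lemma h94_descend (τ : S ≃ₐ[R] S) (h3 : ∀ x, τ (τ (τ x)) = x)
    (hfix : ∀ x, τ x = x → ∃ y, algebraMap R S y = x)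
    (hspan : Ideal.span (Set.range fun u => u - τ u) = ⊤) {x η : S} (hη : IsUnit η)
    (h : η * τ x = x) :
    ((Ideal.span {x}).comap (algebraMap R S)).map (algebraMap R S) = Ideal.span {x} := by
  set M := Ideal.span {x} with hM
  set N := ((Ideal.span {x}).comap (algebraMap R S)).map (algebraMap R S) with hN
  apply le_antisymm
  · exact Ideal.map_comap_le
  obtain ⟨ηu, rfl⟩ := hη
  have hst1 : ∀ m ∈ M, τ m ∈ M := by
    intro m hm
    obtain ⟨y, rfl⟩ := Ideal.mem_span_singleton'.1 hm
    rw [map_mul]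
    apply Ideal.mul_mem_left
    apply Ideal.mem_span_singleton'.2
    refine ⟨(ηu⁻¹ : Sˣ), ?_⟩
    conv_lhs => rw [← h]
    simp
  have hT : ∀ m ∈ M, m + τ m + τ (τ m) ∈ N := by
    intro m hm
    obtain ⟨r, hr⟩ := hfix (m + τ m + τ (τ m)) (by simp only [map_add, h3]; ring)
    rw [← hr]
    apply Ideal.mem_map_of_mem
    rw [Ideal.mem_comap, hr]
    exact add_mem (add_mem hm (hst1 _ hm)) (hst1 _ (hst1 _ hm))
  have hx : x ∈ M := Ideal.mem_span_singleton_self x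
  have hTy : ∀ y, y * x + τ y * τ x + τ (τ y) * τ (τ x) ∈ N := by
    intro y
    have := hT (y * x) (Ideal.mul_mem_left _ _ hx)
    simpa only [map_mul] using this
  have hE : ∀ y v, y * (v - τ (τ v)) * x + τ y * (τ v - τ (τ v)) * τ x ∈ N := by
    intro y v
    have := sub_mem (hTy (y * v)) (Ideal.mul_mem_left _ (τ (τ v)) (hTy y))
    convert this using 1
    simp only [map_mul]; ring
  have hF : ∀ u v, (u - τ u) * (v - τ (τ v)) * x ∈ N := by
    intro u v
    have := sub_mem (hE u v) (Ideal.mul_mem_left _ (τ u) (hE 1 v))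
    convert this using 1
    simp only [map_one]; ring
  have hF' : ∀ u v, (u - τ u) * (v - τ v) * x ∈ N := by
    intro u v
    have := neg_mem (hF u (τ v))
    rw [h3] at this
    convert this using 1; ring
  have hone : ∀ v, (v - τ v) * x ∈ N := by
    intro v
    have : Ideal.span (Set.range fun u => u - τ u) ≤ Submodule.comap (LinearMap.toSpanSingleton S S ((v - τ v) * x)) N := by
      rw [Ideal.span_le]
      rintro _ ⟨u, rfl⟩
      simpa [mul_assoc] using hF' u v
    have h1 := (hspan ▸ this) (Submodule.mem_top (x := (1 : S)))
    simpa using h1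
  have htwo : x ∈ N := by
    have : Ideal.span (Set.range fun u => u - τ u) ≤ Submodule.comap (LinearMap.toSpanSingleton S S x) N := by
      rw [Ideal.span_le]
      rintro _ ⟨u, rfl⟩
      simpa using hone u
    have h1 := (hspan ▸ this) (Submodule.mem_top (x := (1 : S)))
    simpa using h1
  rw [hM, Ideal.span_le]
  simpa using htwo

lemma h94_principal (hinj : Function.Injective (Ideal.map (algebraMap R S)))
    (hcl : ∀ x : ClassGroup R, x ^ 3 = 1 → x = 1)
    (τ : S ≃ₐ[R] S) (h3 : ∀ x, τ (τ (τ x)) = x)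
    (hfix : ∀ x, τ x = x → ∃ y, algebraMap R S y = x)
    (hspan : Ideal.span (Set.range fun u => u - τ u) = ⊤) {x η : S} (hη : IsUnit η)
    (hx : x ≠ 0) (h : η * τ x = x) : ∃ w : Sˣ, η * τ w = w := by
  have hJ := h94_descend τ h3 hfix hspan hη h
  set J := (Ideal.span {x}).comap (algebraMap R S) with hJdef
  obtain ⟨n, hn⟩ := hfix (x * τ x * τ (τ x)) (by simp only [map_mul, h3]; ring)
  have hJ0 : J ≠ 0 := by
    intro h0
    rw [h0] at hJ
    have : Ideal.span {x} = ⊥ := by rw [← hJ]; exact Ideal.map_bot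
    exact hx (Ideal.span_singleton_eq_bot.1 this)
  have hass : Ideal.span {τ x} = Ideal.span {x} := by
    rw [Ideal.span_singleton_eq_span_singleton]
    obtain ⟨u, rfl⟩ := hη
    exact ⟨u, by rw [mul_comm]; exact h⟩
  have hass2 : Ideal.span {τ (τ x)} = Ideal.span {x} := by
    rw [← hass, Ideal.span_singleton_eq_span_singleton]
    obtain ⟨u, rfl⟩ := hη
    refine ⟨Units.map (τ : S →* S) u, ?_⟩
    have := congrArg τ h
    rw [map_mul, mul_comm] at this
    exact this
  have hJ3 : J ^ 3 = Ideal.span {n} := by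
    apply hinj
    rw [Ideal.map_pow, hJ, Ideal.map_span, Set.image_singleton, hn,
      ← Ideal.span_singleton_mul_span_singleton, ← Ideal.span_singleton_mul_span_singleton, hass,
      hass2]
    ring
  obtain ⟨k, hk⟩ := (Submodule.isPrincipal_iff _).1 (ideal_principal_of_cube hcl hJ0 ⟨⟨n, hJ3⟩⟩)
  have hk' : J = Ideal.span {k} := hk
  rw [hk', Ideal.map_span, Set.image_singleton, Ideal.span_singleton_eq_span_singleton] at hJ
  obtain ⟨w, hw⟩ := hJ
  refine ⟨w, ?_⟩
  have hk0 : algebraMap R S k ≠ 0 := by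
    intro h0; rw [h0, zero_mul] at hw; exact hx hw.symm
  rw [← hw, map_mul, AlgEquiv.commutes] at h
  apply mul_left_cancel₀ hk0
  linear_combination h

lemma h94_cube (hinjR : Function.Injective (algebraMap R S))
    (hinj : Function.Injective (Ideal.map (algebraMap R S)))
    (hcl : ∀ x : ClassGroup R, x ^ 3 = 1 → x = 1)
    (hun : ∀ u : Rˣ, u ^ 4 = 1)
    (τ : S ≃ₐ[R] S) (h3 : ∀ x, τ (τ (τ x)) = x)
    (hfix : ∀ x, τ x = x → ∃ y, algebraMap R S y = x)
    (h90 : ∀ η : S, η * τ η * τ (τ η) = 1 → ∃ x : S, x ≠ 0 ∧ η * τ x = x)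
    (hspan : Ideal.span (Set.range fun u => u - τ u) = ⊤) (u : Sˣ) : ∃ v : S, (u : S) = v ^ 3 := by
  -- norms of units are fourth roots of unity
  have hN : ∀ u : Sˣ, ∃ n : S, (u : S) * τ u * τ (τ u) = n ∧ τ n = n ∧ n ^ 4 = 1 := by
    intro u
    refine ⟨_, rfl, by simp only [map_mul, h3]; ring, ?_⟩
    obtain ⟨n, hn⟩ := hfix ((u : S) * τ u * τ (τ u)) (by simp only [map_mul, h3]; ring)
    obtain ⟨n', hn'⟩ := hfix (((u⁻¹ : Sˣ) : S) * τ (u⁻¹ : Sˣ) * τ (τ (u⁻¹ : Sˣ)))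
      (by simp only [map_mul, h3]; ring)
    have hnn : n * n' = 1 := by
      apply hinjR
      have e : (u : S) * (u⁻¹ : Sˣ) = 1 := Units.mul_inv u
      have e1 := congrArg τ e
      have e2 := congrArg τ e1
      simp only [map_mul, map_one] at e1 e2
      rw [map_mul, hn, hn', map_one]
      calc _ = ((u : S) * (u⁻¹ : Sˣ)) * (τ u * τ (u⁻¹ : Sˣ)) * (τ (τ u) * τ (τ (u⁻¹ : Sˣ))) := by ring
        _ = 1 := by rw [e, e1, e2]; ring
    have := hun (Units.mkOfMulEqOne n n' hnn)
    have h4 : n ^ 4 = 1 := by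
      have := congrArg Units.val this
      simpa using this
    rw [← hn, ← map_pow, h4, map_one]
  have step : ∀ η : Sˣ, (η : S) * τ η * τ (τ η) = 1 →
      ∃ w : Sˣ, (w : S) * τ w * τ (τ w) = 1 ∧ (η : S) * τ w = w := by
    intro η hη
    obtain ⟨x, hx, hx1⟩ := h90 η hη
    obtain ⟨w, hw⟩ := h94_principal hinj hcl τ h3 hfix hspan η.isUnit hx hx1
    obtain ⟨n, h1, h2, h4⟩ := hN w
    refine ⟨w * Units.mkOfMulEqOne n (n ^ 3) (by rw [← h4]; ring), ?_, ?_⟩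
    · simp only [Units.val_mul, Units.val_mkOfMulEqOne, map_mul, h2]
      linear_combination n ^ 3 * h1 + h4
    · simp only [Units.val_mul, Units.val_mkOfMulEqOne, map_mul, h2]
      linear_combination n * hw
  have cube1 : ∀ η : Sˣ, (η : S) * τ η * τ (τ η) = 1 → ∃ v : S, (η : S) = v ^ 3 := by
    intro η hη
    obtain ⟨w, hw, hw1⟩ := step η hη
    obtain ⟨v, hv, hv1⟩ := step w hw
    -- w = v / τ v, η = w / τ w
    refine ⟨(v : S) * τ (τ v), ?_⟩
    have hv2 := congrArg τ hv1
    rw [map_mul] at hv2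
    have a1 : (v : S) * τ v * τ (τ v) = 1 := hv
    -- w = v * (v * ττv), τ w = τ v * (v * τ v)
    have ew : (w : S) = v * (v * τ (τ v)) := by
      linear_combination ((v : S) * τ (τ v)) * hv1 - (w : S) * a1
    have etw : τ (w : S) = τ v * (v * τ v) := by
      linear_combination ((v : S) * τ v) * hv2 - τ (w : S) * a1
    have e1 : (η : S) * (τ v * (v * τ v)) = v * (v * τ (τ v)) := by
      rw [← etw, hw1, ew]
    -- multiply by (ττ v)^2 * v
    have a2 : ((v : S) * τ v * τ (τ v)) ^ 2 = 1 := by rw [a1]; ring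
    linear_combination (v : S) * τ (τ v) ^ 2 * e1 - (η : S) * a2
  obtain ⟨n, h1, h2, h4⟩ := hN u
  obtain ⟨v, hv⟩ := cube1 (u * Units.mkOfMulEqOne n (n ^ 3) (by rw [← h4]; ring)) (by
    simp only [Units.val_mul, Units.val_mkOfMulEqOne, map_mul, h2]
    linear_combination n ^ 3 * h1 + h4)
  simp only [Units.val_mul, Units.val_mkOfMulEqOne] at hv
  refine ⟨v * n, ?_⟩
  rw [mul_pow, ← hv]
  linear_combination -(u : S) * h4

end hilbert94


section nf
open NumberField

lemma units_not_all_cubes {L : Type*} [Field L] [NumberField L] (h3 : 3 ≤ Module.finrank ℚ L)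
    (h : ∀ u : (𝓞 L)ˣ, ∃ v : 𝓞 L, (u : 𝓞 L) = v ^ 3) : False := by
  have hr : 0 < Units.rank L := by
    unfold Units.rank
    have := InfinitePlace.card_add_two_mul_card_eq_rank L
    have h2 := InfinitePlace.card_eq_nrRealPlaces_add_nrComplexPlaces L
    omega
  let i : Fin (Units.rank L) := ⟨0, hr⟩
  obtain ⟨v, hv⟩ := h (Units.fundSystem L i)
  have hvu : IsUnit v := by
    have : IsUnit (v ^ 3) := hv ▸ Units.isUnit _
    exact (isUnit_pow_iff (by norm_num)).1 this
  obtain ⟨w, rfl⟩ := hvu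
  have e : Units.fundSystem L i = w ^ 3 := Units.ext (by simpa using hv)
  obtain ⟨ζe, hζ, -⟩ := Units.exist_unique_eq_mul_prod L w
  obtain ⟨ζe', -, huniq⟩ := Units.exist_unique_eq_mul_prod L (Units.fundSystem L i)
  have h1 := huniq (1, Pi.single i 1) (by
    simp [Pi.single_apply, apply_ite])
  have h2 := huniq (ζe.1 ^ 3, fun j => 3 * ζe.2 j) (by
    beta_reduce
    rw [e]
    conv_lhs => rw [hζ]
    rw [mul_pow, ← Finset.prod_pow]
    simp [zpow_mul, mul_comm (3 : ℤ)])
  have h3 := congrArg (fun z => z.2 i) (h1.trans h2.symm)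
  simp at h3
  omega

variable {K L : Type} [Field K] [NumberField K] [Field L] [NumberField L] [Algebra K L]
  [IsGalois K L]

theorem nf_contra (hdeg : Module.finrank K L = 3)
    (hcl : ∀ x : ClassGroup (𝓞 K), x ^ 3 = 1 → x = 1) (hun : ∀ u : (𝓞 K)ˣ, u ^ 4 = 1)
    (σ : L ≃ₐ[K] L) (hσ : σ ≠ 1)
    (hP : ∀ P : Ideal (𝓞 L), P.IsMaximal →
      (∀ u : 𝓞 L, u - galRestrict (𝓞 K) K L (𝓞 L) σ u ∈ P) → False) : False := by
  have : Fact (Nat.Prime 3) := ⟨by norm_num⟩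
  have hcard : Nat.card (L ≃ₐ[K] L) = 3 := by rw [IsGalois.card_aut_eq_finrank, hdeg]
  have hgen : ∀ x, x ∈ Subgroup.zpowers σ := fun x => mem_zpowers_of_prime_card hcard hσ
  have hcyc : IsCyclic (L ≃ₐ[K] L) := ⟨σ, hgen⟩
  set τ := galRestrict (𝓞 K) K L (𝓞 L) σ with hτ
  have hτσ : ∀ x : 𝓞 L, ((τ x : 𝓞 L) : L) = σ x := fun x =>
    algebraMap_galRestrict_apply (𝓞 K) σ x
  have hσ3 : σ ^ 3 = 1 := by rw [← hcard]; exact pow_card_eq_one'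
  have hσ3' : ∀ x, σ (σ (σ x)) = x := fun x => by
    have := congrArg (fun f : L ≃ₐ[K] L => f x) hσ3
    simpa [pow_succ] using this
  have h3 : ∀ x, τ (τ (τ x)) = x := fun x => by
    apply RingOfIntegers.ext
    rw [hτσ, hτσ, hτσ, hσ3']
  have hfix : ∀ x, τ x = x → ∃ y, algebraMap (𝓞 K) (𝓞 L) y = x := by
    intro x hx
    have h1 : σ (x : L) = x := by rw [← hτσ, hx]
    have h2 : ∀ f : L ≃ₐ[K] L, f (x : L) = x := by
      intro f
      obtain ⟨n, rfl⟩ := hgen f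
      have : ∀ f ∈ Subgroup.zpowers σ, f ∈ MulAction.stabilizer (L ≃ₐ[K] L) (x : L) := by
        intro f hf
        exact (Subgroup.zpowers_le.2 (by simpa [MulAction.mem_stabilizer_iff] using h1)) hf
      exact this _ ⟨n, rfl⟩
    have h4 := (IsGalois.mem_bot_iff_fixed (F := K) (x : L)).2 h2
    obtain ⟨y, hy⟩ := IntermediateField.mem_bot.1 h4
    have hyi : IsIntegral ℤ y := by
      have : IsIntegral ℤ (algebraMap K L y) := by rw [hy]; exact RingOfIntegers.isIntegral_coe x
      exact (isIntegral_algebraMap_iff (algebraMap K L).injective).1 this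
    refine ⟨⟨y, hyi⟩, ?_⟩
    apply RingOfIntegers.ext
    exact hy
  have hnorm : ∀ x : L, algebraMap K L (Algebra.norm K x) = x * σ x * σ (σ x) := by
    intro x
    rw [Algebra.norm_eq_prod_automorphisms]
    have hord : orderOf σ = 3 := orderOf_eq_prime hσ3 hσ
    classical
    rw [← IsCyclic.image_range_card hgen, hcard, Finset.prod_image]
    · simp [Finset.prod_range_succ]
    · intro i hi j hj hij
      exact pow_injOn_Iio_orderOf (by simpa [hord] using hi) (by simpa [hord] using hj) hij
  have h90 : ∀ η : 𝓞 L, η * τ η * τ (τ η) = 1 → ∃ x : 𝓞 L, x ≠ 0 ∧ η * τ x = x := by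
    intro η hη
    refine groupCohomology.exists_mul_galRestrict_of_norm_eq_one (A := 𝓞 K) (B := 𝓞 L)
      (K := K) (L := L) hgen (η := η) ?_
    apply (algebraMap K L).injective
    rw [hnorm, map_one]
    have := congrArg (algebraMap (𝓞 L) L) hη
    simpa [hτσ] using this
  have hspan : Ideal.span (Set.range fun u => u - τ u) = ⊤ := by
    by_contra hne
    obtain ⟨P, hPm, hle⟩ := Ideal.exists_le_maximal _ hne
    exact hP P hPm (fun u => hle (Ideal.subset_span ⟨u, rfl⟩))
  have hinjR : Function.Injective (algebraMap (𝓞 K) (𝓞 L)) := FaithfulSMul.algebraMap_injective _ _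
  have hff : Module.FaithfullyFlat (𝓞 K) (𝓞 L) := inferInstance
  apply units_not_all_cubes (L := L)
  · rw [← Module.finrank_mul_finrank ℚ K L, hdeg]
    have : 0 < Module.finrank ℚ K := Module.finrank_pos
    omega
  · exact h94_cube hinjR Ideal.map_injective_of_faithfullyFlat hcl hun τ h3 hfix h90 hspan

end nf


section cubic
open NumberField

lemma exists_cube_approx {a w E : ℤ} (hw : IsCoprime w 3) (e : a ^ 2 - 27 * E = w ^ 3) :
    ∃ c k m : ℤ, w = c ^ 2 + 27 * k ∧ a = c ^ 3 + 27 * m := by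
  obtain ⟨i, j, hij⟩ : IsCoprime w ((3 : ℤ) ^ 3) := hw.pow_right
  have hw1 : i * w = 1 - 27 * j := by linarith
  have e2 : a ^ 2 = w ^ 3 + 27 * E := by linarith
  refine ⟨a * i, w * j * (i * w + 1) - E * i ^ 2, a * j * ((i * w) ^ 2 + i * w + 1) - a * i ^ 3 * E, ?_, ?_⟩
  · linear_combination -i^2 * e2 - w * (1 + i*w) * hw1
  · linear_combination -a * i^3 * e2 - a * (1 + i*w + (i*w)^2) * hw1

lemma three_roots {F : Type*} [Field F] {x y z p q : F} (hx : x ^ 3 - p * x - q = 0)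
    (hy : y ^ 3 - p * y - q = 0) (hz : z ^ 3 - p * z - q = 0) (hxy : x ≠ y) (hxz : x ≠ z)
    (hyz : y ≠ z) : x + y + z = 0 ∧ x ^ 2 + x * y + y ^ 2 = p := by
  have h1 : x ^ 2 + x * y + y ^ 2 = p := by
    apply mul_left_cancel₀ (sub_ne_zero.2 hxy)
    linear_combination hx - hy
  have h2 : x ^ 2 + x * z + z ^ 2 = p := by
    apply mul_left_cancel₀ (sub_ne_zero.2 hxz)
    linear_combination hx - hz
  refine ⟨?_, h1⟩
  apply mul_left_cancel₀ (sub_ne_zero.2 hyz)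
  linear_combination h1 - h2

variable {K L : Type} [Field K] [NumberField K] [Field L] [NumberField L] [Algebra K L]
  [IsGalois K L]

theorem cubic_contra (hdeg : Module.finrank K L = 3)
    (hcl : ∀ x : ClassGroup (𝓞 K), x ^ 3 = 1 → x = 1) (hun : ∀ u : (𝓞 K)ˣ, u ^ 4 = 1)
    {a w A D z : ℤ} (hco : IsCoprime w (6 * A * D * z))
    (e : a ^ 2 - 27 * A * D ^ 2 * z ^ 6 = w ^ 3)
    (t : L) (ht : t ^ 3 - 3 * w * t - 2 * a = 0) (htK : t ∉ Set.range (algebraMap K L)) : False := by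
  obtain ⟨σ, hσt⟩ : ∃ σ : L ≃ₐ[K] L, σ t ≠ t := by
    by_contra! hcon
    exact htK (IntermediateField.mem_bot.1 ((IsGalois.mem_bot_iff_fixed (F := K) t).2 hcon))
  have hσ1 : σ ≠ 1 := by rintro rfl; exact hσt rfl
  have hcard : Nat.card (L ≃ₐ[K] L) = 3 := by rw [IsGalois.card_aut_eq_finrank, hdeg]
  have hσ3 : σ ^ 3 = 1 := by rw [← hcard]; exact pow_card_eq_one'
  have hσ3' : ∀ x, σ (σ (σ x)) = x := fun x => by
    have := congrArg (fun f : L ≃ₐ[K] L => f x) hσ3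
    simpa [pow_succ] using this
  refine nf_contra hdeg hcl hun σ hσ1 ?_
  intro P hPm hP
  set τ := galRestrict (𝓞 K) K L (𝓞 L) σ with hτ
  have hτσ : ∀ x : 𝓞 L, ((τ x : 𝓞 L) : L) = σ x := fun x =>
    algebraMap_galRestrict_apply (𝓞 K) σ x
  have hp := hPm.isPrime
  have hs2 : σ 2 = 2 := map_ofNat σ 2
  have hs3 : σ 3 = 3 := map_ofNat σ 3
  have ht1 : (σ t) ^ 3 - 3 * w * (σ t) - 2 * a = 0 := by
    have := congrArg σ ht; simpa [hs2, hs3] using this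
  have ht2 : (σ (σ t)) ^ 3 - 3 * w * (σ (σ t)) - 2 * a = 0 := by
    have := congrArg σ ht1; simpa [hs2, hs3] using this
  have hn12 : σ t ≠ σ (σ t) := fun h => hσt (σ.injective h).symm
  have hn02 : t ≠ σ (σ t) := fun h => hσt (by conv_lhs => rw [h, hσ3'])
  obtain ⟨hsum, hq⟩ := three_roots ht ht1 ht2 hσt.symm hn02 hn12
  have hti : IsIntegral ℤ t := by
    refine ⟨Polynomial.X ^ 3 - Polynomial.C (3 * w) * Polynomial.X - Polynomial.C (2 * a), ?_, ?_⟩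
    · monicity!
    · simpa [Polynomial.eval₂_sub, Polynomial.eval₂_mul, -eq_intCast, -map_mul] using ht
  have hP2 : ∀ u, 3 * u - (u + τ u + τ (τ u)) ∈ P := by
    intro u
    have h1 := hP u
    have h2 := hP (τ u)
    have := add_mem (add_mem h1 h1) h2
    convert this using 1; ring
  have hcoP : ∀ x y : ℤ, IsCoprime x y → (x : 𝓞 L) ∈ P → (y : 𝓞 L) ∈ P → False := by
    rintro x y ⟨i, j, hij⟩ hx hy
    apply hPm.ne_top
    rw [Ideal.eq_top_iff_one]
    have : (1 : 𝓞 L) = i * x + j * y := by exact_mod_cast hij.symm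
    rw [this]
    exact add_mem (P.mul_mem_left _ hx) (P.mul_mem_left _ hy)
  have hw3 : IsCoprime w 3 := hco.of_isCoprime_of_dvd_right ⟨2 * A * D * z, by ring⟩
  by_cases h3 : (3 : 𝓞 L) ∈ P
  · obtain ⟨c, k, m, hwc, hac⟩ := exists_cube_approx (a := a) (E := A * D ^ 2 * z ^ 6) hw3
      (by linear_combination e)
    have hr : IsIntegral ℤ ((t - 2 * c) / 3) := by
      refine ⟨Polynomial.X ^ 3 + Polynomial.C (2 * c) * Polynomial.X ^ 2 +
        Polynomial.C (c ^ 2 - 9 * k) * Polynomial.X - Polynomial.C (6 * k * c + 2 * m), ?_, ?_⟩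
      · monicity!
      · have hwc' : (w : L) = c ^ 2 + 27 * k := by exact_mod_cast hwc
        have hac' : (a : L) = c ^ 3 + 27 * m := by exact_mod_cast hac
        rw [hwc', hac'] at ht
        simp [Polynomial.eval₂_sub, Polynomial.eval₂_mul, Polynomial.eval₂_add, -eq_intCast, -map_mul, -map_sub,
          -map_add, -map_pow, -map_intCast]
        field_simp
        linear_combination ht
    let r : 𝓞 L := ⟨(t - 2 * c) / 3, hr⟩
    have hrc : (r : L) = (t - 2 * c) / 3 := rfl
    have h1 : r + τ r + τ (τ r) = ((-2 * c : ℤ) : 𝓞 L) := by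
      apply RingOfIntegers.ext
      simp only [map_add, hτσ, hrc, map_div₀, map_sub, map_mul, map_intCast, map_ofNat, hs2, hs3]
      push_cast
      field_simp
      linear_combination hsum
    have h2 := hP2 r
    rw [h1] at h2
    have h4 : ((-2 * c : ℤ) : 𝓞 L) ∈ P := by
      have := sub_mem (P.mul_mem_right r h3) h2
      simpa using this
    refine hcoP (-2 * c) 3 ?_ h4 (by exact_mod_cast h3)
    have hc3 : IsCoprime c 3 := by
      rw [hwc, show c ^ 2 + 27 * k = c * c + 3 * (9 * k) by ring] at hw3
      exact (IsCoprime.of_add_mul_left_left hw3).of_mul_left_left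
    refine IsCoprime.mul_left ⟨1, 1, by norm_num⟩ hc3
  · let T : 𝓞 L := ⟨t, hti⟩
    have hTc : (T : L) = t := rfl
    have h1 : T + τ T + τ (τ T) = 0 := by
      apply RingOfIntegers.ext
      simp only [map_add, hτσ, hTc, map_zero]
      exact hsum
    have h2 := hP2 T
    rw [h1, sub_zero] at h2
    have hT : T ∈ P := (hp.mem_or_mem h2).resolve_left h3
    have hτT : τ T ∈ P := by
      have := sub_mem hT (hP T)
      simpa using this
    have e1 : T ^ 2 + T * τ T + (τ T) ^ 2 = 3 * (w : 𝓞 L) := by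
      apply RingOfIntegers.ext
      simp only [map_add, map_mul, map_pow, hτσ, hTc, map_intCast, map_ofNat]
      exact hq
    have hw : (w : 𝓞 L) ∈ P := by
      refine (hp.mem_or_mem (x := 3) ?_).resolve_left h3
      rw [← e1]
      exact add_mem (add_mem (P.pow_mem_of_mem hT 2 (by norm_num)) (P.mul_mem_right _ hT))
        (P.pow_mem_of_mem hτT 2 (by norm_num))
    have e2 : T ^ 3 - 3 * (w : 𝓞 L) * T = 2 * (a : 𝓞 L) := by
      apply RingOfIntegers.ext
      simp only [map_sub, map_mul, map_pow, hTc, map_intCast, map_ofNat]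
      linear_combination ht
    have h2a : 2 * (a : 𝓞 L) ∈ P := by
      rw [← e2]
      exact sub_mem (P.pow_mem_of_mem hT 3 (by norm_num)) (P.mul_mem_left _ hT)
    refine hcoP w (6 * A * D * z) hco hw ?_
    have e3 : (108 : 𝓞 L) * (A * D ^ 2 * z ^ 6) ∈ P := by
      have e' : (a : 𝓞 L) ^ 2 - 27 * A * D ^ 2 * z ^ 6 = w ^ 3 := by exact_mod_cast e
      have : (108 : 𝓞 L) * (A * D ^ 2 * z ^ 6) = (2 * a) * (2 * a) - 4 * (w : 𝓞 L) ^ 3 := by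
        linear_combination -4 * e'
      rw [this]
      exact sub_mem (P.mul_mem_left _ h2a) (P.mul_mem_left _ (P.pow_mem_of_mem hw 3 (by norm_num)))
    have e4 : ((6 * A * D * z : ℤ) : 𝓞 L) ^ 6 ∈ P := by
      have := P.mul_mem_left (432 * (A : 𝓞 L) ^ 5 * D ^ 4) e3
      convert this using 1
      push_cast; ring
    exact hp.mem_of_pow_mem 6 e4

end cubic


section cubic2
open NumberField Polynomial

lemma IsQuad.cubic_no_root {K : Type*} [Field K] [NumberField K] {A : ℤ} {s : K}
    (h : IsQuad K A s) {w a : ℤ} (hno : ¬ ∃ t : ℤ, t ^ 3 - 3 * w * t - 2 * a = 0) (x : K) :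
    x ^ 3 - 3 * w * x - 2 * a ≠ 0 := by
  intro hx
  have hxi : IsIntegral ℤ x := by
    refine ⟨X ^ 3 - C (3 * w) * X - C (2 * a), ?_, ?_⟩
    · monicity!
    · simpa [eval₂_sub, eval₂_mul, -eq_intCast, -map_mul] using hx
  obtain ⟨p, q, hpq⟩ := h.int_coords ⟨x, hxi⟩
  have hpq' : x = p + q * s := hpq
  have h1 : ((p ^ 3 - 3 * A * p * q ^ 2 - 3 * w * p - 2 * a : ℤ) : K) +
      ((q * (3 * p ^ 2 - A * q ^ 2 - 3 * w) : ℤ) : K) * s = ((0 : ℤ) : K) + ((0 : ℤ) : K) * s := by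
    rw [hpq'] at hx
    push_cast
    linear_combination hx - (3 * p * q ^ 2 + q ^ 3 * s) * h.hs
  obtain ⟨h2, h3⟩ := h.ext_int h1
  rcases mul_eq_zero.1 h3 with hq | hq
  · refine hno ⟨p, ?_⟩
    rw [hq] at h2
    linear_combination h2
  · refine hno ⟨-2 * p, ?_⟩
    linear_combination h2 - 3 * p * hq

theorem IsQuad.HK_aux {K L : Type} [Field K] [NumberField K] [Field L] [NumberField L] [Algebra K L]
    [FiniteDimensional K L]
    {A : ℤ} {s : K}
    (h : IsQuad K A s) (hcl : ∀ x : ClassGroup (𝓞 K), x ^ 3 = 1 → x = 1)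
    {D a z w : ℤ} (hD : D ≠ 0) (hco : IsCoprime w (6 * A * D * z)) (hz : z ≠ 0)
    (e : a ^ 2 - 27 * A * D ^ 2 * z ^ 6 = w ^ 3)
    (f : K[X]) (hfdef : f = X ^ 3 - C (3 * (w : K)) * X - C (2 * (a : K))) (hirr : Irreducible f)
    (hrank : Module.finrank K L = 3) (t : L) (ht : t ^ 3 - 3 * w * t - 2 * a = 0)
    (htK : t ∉ Set.range (algebraMap K L)) (htop : Algebra.adjoin K {t} = ⊤) : False := by
  obtain ⟨δ, hδd⟩ : ∃ δ : L, δ = 54 * D * z ^ 3 * algebraMap K L s := ⟨_, rfl⟩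
  have hs : (algebraMap K L s) ^ 2 = -(A : L) := by rw [← map_pow, h.hs]; simp
  have eL : (a : L) ^ 2 - 27 * A * D ^ 2 * z ^ 6 = w ^ 3 := by
    have := congrArg (Int.cast : ℤ → L) e
    push_cast at this; exact this
  have hδ : δ ^ 2 = (3 * (t ^ 2 - w)) ^ 2 * (12 * w - 3 * t ^ 2) := by
    have h1 : δ ^ 2 = 108 * ((w : L) ^ 3 - a ^ 2) := by
      rw [hδd]
      linear_combination (54 * D * z ^ 3) ^ 2 * hs + 108 * eL
    rw [h1]
    linear_combination -(27 * t ^ 3 - 81 * t * w + 54 * a) * (-1) * ht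
  have hA0 : (A : L) ≠ 0 := by exact_mod_cast h.Apos.ne'
  have hD0 : (D : L) ≠ 0 := by exact_mod_cast hD
  have hz0 : (z : L) ≠ 0 := by exact_mod_cast hz
  have hs0 : algebraMap K L s ≠ 0 := by
    intro h0
    rw [h0] at hs
    apply hA0
    linear_combination hs
  have hδ0 : δ ≠ 0 := by
    rw [hδd]
    refine mul_ne_zero (mul_ne_zero (mul_ne_zero (by norm_num) hD0) (pow_ne_zero _ hz0)) hs0
  have hf' : t ^ 2 - w ≠ 0 := by
    intro h0
    rw [h0] at hδ
    apply hδ0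
    have : δ ^ 2 = 0 := by rw [hδ]; ring
    exact pow_eq_zero_iff (two_ne_zero) |>.1 this
  obtain ⟨ρ, hρ⟩ : ∃ ρ : L, ρ * (3 * (t ^ 2 - w)) = δ :=
    ⟨δ / (3 * (t ^ 2 - w)), div_mul_cancel₀ _ (mul_ne_zero three_ne_zero hf')⟩
  have hρ2 : ρ ^ 2 = 12 * w - 3 * t ^ 2 := by
    have h0 : (3 * (t ^ 2 - w)) ^ 2 ≠ 0 := pow_ne_zero _ (mul_ne_zero (by norm_num) hf')
    apply mul_left_cancel₀ h0
    rw [← hδ, ← hρ]; ring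
  have hfac : f.map (algebraMap K L) = (X - C t) * (X - C ((-t + ρ) / 2)) * (X - C ((-t - ρ) / 2)) := by
    have e1 : f.map (algebraMap K L) = X ^ 3 - C (3 * (w : L)) * X - C (2 * (a : L)) := by
      simp only [hfdef, Polynomial.map_sub, Polynomial.map_mul, Polynomial.map_pow, map_X, map_C,
        map_mul (algebraMap K L), map_intCast (algebraMap K L), map_ofNat (algebraMap K L)]
    have e2 : (X - C t) * (X - C ((-t + ρ) / 2)) * (X - C ((-t - ρ) / 2))
      = X ^ 3 - C (t + (-t + ρ) / 2 + (-t - ρ) / 2) * X ^ 2 +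
        C (t * ((-t + ρ) / 2) + t * ((-t - ρ) / 2) + ((-t + ρ) / 2) * ((-t - ρ) / 2)) * X
        - C (t * ((-t + ρ) / 2) * ((-t - ρ) / 2)) := by
      simp only [C_add, C_mul]; ring
    rw [e1, e2]
    have f1 : t + (-t + ρ) / 2 + (-t - ρ) / 2 = 0 := by ring
    have f2 : t * ((-t + ρ) / 2) + t * ((-t - ρ) / 2) + ((-t + ρ) / 2) * ((-t - ρ) / 2)
        = -(3 * (w : L)) := by linear_combination -hρ2 / 4
    have f3 : t * ((-t + ρ) / 2) * ((-t - ρ) / 2) = 2 * (a : L) := by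
      linear_combination -t * hρ2 / 4 + ht
    rw [f1, f2, f3]
    simp only [C_neg, C_0]; ring
  have hsplit : IsSplittingField K L f := by
    refine ⟨?_, ?_⟩
    · rw [hfac]
      exact ((Splits.X_sub_C _).mul (Splits.X_sub_C _)).mul (Splits.X_sub_C _)
    · rw [eq_top_iff, ← htop]
      apply Algebra.adjoin_mono
      rintro _ rfl
      rw [mem_rootSet]
      refine ⟨hirr.ne_zero, ?_⟩
      rw [aeval_def, ← eval_map, hfac]
      simp
  have : IsGalois K L := IsGalois.of_separable_splitting_field hirr.separable
  exact cubic_contra (K := K) (L := L) hrank hcl h.unit_pow_four hco e t ht htK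

theorem IsQuad.HK' {K : Type} [Field K] [NumberField K] {A : ℤ} {s : K}
    (h : IsQuad K A s) (hcl : ∀ x : ClassGroup (𝓞 K), x ^ 3 = 1 → x = 1)
    {D a z w : ℤ} (hD : D ≠ 0) (hco : IsCoprime w (6 * A * D * z)) (hz : z ≠ 0)
    (e : a ^ 2 - 27 * A * D ^ 2 * z ^ 6 = w ^ 3) :
    ∃ t : ℤ, t ^ 3 - 3 * w * t - 2 * a = 0 := by
  by_contra hno
  have hroot := h.cubic_no_root hno
  obtain ⟨f, hf⟩ : ∃ f : K[X], f = X ^ 3 - C (3 * (w : K)) * X - C (2 * (a : K)) := ⟨_, rfl⟩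
  have hmon : f.Monic := by rw [hf]; monicity!
  have hdeg : f.natDegree = 3 := by rw [hf]; compute_degree!
  have hirr : Irreducible f := by
    rw [hmon.irreducible_iff_roots_eq_zero_of_degree_le_three (by omega) (by omega)]
    rw [Multiset.eq_zero_iff_forall_notMem]
    intro x hx
    have := (mem_roots'.1 hx).2
    simp only [hf, IsRoot, eval_sub, eval_mul, eval_pow, eval_X, eval_C] at this
    exact hroot x this
  have : Fact (Irreducible f) := ⟨hirr⟩
  have hfin : Module.Finite K (AdjoinRoot f) := (AdjoinRoot.powerBasis hirr.ne_zero).finite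
  have hrank : Module.finrank K (AdjoinRoot f) = 3 := by
    rw [(AdjoinRoot.powerBasis hirr.ne_zero).finrank, AdjoinRoot.powerBasis_dim, hdeg]
  have hch : CharZero (AdjoinRoot f) :=
    charZero_of_injective_algebraMap (algebraMap K (AdjoinRoot f)).injective
  have hnf : NumberField (AdjoinRoot f) :=
    { to_charZero := hch, to_finiteDimensional := Module.Finite.trans K (AdjoinRoot f) }
  have ht : (AdjoinRoot.root f) ^ 3 - 3 * w * (AdjoinRoot.root f) - 2 * a = 0 := by
    have := AdjoinRoot.eval₂_root f
    have h2 : eval₂ (AdjoinRoot.of f) (AdjoinRoot.root f)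
      (X ^ 3 - C (3 * (w : K)) * X - C (2 * (a : K))) = 0 := by rw [← hf]; exact this
    simpa only [eval₂_sub, eval₂_mul, eval₂_pow, eval₂_X, eval₂_C, map_mul (AdjoinRoot.of f),
      map_intCast (AdjoinRoot.of f), map_ofNat (AdjoinRoot.of f)] using h2
  have htK : AdjoinRoot.root f ∉ Set.range (algebraMap K (AdjoinRoot f)) := by
    rintro ⟨x, hx⟩
    apply hroot x
    apply (algebraMap K (AdjoinRoot f)).injective
    rw [map_zero, ← ht, ← hx]
    simp only [map_sub, map_mul, map_pow, map_intCast (algebraMap K (AdjoinRoot f)),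
      map_ofNat (algebraMap K (AdjoinRoot f))]
  exact h.HK_aux hcl hD hco hz e f hf hirr hrank _ ht htK AdjoinRoot.adjoinRoot_eq_top

end cubic2

theorem goodTwist_rank {A D : ℤ} (g : GoodTwist A D)
    (hcl : Nat.card {x : ClassGroup (NumberField.RingOfIntegers (quadField (-A))) // x ^ 3 = 1} = 1) :
    mordellRank (-(A * D ^ 2)) = 0 := by
  let := quadField_numberField (-A)
  have hq := quadField_isQuad g.Apos g.Asf g.A4
  have hcl' : ∀ x : ClassGroup (NumberField.RingOfIntegers (quadField (-A))), x ^ 3 = 1 → x = 1 := by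
    intro x hx
    have := (Nat.card_eq_one_iff_unique.1 hcl).1
    exact congrArg Subtype.val (Subsingleton.elim
      (⟨x, hx⟩ : {x : ClassGroup (NumberField.RingOfIntegers (quadField (-A))) // x ^ 3 = 1})
      ⟨1, one_pow 3⟩)
  apply mordellRank_eq_zero
  intro X Y Z hXZ hZ e
  refine g.no_solution ?_ ?_ _ X Y Z rfl hXZ hZ e
  · intro X Y Z hXZ hZ e
    have h1 := g.coprime_X hXZ e
    refine hq.HK hcl' (X := X) (W := D * Z ^ 3) (mul_ne_zero g.D0 (pow_ne_zero _ hZ)) ?_ (by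
      linear_combination e)
    rw [← mul_assoc]
    exact h1.mul_right hXZ.pow_right
  · intro a z w hco hz _ e
    exact hq.HK' hcl' g.D0 hco hz e


section mertens
open Finset

lemma abel_bound {f : ℕ → ℂ} {B : ℝ} (hB : ∀ N, ‖∑ n ∈ range N, f n‖ ≤ B) {w : ℕ → ℝ} {M : ℕ}
    (hw : ∀ n, M ≤ n → w (n + 1) ≤ w n) (hw0 : ∀ n, M ≤ n → 0 ≤ w n) {N : ℕ} (hMN : M ≤ N) :
    ‖∑ n ∈ Ico M N, (w n : ℂ) * f n‖ ≤ 2 * B * w M := by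
  have hB0 : 0 ≤ B := (norm_nonneg _).trans (hB 0)
  have hd : ∀ N, ‖∑ n ∈ range N, f n - ∑ n ∈ range M, f n‖ ≤ 2 * B := fun N =>
    (norm_sub_le _ _).trans (by linarith [hB N, hB M])
  have key : ∀ N, M ≤ N → ‖∑ n ∈ Ico M N, (w n : ℂ) * f n -
      (w N : ℂ) * (∑ n ∈ range N, f n - ∑ n ∈ range M, f n)‖ ≤ 2 * B * (w M - w N) := by
    intro N hN
    induction N, hN using Nat.le_induction with
    | base => simp
    | succ N hN ih =>
      have e : ∑ n ∈ Ico M (N + 1), (w n : ℂ) * f n -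
          (w (N + 1) : ℂ) * (∑ n ∈ range (N + 1), f n - ∑ n ∈ range M, f n)
          = (∑ n ∈ Ico M N, (w n : ℂ) * f n -
            (w N : ℂ) * (∑ n ∈ range N, f n - ∑ n ∈ range M, f n))
          + ((w N - w (N + 1) : ℝ) : ℂ) * (∑ n ∈ range (N + 1), f n - ∑ n ∈ range M, f n) := by
        rw [sum_Ico_succ_top hN, sum_range_succ]; push_cast; ring
      rw [e]
      refine (norm_add_le _ _).trans ?_
      have h2 : ‖((w N - w (N + 1) : ℝ) : ℂ) * (∑ n ∈ range (N + 1), f n - ∑ n ∈ range M, f n)‖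
          ≤ (w N - w (N + 1)) * (2 * B) := by
        rw [norm_mul, Complex.norm_real, Real.norm_eq_abs, abs_of_nonneg (by linarith [hw N hN])]
        exact mul_le_mul_of_nonneg_left (hd _) (by linarith [hw N hN])
      linarith
  have h1 := key N hMN
  have h2 : ‖(w N : ℂ) * (∑ n ∈ range N, f n - ∑ n ∈ range M, f n)‖ ≤ w N * (2 * B) := by
    rw [norm_mul, Complex.norm_real, Real.norm_eq_abs, abs_of_nonneg (hw0 N hMN)]
    exact mul_le_mul_of_nonneg_left (hd _) (hw0 N hMN)
  have h3 := norm_le_norm_sub_add (∑ n ∈ Ico M N, (w n : ℂ) * f n)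
    ((w N : ℂ) * (∑ n ∈ range N, f n - ∑ n ∈ range M, f n))
  linarith

variable {q : ℕ} [NeZero q]

lemma char_partial_sum {χ : DirichletCharacter ℂ q} (hχ : χ ≠ 1) (N : ℕ) :
    ‖∑ n ∈ range N, χ (n : ZMod q)‖ ≤ q := by
  have hq : 0 < q := Nat.pos_of_neZero q
  have h0 : ∑ n ∈ range q, χ (n : ZMod q) = 0 := by
    rw [← MulChar.sum_eq_zero_of_ne_one hχ]
    refine Finset.sum_bij (fun n _ => (n : ZMod q)) (fun _ _ => mem_univ _) ?_ ?_ (fun _ _ => rfl)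
    · intro a ha b hb hab
      rw [mem_range] at ha hb
      have := (ZMod.natCast_eq_natCast_iff' a b q).1 hab
      rwa [Nat.mod_eq_of_lt ha, Nat.mod_eq_of_lt hb] at this
    · intro b _
      exact ⟨b.val, mem_range.2 (ZMod.val_lt b), ZMod.natCast_zmod_val b⟩
  induction N using Nat.strong_induction_on with
  | _ N ih =>
    by_cases h : N < q
    · calc ‖∑ n ∈ range N, χ (n : ZMod q)‖ ≤ ∑ n ∈ range N, ‖χ (n : ZMod q)‖ := norm_sum_le _ _
        _ ≤ ∑ n ∈ range N, 1 := sum_le_sum fun _ _ => DirichletCharacter.norm_le_one _ _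
        _ ≤ q := by simp; exact_mod_cast h.le
    · obtain ⟨M, rfl⟩ := Nat.exists_eq_add_of_le (not_lt.1 h)
      rw [Finset.sum_range_add, h0, zero_add]
      simpa using ih M (by omega)

/-- truncated `L(1,χ)` -/
lemma char_L_one {χ : DirichletCharacter ℂ q} (hχ : χ ≠ 1) (N : ℕ) (hN : 1 ≤ N) :
    ‖∑ n ∈ range N, ((n : ℝ)⁻¹ : ℝ) * χ (n : ZMod q) - χ.LFunction 1‖ ≤ 2 * q / N := by
  have hbd : ∀ s : ℝ, 1 < s →
      ‖∑ n ∈ range N, (((n : ℝ) ^ (-s) : ℝ) : ℂ) * χ (n : ZMod q) - χ.LFunction s‖ ≤ 2 * q * (N : ℝ) ^ (-s) := by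
    intro s hs
    have hs' : 1 < (s : ℂ).re := by simpa using hs
    have hsum := (DirichletCharacter.LSeriesSummable_of_one_lt_re χ hs').hasSum
    have hterm : ∀ n, LSeries.term (fun n => χ (n : ZMod q)) s n
        = (((n : ℝ) ^ (-s) : ℝ) : ℂ) * χ (n : ZMod q) := by
      intro n
      rcases Nat.eq_zero_or_pos n with rfl | hn
      · simp [Real.zero_rpow (show -s ≠ 0 by linarith)]
      · rw [LSeries.term_of_ne_zero hn.ne', Complex.ofReal_cpow (by positivity)]
        push_cast
        rw [Complex.cpow_neg]
        field_simp
    have hT : Tendsto (fun M => ∑ n ∈ range M, (((n : ℝ) ^ (-s) : ℝ) : ℂ) * χ (n : ZMod q)) atTop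
        (nhds (χ.LFunction s)) := by
      rw [DirichletCharacter.LFunction_eq_LSeries χ hs']
      have := hsum.tendsto_sum_nat
      simpa only [hterm, LSeries] using this
    have hT2 := (tendsto_const_nhds (x := ∑ n ∈ range N, (((n : ℝ) ^ (-s) : ℝ) : ℂ) * χ (n : ZMod q))).sub hT
    refine le_of_tendsto hT2.norm ?_
    filter_upwards [eventually_ge_atTop N] with M hM
    rw [norm_sub_rev, ← sum_Ico_eq_sub _ hM]
    refine abel_bound (w := fun n => (n : ℝ) ^ (-s)) (char_partial_sum hχ) ?_ ?_ hM
    · intro n hn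
      apply Real.rpow_le_rpow_of_nonpos <;> [skip; skip; linarith]
      · exact_mod_cast (by omega)
      · exact_mod_cast (by omega)
    · intro n hn; positivity
  have hN0 : (0 : ℝ) < N := by exact_mod_cast hN
  -- limit s → 1+
  have hL : Tendsto (fun s : ℝ => ‖∑ n ∈ range N, (((n : ℝ) ^ (-s) : ℝ) : ℂ) * χ (n : ZMod q) - χ.LFunction s‖)
      (nhdsWithin 1 (Set.Ioi 1))
      (nhds ‖∑ n ∈ range N, ((n : ℝ)⁻¹ : ℝ) * χ (n : ZMod q) - χ.LFunction 1‖) := by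
    refine Tendsto.norm (Tendsto.sub ?_ ?_)
    · refine tendsto_finsetSum _ fun n _ => ?_
      refine Tendsto.mul_const _ ?_
      refine (Complex.continuous_ofReal.tendsto _).comp ?_
      rw [← Real.rpow_neg_one]
      rcases Nat.eq_zero_or_pos n with rfl | hn
      · refine Tendsto.congr' (f₁ := fun _ => (((0:ℕ):ℝ)) ^ (-1:ℝ)) ?_ tendsto_const_nhds
        filter_upwards [self_mem_nhdsWithin] with s hs
        have : (1:ℝ) < s := hs
        simp [Real.zero_rpow (show -s ≠ 0 by linarith)]
      · have : ContinuousAt (fun s : ℝ => (n : ℝ) ^ (-s)) 1 := by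
          apply ContinuousAt.rpow <;> [fun_prop; fun_prop; skip]
          left; positivity
        exact this.tendsto.mono_left nhdsWithin_le_nhds
    · have h1 := (DirichletCharacter.differentiable_LFunction hχ).continuous
      have h2 : Continuous (fun s : ℝ => χ.LFunction s) := h1.comp Complex.continuous_ofReal
      have := h2.tendsto 1
      simpa using this.mono_left nhdsWithin_le_nhds
  have hR : Tendsto (fun s : ℝ => 2 * q * (N : ℝ) ^ (-s)) (nhdsWithin 1 (Set.Ioi 1)) (nhds (2 * q / N)) := by
    have : ContinuousAt (fun s : ℝ => 2 * q * (N : ℝ) ^ (-s)) 1 := by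
      refine ContinuousAt.mul (by fun_prop) ?_
      apply ContinuousAt.rpow <;> [fun_prop; fun_prop; skip]
      left; positivity
    have h2 := this.tendsto.mono_left (nhdsWithin_le_nhds (s := Set.Ioi 1))
    rwa [Real.rpow_neg_one, ← div_eq_mul_inv] at h2
  refine le_of_tendsto_of_tendsto hL hR ?_
  filter_upwards [self_mem_nhdsWithin] with s hs using hbd s hs

lemma char_log_sum {χ : DirichletCharacter ℂ q} (hχ : χ ≠ 1) :
    ∃ C, ∀ N, ‖∑ n ∈ range N, ((Real.log n / n : ℝ) : ℂ) * χ (n : ZMod q)‖ ≤ C := by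
  have hmono : ∀ n : ℕ, 3 ≤ n → Real.log ((n + 1 : ℕ) : ℝ) / ((n + 1 : ℕ) : ℝ) ≤ Real.log n / n := by
    intro n hn
    have h3 : Real.exp 1 ≤ n := by
      have := Real.exp_one_lt_d9
      have : (3 : ℝ) ≤ n := by exact_mod_cast hn
      linarith
    exact Real.log_div_self_antitoneOn h3 (by push_cast; simp; linarith) (by push_cast; linarith)
  refine ⟨(∑ n ∈ range 3, ‖((Real.log n / n : ℝ) : ℂ) * χ (n : ZMod q)‖) + 2 * q * (Real.log (3:ℕ) / (3:ℕ)), fun N => ?_⟩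
  have hn : (0:ℝ) ≤ 2 * q * (Real.log (3:ℕ) / (3:ℕ)) := by
    have := Real.log_natCast_nonneg 3
    positivity
  rcases le_total N 3 with h | h
  · refine (norm_sum_le _ _).trans ?_
    have := sum_le_sum_of_subset_of_nonneg (f := fun n : ℕ => ‖((Real.log n / n : ℝ) : ℂ) * χ (n : ZMod q)‖)
      (range_mono h) (fun _ _ _ => norm_nonneg _)
    linarith
  · rw [← Finset.sum_range_add_sum_Ico _ h]
    refine (norm_add_le _ _).trans ?_
    refine add_le_add (norm_sum_le _ _) ?_
    refine abel_bound (w := fun n => Real.log n / n) (char_partial_sum hχ) hmono ?_ h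
    intro n _
    have := Real.log_natCast_nonneg n
    positivity

end mertens


section mertens2
open Finset ArithmeticFunction

lemma sum_range_succ_eq_Ioc {M : Type*} [AddCommMonoid M] (f : ℕ → M) (h0 : f 0 = 0) (N : ℕ) :
    ∑ n ∈ range (N + 1), f n = ∑ n ∈ Ioc 0 N, f n := by
  rw [Finset.sum_range_succ', h0, add_zero]
  exact Finset.sum_bij (fun n _ => n + 1) (fun n hn => by simp at hn ⊢; omega)
    (fun a _ b _ h => by simpa using h) (fun b hb => ⟨b - 1, by simp at hb ⊢; omega, by simp at hb; omega⟩)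
    (fun _ _ => rfl)

lemma psi_bound (N : ℕ) : ∑ n ∈ Ioc 0 N, vonMangoldt n ≤ (Real.log 4 + 4) * N := by
  have := Chebyshev.psi_le_const_mul_self (x := N) (by positivity)
  simpa [Chebyshev.psi] using this

variable {q : ℕ} [NeZero q]

lemma char_mangoldt {χ : DirichletCharacter ℂ q} (hχ : χ ≠ 1) :
    ∃ C : ℝ, ∀ N : ℕ, ‖∑ n ∈ Ioc 0 N, χ (n : ZMod q) * ((vonMangoldt n / n : ℝ) : ℂ)‖ ≤ C := by
  obtain ⟨C, hC⟩ := char_log_sum hχ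
  have hL := DirichletCharacter.LFunction_apply_one_ne_zero hχ
  let f : ArithmeticFunction ℂ := ⟨fun n => χ (n : ZMod q) * ((vonMangoldt n / n : ℝ) : ℂ), by simp⟩
  let g : ArithmeticFunction ℂ := ⟨fun n => ((n : ℝ)⁻¹ : ℝ) * χ (n : ZMod q), by simp⟩
  have hfg : ∀ n, (f * g) n = ((Real.log n / n : ℝ) : ℂ) * χ (n : ZMod q) := by
    intro n
    rw [ArithmeticFunction.mul_apply]
    have : ∀ x ∈ n.divisorsAntidiagonal, f x.1 * g x.2 =
        (vonMangoldt x.1 : ℂ) * (((n : ℝ)⁻¹ : ℝ) * χ (n : ZMod q)) := by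
      intro x hx
      obtain ⟨h1, h2⟩ := Nat.mem_divisorsAntidiagonal.1 hx
      simp only [f, g, ArithmeticFunction.coe_mk]
      rw [← h1]
      push_cast
      rw [map_mul, mul_inv, div_eq_mul_inv]
      ring
    rw [sum_congr rfl this, ← sum_mul, ← Complex.ofReal_sum, 
      Nat.sum_divisorsAntidiagonal (fun i _ => vonMangoldt i), vonMangoldt_sum]
    push_cast
    rw [div_eq_mul_inv]; ring
  refine ⟨(C + 2 * q * (Real.log 4 + 4)) / ‖χ.LFunction 1‖, fun N => ?_⟩
  rw [le_div_iff₀ (norm_pos_iff.2 hL), ← norm_mul]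
  rcases Nat.eq_zero_or_pos N with rfl | hN
  · have := (norm_nonneg _).trans (hC 0)
    have := Real.log_nonneg (show (1:ℝ) ≤ 4 by norm_num)
    simp; positivity
  have hN0 : (0 : ℝ) < N := by exact_mod_cast hN
  have h1 := ArithmeticFunction.sum_Ioc_mul_eq_sum_sum f g N
  simp only [hfg] at h1
  rw [← sum_range_succ_eq_Ioc _ (by simp)] at h1
  have h2 : (∑ n ∈ Ioc 0 N, χ (n : ZMod q) * ((vonMangoldt n / n : ℝ) : ℂ)) * χ.LFunction 1
      = ∑ n ∈ range (N + 1), ((Real.log n / n : ℝ) : ℂ) * χ (n : ZMod q)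
        - ∑ n ∈ Ioc 0 N, f n * (∑ m ∈ Ioc 0 (N / n), g m - χ.LFunction 1) := by
    rw [h1, ← sum_sub_distrib, sum_mul]
    refine sum_congr rfl fun n _ => ?_
    change f n * _ = _
    ring
  rw [h2]
  refine (norm_sub_le _ _).trans (add_le_add (hC _) ?_)
  calc ‖∑ n ∈ Ioc 0 N, f n * (∑ m ∈ Ioc 0 (N / n), g m - χ.LFunction 1)‖
      ≤ ∑ n ∈ Ioc 0 N, ‖f n * (∑ m ∈ Ioc 0 (N / n), g m - χ.LFunction 1)‖ := norm_sum_le _ _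
    _ ≤ ∑ n ∈ Ioc 0 N, vonMangoldt n * (2 * q / N) := by
      refine sum_le_sum fun n hn => ?_
      obtain ⟨hn0, hnN⟩ := mem_Ioc.1 hn
      have hn0' : (0 : ℝ) < n := by exact_mod_cast hn0
      rw [norm_mul]
      have e1 : ‖f n‖ ≤ vonMangoldt n / n := by
        simp only [f, ArithmeticFunction.coe_mk, norm_mul, Complex.norm_real, Real.norm_eq_abs]
        rw [abs_of_nonneg (div_nonneg vonMangoldt_nonneg hn0'.le)]
        exact mul_le_of_le_one_left (div_nonneg vonMangoldt_nonneg hn0'.le)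
          (DirichletCharacter.norm_le_one _ _)
      have e2 : ‖∑ m ∈ Ioc 0 (N / n), g m - χ.LFunction 1‖ ≤ 2 * q * (n / N) := by
        rw [← sum_range_succ_eq_Ioc _ g.map_zero]
        refine (char_L_one hχ _ (Nat.le_add_left 1 _)).trans ?_
        rw [div_eq_mul_inv]
        refine mul_le_mul_of_nonneg_left ?_ (by positivity)
        rw [inv_le_comm₀ (by positivity) (by positivity), inv_div, div_le_iff₀ hn0']
        have := Nat.lt_div_mul_add (a := N) hn0
        have h3 : N < (N / n + 1) * n := by nlinarith
        exact_mod_cast h3.le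
      calc _ ≤ vonMangoldt n / n * (2 * q * (n / N)) :=
            mul_le_mul e1 e2 (norm_nonneg _) (div_nonneg vonMangoldt_nonneg hn0'.le)
        _ = _ := by field_simp
    _ = (∑ n ∈ Ioc 0 N, vonMangoldt n) * (2 * q / N) := by rw [sum_mul]
    _ ≤ (Real.log 4 + 4) * N * (2 * q / N) :=
        mul_le_mul_of_nonneg_right (psi_bound N) (by positivity)
    _ = _ := by field_simp

lemma mangoldt_sum : ∃ C, ∀ N : ℕ, 1 ≤ N →
    |∑ n ∈ Ioc 0 N, vonMangoldt n / n - Real.log N| ≤ C := by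
  refine ⟨Real.log 4 + 4, fun N hN => ?_⟩
  have hN0 : (0 : ℝ) < N := by exact_mod_cast hN
  have h1 := ArithmeticFunction.sum_Ioc_mul_zeta_eq_sum vonMangoldt N
  rw [vonMangoldt_mul_zeta] at h1
  simp only [ArithmeticFunction.log_apply] at h1
  have h2 : ∑ n ∈ Ioc 0 N, Real.log n = Real.log (N.factorial) := by
    clear h1 hN hN0
    induction N with
    | zero => simp
    | succ N ih =>
      rw [Finset.sum_Ioc_succ_top (by omega), ih, Nat.factorial_succ]
      push_cast
      rw [Real.log_mul (by positivity) (by positivity)]; ring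
  rw [h2] at h1
  have hup : Real.log N.factorial ≤ N * Real.log N := by
    rw [← Real.log_pow]
    exact Real.log_le_log (by positivity) (by exact_mod_cast Nat.factorial_le_pow N)
  have hlo : N * Real.log N - N ≤ Real.log N.factorial := by
    have h3 : (N : ℝ) ^ N / N.factorial ≤ Real.exp N := by
      exact Real.pow_div_factorial_le_exp N (by positivity) N
    have h4 := Real.log_le_log (by positivity) h3
    rw [Real.log_exp, Real.log_div (by positivity) (by positivity), Real.log_pow] at h4
    linarith
  have s1 : Real.log N.factorial ≤ N * ∑ n ∈ Ioc 0 N, vonMangoldt n / n := by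
    rw [h1, mul_sum]
    refine sum_le_sum fun n hn => ?_
    have := Nat.cast_div_le (α := ℝ) (m := N) (n := n)
    calc vonMangoldt n * ((N / n : ℕ) : ℝ) ≤ vonMangoldt n * (N / n) :=
          mul_le_mul_of_nonneg_left this vonMangoldt_nonneg
      _ = _ := by ring
  have s2 : N * ∑ n ∈ Ioc 0 N, vonMangoldt n / n - (Real.log 4 + 4) * N ≤ Real.log N.factorial := by
    have : N * ∑ n ∈ Ioc 0 N, vonMangoldt n / n - ∑ n ∈ Ioc 0 N, vonMangoldt n ≤ Real.log N.factorial := by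
      rw [h1, mul_sum, ← sum_sub_distrib]
      refine sum_le_sum fun n hn => ?_
      obtain ⟨hn0, hnN⟩ := mem_Ioc.1 hn
      have hn0' : (0 : ℝ) < n := by exact_mod_cast hn0
      have h3 : N < (N / n + 1) * n := by nlinarith [Nat.lt_div_mul_add (a := N) hn0]
      have h4 : (N : ℝ) / n ≤ (N / n : ℕ) + 1 := by
        rw [div_le_iff₀ hn0']; exact_mod_cast h3.le
      calc _ = vonMangoldt n * (N / n - 1) := by ring
        _ ≤ _ := mul_le_mul_of_nonneg_left (by linarith) vonMangoldt_nonneg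
    linarith [psi_bound N]
  have h4 : 0 ≤ Real.log 4 := Real.log_nonneg (by norm_num)
  rw [abs_le]
  constructor
  · have : N * (Real.log N - 1) ≤ N * ∑ n ∈ Ioc 0 N, vonMangoldt n / n := by linarith
    have := le_of_mul_le_mul_left this hN0
    linarith
  · have : N * ∑ n ∈ Ioc 0 N, vonMangoldt n / n ≤ N * (Real.log N + (Real.log 4 + 4)) := by linarith
    have := le_of_mul_le_mul_left this hN0
    linarith

end mertens2


section mertens3
open Finset ArithmeticFunction ArithmeticFunction.vonMangoldt

lemma nonprime_bound {q : ℕ} (a : ZMod q) : ∃ C : ℝ, ∀ N : ℕ,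
    ∑ n ∈ Ioc 0 N, (if n.Prime then 0 else residueClass a n) / n ≤ C :=
  ⟨_, fun N => (summable_residueClass_non_primes_div a).sum_le_tsum (Ioc 0 N)
    (fun n _ => div_nonneg (by split_ifs; exacts [le_rfl, residueClass_nonneg a n]) (by positivity))⟩

variable {q : ℕ} [NeZero q]

lemma principal_mangoldt : ∃ C : ℝ, ∀ N : ℕ, 1 ≤ N →
    ‖∑ n ∈ Ioc 0 N, (1 : DirichletCharacter ℂ q) (n : ZMod q) * ((vonMangoldt n / n : ℝ) : ℂ)
      - (Real.log N : ℂ)‖ ≤ C := by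
  obtain ⟨C1, h1⟩ := mangoldt_sum
  obtain ⟨C2, h2⟩ := nonprime_bound (0 : ZMod 1)
  let E : ℕ → ℝ := fun n => if IsUnit (n : ZMod q) then 0 else vonMangoldt n / n
  have hE : ∀ N, ∑ n ∈ Ioc 0 N, E n ≤ C2 + ∑ p ∈ q.primeFactors, Real.log p / p := by
    intro N
    have hb : ∀ n ∈ Ioc 0 N, E n ≤ (if n.Prime then 0 else residueClass (0 : ZMod 1) n) / n
        + (if n ∈ q.primeFactors then Real.log n / n else 0) := by
      intro n hn
      have hn0 := (mem_Ioc.1 hn).1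
      have hr : residueClass (0 : ZMod 1) n = vonMangoldt n := by
        exact Set.indicator_of_mem (show n ∈ {m : ℕ | (m : ZMod 1) = 0} from Subsingleton.elim _ _) _
      rw [hr]
      have hnn : 0 ≤ vonMangoldt n / (n : ℝ) := div_nonneg vonMangoldt_nonneg (by positivity)
      have hl : 0 ≤ Real.log n / n := div_nonneg (Real.log_natCast_nonneg n) (by positivity)
      simp only [E]
      by_cases hp : n.Prime
      · by_cases hu : IsUnit (n : ZMod q)
        · simp only [hu, hp, if_true, zero_div, zero_add]
          split_ifs
          exacts [hl, le_rfl]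
        · have hd : n ∣ q := by
            by_contra hnd
            exact hu ((ZMod.isUnit_iff_coprime n q).2 ((Nat.Prime.coprime_iff_not_dvd hp).2 hnd))
          have : n ∈ q.primeFactors := Nat.mem_primeFactors.2 ⟨hp, hd, NeZero.ne q⟩
          simp only [hu, hp, this, if_true, if_false, zero_div, zero_add, vonMangoldt_apply_prime hp]
          exact le_rfl
      · simp only [hp, if_false]
        have : n ∉ q.primeFactors := fun h => hp (Nat.prime_of_mem_primeFactors h)
        simp only [this, if_false, add_zero]
        split_ifs
        exacts [hnn, le_rfl]
    refine (sum_le_sum hb).trans ?_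
    rw [sum_add_distrib]
    refine add_le_add (h2 N) ?_
    rw [← sum_filter]
    refine sum_le_sum_of_subset_of_nonneg (fun n hn => (mem_filter.1 hn).2) ?_
    intro n _ _
    exact div_nonneg (Real.log_natCast_nonneg n) (by positivity)
  have hE0 : ∀ N, 0 ≤ ∑ n ∈ Ioc 0 N, E n := fun N => sum_nonneg fun n _ => by
    simp only [E]
    split_ifs
    exacts [le_rfl, div_nonneg vonMangoldt_nonneg (by positivity)]
  refine ⟨C1 + (C2 + ∑ p ∈ q.primeFactors, Real.log p / p), fun N hN => ?_⟩
  have e : ∑ n ∈ Ioc 0 N, (1 : DirichletCharacter ℂ q) (n : ZMod q) * ((vonMangoldt n / n : ℝ) : ℂ)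
      - (Real.log N : ℂ) = ((∑ n ∈ Ioc 0 N, vonMangoldt n / n - Real.log N : ℝ) : ℂ) -
        ((∑ n ∈ Ioc 0 N, E n : ℝ) : ℂ) := by
    have : ∑ n ∈ Ioc 0 N, (1 : DirichletCharacter ℂ q) (n : ZMod q) * ((vonMangoldt n / n : ℝ) : ℂ)
      = ((∑ n ∈ Ioc 0 N, vonMangoldt n / n : ℝ) : ℂ) - ((∑ n ∈ Ioc 0 N, E n : ℝ) : ℂ) := by
      rw [Complex.ofReal_sum, Complex.ofReal_sum, ← sum_sub_distrib]
      refine sum_congr rfl fun n _ => ?_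
      by_cases hu : IsUnit (n : ZMod q)
      · rw [MulChar.one_apply hu]; simp [E, hu]
      · rw [MulChar.map_nonunit _ hu]; simp [E, hu]
    rw [this]; push_cast; ring
  rw [e]
  refine (norm_sub_le _ _).trans (add_le_add ?_ ?_)
  · rw [Complex.norm_real]; exact h1 N hN
  · rw [Complex.norm_real, Real.norm_eq_abs, abs_of_nonneg (hE0 N)]; exact hE N

lemma mertens_residue {a : ZMod q} (ha : IsUnit a) : ∃ C : ℝ, ∀ N : ℕ, 1 ≤ N →
    |∑ n ∈ Ioc 0 N, residueClass a n / n - (q.totient : ℝ)⁻¹ * Real.log N| ≤ C := by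
  classical
  have hex : ∀ χ : DirichletCharacter ℂ q, ∃ C : ℝ, ∀ N : ℕ, 1 ≤ N →
      ‖∑ n ∈ Ioc 0 N, χ (n : ZMod q) * ((vonMangoldt n / n : ℝ) : ℂ)
        - (if χ = 1 then (Real.log N : ℂ) else 0)‖ ≤ C := by
    intro χ
    by_cases h : χ = 1
    · subst h; simpa using principal_mangoldt (q := q)
    · obtain ⟨C, hC⟩ := char_mangoldt h
      exact ⟨C, fun N _ => by simpa [h] using hC N⟩
  choose C hC using hex
  refine ⟨(q.totient : ℝ)⁻¹ * ∑ χ, C χ, fun N hN => ?_⟩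
  have e : ((∑ n ∈ Ioc 0 N, residueClass a n / n - (q.totient : ℝ)⁻¹ * Real.log N : ℝ) : ℂ)
      = (q.totient : ℂ)⁻¹ * ∑ χ : DirichletCharacter ℂ q, χ a⁻¹ *
        (∑ n ∈ Ioc 0 N, χ (n : ZMod q) * ((vonMangoldt n / n : ℝ) : ℂ)
        - (if χ = 1 then (Real.log N : ℂ) else 0)) := by
    simp only [mul_sub, sum_sub_distrib]
    rw [Complex.ofReal_sub]
    congr 1
    · simp only [mul_sum]
      rw [sum_comm, Complex.ofReal_sum]
      refine sum_congr rfl fun n _ => ?_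
      rw [Complex.ofReal_div, residueClass_apply ha, div_eq_mul_inv, mul_assoc, sum_mul, mul_sum]
      refine sum_congr rfl fun χ _ => ?_
      push_cast
      rw [div_eq_mul_inv]; ring
    · simp only [mul_ite, mul_zero, sum_ite_eq', mem_univ, if_true]
      have : IsUnit a⁻¹ := by
        obtain ⟨u, rfl⟩ := ha
        rw [ZMod.inv_coe_unit]; exact Units.isUnit _
      rw [MulChar.one_apply this]; push_cast; ring
  rw [← Real.norm_eq_abs, ← Complex.norm_real, e, norm_mul]
  have : ‖(q.totient : ℂ)⁻¹‖ = (q.totient : ℝ)⁻¹ := by simp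
  rw [this]
  refine mul_le_mul_of_nonneg_left ?_ (by positivity)
  refine (norm_sum_le _ _).trans (sum_le_sum fun χ _ => ?_)
  rw [norm_mul]
  calc _ ≤ 1 * ‖∑ n ∈ Ioc 0 N, χ (n : ZMod q) * ((vonMangoldt n / n : ℝ) : ℂ)
        - (if χ = 1 then (Real.log N : ℂ) else 0)‖ :=
        mul_le_mul_of_nonneg_right (DirichletCharacter.norm_le_one _ _) (norm_nonneg _)
    _ ≤ _ := by rw [one_mul]; exact hC χ N hN

/-- Mertens' first theorem in arithmetic progressions. -/
theorem mertens_AP {a : ZMod q} (ha : IsUnit a) : ∃ C : ℝ, ∀ N : ℕ, 1 ≤ N →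
    |∑ p ∈ (Ioc 0 N).filter (fun p : ℕ => p.Prime ∧ (p : ZMod q) = a), Real.log p / p
      - (q.totient : ℝ)⁻¹ * Real.log N| ≤ C := by
  obtain ⟨C1, h1⟩ := mertens_residue ha
  obtain ⟨C2, h2⟩ := nonprime_bound a
  refine ⟨C1 + C2, fun N hN => ?_⟩
  have e : ∑ p ∈ (Ioc 0 N).filter (fun p : ℕ => p.Prime ∧ (p : ZMod q) = a), Real.log p / p
    = ∑ n ∈ Ioc 0 N, residueClass a n / n
      - ∑ n ∈ Ioc 0 N, (if n.Prime then 0 else residueClass a n) / n := by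
    rw [← sum_sub_distrib, sum_filter]
    refine sum_congr rfl fun n _ => ?_
    by_cases hp : n.Prime
    · by_cases hn : (n : ZMod q) = a
      · have : residueClass a n = Real.log n := by
          rw [← vonMangoldt_apply_prime hp]
          exact Set.indicator_of_mem (show n ∈ {m : ℕ | (m : ZMod q) = a} from hn) _
        simp only [hp, hn, this, and_self, if_true, zero_div, sub_zero]
      · have : residueClass a n = 0 := Set.indicator_of_notMem (show n ∉ {m : ℕ | (m : ZMod q) = a} from hn) _
        simp only [hp, hn, this, and_false, if_true, if_false, zero_div, sub_zero]
    · simp only [hp, false_and, if_false, sub_self]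
  have h0 : 0 ≤ ∑ n ∈ Ioc 0 N, (if n.Prime then 0 else residueClass a n) / n :=
    sum_nonneg fun n _ => div_nonneg (by split_ifs; exacts [le_rfl, residueClass_nonneg a n]) (by positivity)
  have h3 := abs_le.1 (h1 N hN)
  have h4 := h2 N
  rw [e, abs_le]
  constructor <;> linarith

end mertens3


section density
open Finset

/-- square-free with all prime factors satisfying `P` -/
def GoodNum (P : ℕ → Prop) (m : ℕ) : Prop := Squarefree m ∧ ∀ p, p.Prime → p ∣ m → P p

variable {P : ℕ → Prop} {κ C : ℝ}

open Classical in
lemma dens_theta (hκ : 0 < κ) (hM : ∀ N : ℕ, 1 ≤ N →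
    |∑ p ∈ (Ioc 0 N).filter P, Real.log p / p - κ * Real.log N| ≤ C) :
    ∃ δ : ℝ, 0 < δ ∧ ∃ K : ℕ, ∀ N : ℕ, K ≤ N → δ * N ≤ ∑ p ∈ (Ioc 0 N).filter P, Real.log p := by
  obtain ⟨K, hK⟩ := exists_nat_ge (Real.exp ((1 + 2 * C) / κ))
  have hK0' : (0 : ℝ) < K := (Real.exp_pos _).trans_le hK
  have hK0 : 0 < K := by exact_mod_cast hK0'
  have hlogK : 1 + 2 * C ≤ κ * Real.log K := by
    have := (Real.le_log_iff_exp_le hK0').2 hK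
    rw [div_le_iff₀ hκ] at this; linarith
  refine ⟨1 / K, by positivity, K, fun N hN => ?_⟩
  have hN1 : 1 ≤ N := by omega
  have hN0 : (0 : ℝ) < N := by exact_mod_cast hN1
  have hM1 : 1 ≤ N / K := (Nat.one_le_div_iff hK0).2 hN
  have h1 := (abs_le.1 (hM N hN1)).1
  have h2 := (abs_le.1 (hM (N / K) hM1)).2
  have h3 : Real.log ((N / K : ℕ) : ℝ) ≤ Real.log N - Real.log K := by
    rw [← Real.log_div hN0.ne' hK0'.ne']
    exact Real.log_le_log (by exact_mod_cast hM1) Nat.cast_div_le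
  have hsub : (Ioc 0 (N / K)).filter P ⊆ (Ioc 0 N).filter P :=
    filter_subset_filter _ (Ioc_subset_Ioc_right (Nat.div_le_self _ _))
  have h4 := Finset.sum_sdiff (f := fun p : ℕ => Real.log p / p) hsub
  have h5 : 1 ≤ ∑ p ∈ (Ioc 0 N).filter P \ (Ioc 0 (N / K)).filter P, Real.log p / p := by
    have := mul_le_mul_of_nonneg_left h3 hκ.le
    linarith
  have h6 : ∑ p ∈ (Ioc 0 N).filter P \ (Ioc 0 (N / K)).filter P, Real.log p / p
      ≤ ∑ p ∈ (Ioc 0 N).filter P \ (Ioc 0 (N / K)).filter P, Real.log p * (K / N) := by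
    refine sum_le_sum fun p hp => ?_
    rw [Finset.mem_sdiff] at hp
    simp only [mem_filter, mem_Ioc, not_and] at hp
    obtain ⟨⟨⟨hp0, hpN⟩, hpP⟩, hp2⟩ := hp
    have hlt : N / K < p := by
      by_contra hc
      exact hp2 ⟨hp0, by omega⟩ hpP
    have hp0' : (0 : ℝ) < p := by exact_mod_cast hp0
    rw [div_eq_mul_inv]
    refine mul_le_mul_of_nonneg_left ?_ (Real.log_natCast_nonneg p)
    rw [inv_le_comm₀ hp0' (by positivity), inv_div, div_le_iff₀ hK0']
    have : N < p * K := (Nat.div_lt_iff_lt_mul hK0).1 hlt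
    exact_mod_cast this.le
  rw [← sum_mul] at h6
  have h7 : ∑ p ∈ (Ioc 0 N).filter P \ (Ioc 0 (N / K)).filter P, Real.log p
      ≤ ∑ p ∈ (Ioc 0 N).filter P, Real.log p :=
    sum_le_sum_of_subset_of_nonneg sdiff_subset fun p _ _ => Real.log_natCast_nonneg p
  have h8 : 1 ≤ (∑ p ∈ (Ioc 0 N).filter P, Real.log p) * (K / N) :=
    h5.trans (h6.trans (mul_le_mul_of_nonneg_right h7 (by positivity)))
  rw [← mul_div_assoc, le_div_iff₀ hN0, one_mul] at h8
  rw [one_div, inv_mul_le_iff₀ hK0']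
  linarith

open Classical in
lemma dens_recip (hκ : 0 < κ) (hM : ∀ N : ℕ, 1 ≤ N →
    |∑ p ∈ (Ioc 0 N).filter P, Real.log p / p - κ * Real.log N| ≤ C) :
    ∃ y0 : ℕ, ∀ y : ℕ, y0 ≤ y → κ / 4 ≤ ∑ p ∈ (Ioc y (y ^ 2)).filter P, (p : ℝ)⁻¹ := by
  obtain ⟨y0, hy0⟩ := exists_nat_ge (Real.exp (8 * C / κ))
  refine ⟨max y0 2, fun y hy => ?_⟩
  have hy2 : 2 ≤ y := le_trans (le_max_right _ _) hy
  have hyr : (1 : ℝ) < y := by exact_mod_cast hy2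
  have hlog : 0 < Real.log y := Real.log_pos hyr
  have hC : 8 * C ≤ κ * Real.log y := by
    have h1 : Real.exp (8 * C / κ) ≤ y := hy0.trans (by exact_mod_cast (le_max_left _ _).trans hy)
    have := (Real.le_log_iff_exp_le (by linarith)).2 h1
    rw [div_le_iff₀ hκ] at this; linarith
  have hyy : y ≤ y ^ 2 := by nlinarith
  have h1 := (abs_le.1 (hM (y ^ 2) (by nlinarith))).1
  have h2 := (abs_le.1 (hM y (by omega))).2
  have e : ∑ p ∈ (Ioc 0 (y ^ 2)).filter P, Real.log p / p =
      ∑ p ∈ (Ioc 0 y).filter P, Real.log p / p + ∑ p ∈ (Ioc y (y ^ 2)).filter P, Real.log p / p := by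
    rw [← Ioc_union_Ioc_eq_Ioc (Nat.zero_le y) hyy, filter_union, sum_union]
    refine disjoint_filter_filter ?_
    rw [Finset.disjoint_left]
    intro x hx hx2
    simp at hx hx2; omega
  have hl2 : Real.log ((y ^ 2 : ℕ) : ℝ) = 2 * Real.log y := by push_cast; rw [Real.log_pow]; norm_num
  rw [hl2] at h1
  have h3 : ∑ p ∈ (Ioc y (y ^ 2)).filter P, Real.log p / p
      ≤ ∑ p ∈ (Ioc y (y ^ 2)).filter P, (2 * Real.log y) * (p : ℝ)⁻¹ := by
    refine sum_le_sum fun p hp => ?_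
    simp only [mem_filter, mem_Ioc] at hp
    have hp0 : (0 : ℝ) < p := by exact_mod_cast (by omega : 0 < p)
    rw [div_eq_mul_inv]
    refine mul_le_mul_of_nonneg_right ?_ (by positivity)
    rw [← hl2]
    exact Real.log_le_log hp0 (by exact_mod_cast hp.1.2)
  rw [← mul_sum] at h3
  have h4 : (2 * Real.log y) * (κ / 4) ≤ (2 * Real.log y) * ∑ p ∈ (Ioc y (y ^ 2)).filter P, (p : ℝ)⁻¹ := by
    have := mul_pos hκ hlog
    linarith
  exact le_of_mul_le_mul_left h4 (by linarith)

open Classical in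
/-- harmonic sum over good numbers -/
noncomputable def Lsum (P : ℕ → Prop) (y : ℕ) : ℝ := ∑ m ∈ (Ioc 0 y).filter (GoodNum P), (m : ℝ)⁻¹

open Classical in
lemma Lsum_mono {x y : ℕ} (h : x ≤ y) : Lsum P x ≤ Lsum P y :=
  sum_le_sum_of_subset_of_nonneg (filter_subset_filter _ (Ioc_subset_Ioc_right h))
    fun _ _ _ => by positivity

lemma GoodNum.one : GoodNum P 1 :=
  ⟨squarefree_one, fun p hp h => absurd (Nat.dvd_one.1 h) hp.ne_one⟩

open Classical in
lemma one_le_Lsum {y : ℕ} (hy : 1 ≤ y) : 1 ≤ Lsum P y := by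
  refine le_trans ?_ (Lsum_mono hy)
  have : (1 : ℕ) ∈ (Ioc 0 1).filter (GoodNum P) := by simp [GoodNum.one]
  have := single_le_sum (f := fun m : ℕ => (m : ℝ)⁻¹) (fun _ _ => by positivity) this
  simpa [Lsum] using this

lemma GoodNum.mul_prime (hP : ∀ p, P p → p.Prime) {m p : ℕ} (hm : GoodNum P m) (hp : P p)
    (hpm : ¬ p ∣ m) : GoodNum P (m * p) := by
  have hpp := hP p hp
  refine ⟨?_, fun r hr hd => ?_⟩
  · exact (Nat.squarefree_mul ((Nat.coprime_comm.1 (hpp.coprime_iff_not_dvd.2 hpm)))).2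
      ⟨hm.1, hpp.squarefree⟩
  · rcases (Nat.Prime.dvd_mul hr).1 hd with h | h
    · exact hm.2 r hr h
    · rwa [(Nat.prime_dvd_prime_iff_eq hr hpp).1 h]

open Classical in
lemma Lsum_step (hP : ∀ p, P p → p.Prime) {y : ℕ} {δ : ℝ}
    (h : δ ≤ ∑ p ∈ (Ioc y (y ^ 2)).filter P, (p : ℝ)⁻¹) :
    (1 + δ) * Lsum P y ≤ Lsum P (y ^ 3) := by
  rcases Nat.eq_zero_or_pos y with rfl | hy
  · simp [Lsum]
  have hinj : Set.InjOn (fun x : ℕ × ℕ => x.1 * x.2)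
      ((Ioc 0 y).filter (GoodNum P) ×ˢ (Ioc y (y ^ 2)).filter P : Finset (ℕ × ℕ)) := by
    rintro ⟨m, p⟩ h1 ⟨m', p'⟩ h2 h3
    simp only [coe_product, Set.mem_prod, mem_coe, mem_filter, mem_Ioc] at h1 h2 h3
    have hp := hP p h1.2.2
    have hp' := hP p' h2.2.2
    have hd : p ∣ m' * p' := ⟨m, by rw [← h3]; ring⟩
    have : p = p' := by
      rcases (Nat.Prime.dvd_mul hp).1 hd with hh | hh
      · have := Nat.le_of_dvd h2.1.1.1 hh
        omega
      · exact (Nat.prime_dvd_prime_iff_eq hp hp').1 hh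
    subst this
    have := Nat.eq_of_mul_eq_mul_right hp.pos h3
    rw [this]
  have hsub : ((Ioc 0 y).filter (GoodNum P) ×ˢ (Ioc y (y ^ 2)).filter P).image (fun x : ℕ × ℕ => x.1 * x.2)
      ⊆ (Ioc y (y ^ 3)).filter (GoodNum P) := by
    intro n hn
    obtain ⟨⟨m, p⟩, h1, rfl⟩ := mem_image.1 hn
    simp only [mem_product, mem_filter, mem_Ioc] at h1 ⊢
    obtain ⟨⟨⟨hm0, hmy⟩, hmg⟩, ⟨hpy, hpy2⟩, hpP⟩ := h1
    refine ⟨⟨by nlinarith, ?_⟩, hmg.mul_prime hP hpP ?_⟩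
    · calc m * p ≤ y * y ^ 2 := Nat.mul_le_mul hmy hpy2
        _ = y ^ 3 := by ring
    · intro hd
      have := Nat.le_of_dvd hm0 hd
      omega
  have h1 : Lsum P y * ∑ p ∈ (Ioc y (y ^ 2)).filter P, (p : ℝ)⁻¹
      ≤ ∑ n ∈ (Ioc y (y ^ 3)).filter (GoodNum P), (n : ℝ)⁻¹ := by
    refine le_trans (le_of_eq ?_) (sum_le_sum_of_subset_of_nonneg hsub fun _ _ _ => by positivity)
    rw [sum_image hinj, Lsum, sum_mul_sum, sum_product]
    refine sum_congr rfl fun m _ => sum_congr rfl fun p _ => ?_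
    push_cast; rw [mul_inv]
  have e : Lsum P (y ^ 3) = Lsum P y + ∑ n ∈ (Ioc y (y ^ 3)).filter (GoodNum P), (n : ℝ)⁻¹ := by
    rw [Lsum, Lsum, ← Ioc_union_Ioc_eq_Ioc (Nat.zero_le y) (show y ≤ y ^ 3 from Nat.le_self_pow (by norm_num) y),
      filter_union, sum_union]
    refine disjoint_filter_filter ?_
    rw [Finset.disjoint_left]
    intro x hx hx2
    simp at hx hx2; omega
  have h0 : 0 ≤ Lsum P y := sum_nonneg fun _ _ => by positivity
  have := mul_le_mul_of_nonneg_left h h0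
  linarith

lemma Lsum_lower (hP : ∀ p, P p → p.Prime) (hκ : 0 < κ) (hκ1 : κ ≤ 1) (hM : ∀ N : ℕ, 1 ≤ N → open Classical in
    |∑ p ∈ (Ioc 0 N).filter P, Real.log p / p - κ * Real.log N| ≤ C) :
    ∃ η : ℝ, 0 < η ∧ η < 1 ∧ ∃ c : ℝ, 0 < c ∧ ∃ Y0 : ℕ, ∀ Y : ℕ, Y0 ≤ Y →
      c * (Real.log Y) ^ η ≤ Lsum P Y := by
  obtain ⟨y1, hy1⟩ := dens_recip hκ hM
  obtain ⟨y0, hy0, hy3⟩ : ∃ y0, y1 ≤ y0 ∧ 3 ≤ y0 := ⟨max y1 3, le_max_left _ _, le_max_right _ _⟩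
  have hl3 : 0 < Real.log 3 := Real.log_pos (by norm_num)
  have hit : ∀ k : ℕ, (1 + κ / 4) ^ k ≤ Lsum P (y0 ^ (3 ^ k)) := by
    intro k
    induction k with
    | zero => simpa using one_le_Lsum (P := P) (y := y0) (by omega)
    | succ k ih =>
      have h1 := Lsum_step hP (hy1 (y0 ^ (3 ^ k))
        (hy0.trans (Nat.le_self_pow (by positivity) y0)))
      rw [← pow_mul, ← pow_succ] at h1
      refine le_trans ?_ h1
      rw [pow_succ, mul_comm]
      exact mul_le_mul_of_nonneg_left ih (by positivity)
  have hη0 : 0 < Real.log (1 + κ / 4) := Real.log_pos (by linarith)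
  have hly : 0 < Real.log y0 := Real.log_pos (by exact_mod_cast (by omega : 1 < y0))
  refine ⟨Real.log (1 + κ / 4) / Real.log 3, div_pos hη0 hl3, ?_,
    (1 / (3 * Real.log y0)) ^ (Real.log (1 + κ / 4) / Real.log 3), by positivity, y0, fun Y hY => ?_⟩
  · rw [div_lt_one hl3]
    exact Real.log_lt_log (by linarith) (by linarith)
  set η := Real.log (1 + κ / 4) / Real.log 3 with hη
  have hη' : 0 < η := div_pos hη0 hl3
  have h3η : (3 : ℝ) ^ η = 1 + κ / 4 := by
    rw [Real.rpow_def_of_pos (by norm_num), hη, mul_div_cancel₀ _ hl3.ne', Real.exp_log (by linarith)]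
  obtain ⟨k, hk1, hk2⟩ : ∃ k : ℕ, y0 ^ (3 ^ k) ≤ Y ∧ Y < y0 ^ (3 ^ (k + 1)) := by
    have hl : Nat.log y0 Y ≠ 0 := (Nat.log_pos (by omega) hY).ne'
    refine ⟨Nat.log 3 (Nat.log y0 Y), ?_, ?_⟩
    · calc y0 ^ (3 ^ (Nat.log 3 (Nat.log y0 Y))) ≤ y0 ^ (Nat.log y0 Y) :=
          Nat.pow_le_pow_right (by omega) (Nat.pow_log_le_self 3 hl)
        _ ≤ Y := Nat.pow_log_le_self y0 (by omega)
    · calc Y < y0 ^ (Nat.log y0 Y + 1) := Nat.lt_pow_succ_log_self (by omega) Y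
        _ ≤ _ := Nat.pow_le_pow_right (by omega) (Nat.lt_pow_succ_log_self (by norm_num) _)
  refine le_trans ?_ ((hit k).trans (Lsum_mono hk1))
  have hYpos : 0 < Y := by omega
  have hlY0 : 0 ≤ Real.log Y := Real.log_natCast_nonneg Y
  have hlY : Real.log Y ≤ 3 ^ (k + 1) * Real.log y0 := by
    have := Real.log_le_log (by exact_mod_cast hYpos) (show (Y : ℝ) ≤ ((y0 ^ (3 ^ (k + 1)) : ℕ) : ℝ) by exact_mod_cast hk2.le)
    push_cast at this
    rw [Real.log_pow] at this
    push_cast at this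
    exact this
  rw [← Real.mul_rpow (by positivity) hlY0, ← h3η, ← Real.rpow_natCast, ← Real.rpow_mul (by norm_num), mul_comm η,
    Real.rpow_mul (by norm_num), Real.rpow_natCast]
  refine Real.rpow_le_rpow (by positivity) ?_ hη'.le
  rw [one_div, inv_mul_le_iff₀ (by positivity)]
  calc _ ≤ _ := hlY
    _ = _ := by ring

end density


section density2
open Finset

lemma sum_log_primes_le {s : Finset ℕ} {n : ℕ} (hn : n ≠ 0) (hs : ∀ p ∈ s, p.Prime ∧ p ∣ n) :
    ∑ p ∈ s, Real.log p ≤ Real.log n := by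
  have h1 : ∏ p ∈ s, p ∣ n :=
    Finset.prod_primes_dvd n (fun p hp => (hs p hp).1.prime) (fun p hp => (hs p hp).2)
  have h2 := Nat.le_of_dvd (Nat.pos_of_ne_zero hn) h1
  rw [← Real.log_prod (fun p hp => by exact_mod_cast (hs p hp).1.ne_zero)]
  have h0 : 0 < ∏ p ∈ s, p := Finset.prod_pos fun p hp => (hs p hp).1.pos
  rw [← Nat.cast_prod]
  exact Real.log_le_log (by exact_mod_cast h0) (by exact_mod_cast h2)

variable {P : ℕ → Prop} {κ C : ℝ}

open Classical in
lemma count_log (hP : ∀ p, P p → p.Prime) (N s : ℕ) :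
    ∑ m ∈ (Ioc 0 s).filter (GoodNum P), (∑ p ∈ (Ioc 0 (N / m)).filter P, Real.log p - Real.log m)
      ≤ ((Ioc 0 N).filter (GoodNum P)).card * Real.log N := by
  have hA : ∀ m ∈ (Ioc 0 s).filter (GoodNum P),
      ∑ p ∈ (Ioc 0 (N / m)).filter P, Real.log p - Real.log m ≤
      ∑ p ∈ (Ioc 0 N).filter P, if (¬ p ∣ m ∧ m * p ≤ N) then Real.log p else 0 := by
    intro m hm
    simp only [mem_filter, mem_Ioc] at hm
    have h1 := sum_filter_add_sum_filter_not ((Ioc 0 (N / m)).filter P) (fun p => p ∣ m)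
      (fun p : ℕ => Real.log p)
    have h2 : ∑ p ∈ ((Ioc 0 (N / m)).filter P).filter (fun p => p ∣ m), Real.log p ≤ Real.log m :=
      sum_log_primes_le (by omega) fun p hp => by
        simp only [mem_filter] at hp
        exact ⟨hP p hp.1.2, hp.2⟩
    have h3 : ∑ p ∈ ((Ioc 0 (N / m)).filter P).filter (fun p => ¬ p ∣ m), Real.log p ≤
        ∑ p ∈ (Ioc 0 N).filter P, if (¬ p ∣ m ∧ m * p ≤ N) then Real.log p else 0 := by
      rw [← sum_filter]
      refine sum_le_sum_of_subset_of_nonneg ?_ fun p _ _ => Real.log_natCast_nonneg p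
      intro p hp
      simp only [mem_filter, mem_Ioc] at hp ⊢
      obtain ⟨⟨⟨h0, hpN⟩, hpP⟩, hd⟩ := hp
      have : m * p ≤ N := by
        have := (Nat.le_div_iff_mul_le hm.1.1).1 hpN
        linarith [mul_comm m p]
      exact ⟨⟨⟨h0, hpN.trans (Nat.div_le_self _ _)⟩, hpP⟩, hd, this⟩
    linarith
  refine (sum_le_sum hA).trans ?_
  rw [← sum_product', ← sum_filter]
  have hinj : Set.InjOn (fun x : ℕ × ℕ => (x.1 * x.2, x.2))
      (((Ioc 0 s).filter (GoodNum P) ×ˢ (Ioc 0 N).filter P).filter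
        (fun x => ¬ x.2 ∣ x.1 ∧ x.1 * x.2 ≤ N) : Finset (ℕ × ℕ)) := by
    rintro ⟨m, p⟩ h1 ⟨m', p'⟩ h2 h3
    simp only [Prod.mk.injEq] at h3
    obtain ⟨h3, rfl⟩ := h3
    simp only [coe_filter, mem_product, mem_filter, mem_Ioc, Set.mem_ofPred_eq] at h1
    rw [Nat.eq_of_mul_eq_mul_right h1.1.2.1.1 h3]
  have e : ∑ x ∈ ((Ioc 0 s).filter (GoodNum P) ×ˢ (Ioc 0 N).filter P).filter
        (fun x => ¬ x.2 ∣ x.1 ∧ x.1 * x.2 ≤ N), Real.log x.2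
      ≤ ∑ x ∈ (((Ioc 0 N).filter (GoodNum P)) ×ˢ (Ioc 0 N).filter P).filter
        (fun x => x.2 ∣ x.1), Real.log x.2 := by
    have := sum_image (f := fun x : ℕ × ℕ => Real.log x.2) hinj
    simp only at this
    rw [← this]
    refine sum_le_sum_of_subset_of_nonneg ?_ fun p _ _ => Real.log_natCast_nonneg _
    intro x hx
    obtain ⟨⟨m, p⟩, h1, rfl⟩ := mem_image.1 hx
    simp only [mem_filter, mem_product, mem_Ioc] at h1 ⊢
    obtain ⟨⟨⟨⟨hm0, hms⟩, hg⟩, ⟨hp0, hpN⟩, hpP⟩, hd, hle⟩ := h1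
    exact ⟨⟨⟨⟨Nat.mul_pos hm0 hp0, hle⟩, hg.mul_prime hP hpP hd⟩, ⟨hp0, hpN⟩, hpP⟩, Dvd.intro_left m rfl⟩
  refine e.trans ?_
  rw [sum_filter, sum_product, ← nsmul_eq_mul]
  refine sum_le_card_nsmul _ _ _ fun n hn => ?_
  simp only [mem_filter, mem_Ioc] at hn
  rw [← sum_filter]
  have hn0 : (0 : ℝ) < n := by exact_mod_cast hn.1.1
  refine (sum_log_primes_le (n := n) (by omega) fun p hp => ?_).trans
    (Real.log_le_log hn0 (by exact_mod_cast hn.1.2))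
  simp only [mem_filter] at hp
  exact ⟨hP p hp.1.2, hp.2⟩

open Classical in
theorem density_main (hP : ∀ p, P p → p.Prime) (hκ : 0 < κ) (hκ1 : κ ≤ 1) (hM : ∀ N : ℕ, 1 ≤ N →
    |∑ p ∈ (Ioc 0 N).filter P, Real.log p / p - κ * Real.log N| ≤ C) :
    ∃ ε : ℝ, 0 < ε ∧ ε < 1 ∧ ∃ c : ℝ, 0 < c ∧ ∃ N0 : ℕ, ∀ N : ℕ, N0 ≤ N →
      c * (N / (Real.log N) ^ ε) ≤ ((Ioc 0 N).filter (GoodNum P)).card := by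
  obtain ⟨δ, hδ, K, hK⟩ := dens_theta hκ hM
  obtain ⟨η, hη0, hη1, c, hc, Y0, hY⟩ := Lsum_lower hP hκ hκ1 hM
  -- log s ≤ (δ/4) s for large s
  have hlog : ∀ᶠ s : ℕ in atTop, Real.log s ≤ δ / 4 * s := by
    have h1 := (Real.isLittleO_log_id_atTop.comp_tendsto tendsto_natCast_atTop_atTop).def
      (show (0 : ℝ) < δ / 4 by positivity)
    filter_upwards [h1] with s hs
    simp only [Function.comp, id, Real.norm_eq_abs] at hs
    rw [abs_of_nonneg (Real.log_natCast_nonneg s), abs_of_nonneg (by positivity)] at hs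
    exact hs
  obtain ⟨s0, hs0⟩ := eventually_atTop.1 hlog
  refine ⟨1 - η, by linarith, by linarith, δ / 4 * c * (1 / 3) ^ η, by positivity,
    (max (max Y0 K) (max s0 4)) ^ 2, fun N hN => ?_⟩
  obtain ⟨s, hs⟩ : ∃ s, s = Nat.sqrt N := ⟨_, rfl⟩
  have hsbig : max (max Y0 K) (max s0 4) ≤ s := by
    rw [hs, Nat.le_sqrt']; exact hN
  simp only [max_le_iff] at hsbig
  obtain ⟨⟨hsY, hsK⟩, hss0, hs4⟩ := hsbig
  have hs2 : s * s ≤ N := hs ▸ Nat.sqrt_le N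
  have hs3 : N < (s + 1) * (s + 1) := hs ▸ Nat.lt_succ_sqrt N
  have hN1 : 4 ≤ N := by nlinarith
  have hNr : (4 : ℝ) ≤ N := by exact_mod_cast hN1
  have hsr : (4 : ℝ) ≤ s := by exact_mod_cast hs4
  have hs2r : (s : ℝ) * s ≤ N := by exact_mod_cast hs2
  have hlogN : 0 < Real.log N := Real.log_pos (by linarith)
  have hlog3 : 1 / 3 * Real.log N ≤ Real.log s := by
    have h1 : (N : ℝ) ≤ s ^ 3 := by
      have h2 : (N : ℝ) ≤ (s + 1) * (s + 1) := by exact_mod_cast hs3.le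
      nlinarith [mul_nonneg (sub_nonneg.2 hsr) (sub_nonneg.2 hsr)]
    have := Real.log_le_log (by linarith) h1
    rw [Real.log_pow] at this
    push_cast at this
    linarith
  have h1 := count_log hP N s
  have h2 : (δ / 4 * N) * Lsum P s ≤ ∑ m ∈ (Ioc 0 s).filter (GoodNum P),
      (∑ p ∈ (Ioc 0 (N / m)).filter P, Real.log p - Real.log m) := by
    rw [Lsum, mul_sum]
    refine sum_le_sum fun m hm => ?_
    simp only [mem_filter, mem_Ioc] at hm
    obtain ⟨⟨hm0, hms⟩, -⟩ := hm
    have hm0r : (0 : ℝ) < m := by exact_mod_cast hm0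
    have hmsr : (m : ℝ) ≤ s := by exact_mod_cast hms
    have hsd : s ≤ N / m := (Nat.le_div_iff_mul_le hm0).2 (by nlinarith)
    have h3 := hK (N / m) (by omega)
    have h4 : (N : ℝ) / m ≤ (N / m : ℕ) + 1 := by
      rw [div_le_iff₀ hm0r]
      have : N < (N / m + 1) * m := by nlinarith [Nat.lt_div_mul_add (a := N) hm0]
      exact_mod_cast this.le
    have h5 : (s : ℝ) ≤ N / m := by
      rw [le_div_iff₀ hm0r]; nlinarith
    have h6 : Real.log m ≤ δ / 4 * (N / m) := by
      calc Real.log m ≤ Real.log s := Real.log_le_log hm0r hmsr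
        _ ≤ δ / 4 * s := hs0 s hss0
        _ ≤ _ := mul_le_mul_of_nonneg_left h5 (by positivity)
    have h7 : δ * ((N : ℝ) / m / 2) ≤ δ * (N / m : ℕ) :=
      mul_le_mul_of_nonneg_left (by linarith) hδ.le
    have e : δ / 4 * N * (m : ℝ)⁻¹ = δ / 4 * (N / m) := by ring
    rw [e]
    linarith
  have h3 := hY s hsY
  have h4 : c * ((1 / 3) ^ η * (Real.log N) ^ η) ≤ Lsum P s := by
    refine le_trans ?_ h3
    rw [← Real.mul_rpow (by norm_num) hlogN.le]
    exact mul_le_mul_of_nonneg_left (Real.rpow_le_rpow (by positivity) hlog3 hη0.le) hc.le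
  have h5 := (mul_le_mul_of_nonneg_left h4 (show 0 ≤ δ / 4 * N by positivity)).trans (h2.trans h1)
  rw [Real.rpow_sub hlogN, Real.rpow_one]
  refine le_trans (le_of_eq ?_) ((div_le_iff₀ hlogN).2 h5)
  have : (Real.log N) ^ η ≠ 0 := (Real.rpow_pos_of_pos hlogN _).ne'
  field_simp

end density2


section assembly

/-- The set of primes used in the construction. -/
def TwPrime (n : ℕ) (p : ℕ) : Prop :=
  p.Prime ∧ (p : ZMod (36 * n)) = ((1 + 18 * n : ℕ) : ZMod (36 * n))

theorem TwPrime.mods {n p : ℕ} (hn : n % 4 = 1) (h : TwPrime n p) :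
    p % 4 = 3 ∧ p % (9 * n) = 1 % (9 * n) := by
  have h1 := (ZMod.natCast_eq_natCast_iff p (1 + 18 * n) (36 * n)).1 h.2
  constructor
  · have h2 : p ≡ 1 + 18 * n [MOD 4] := h1.of_dvd ⟨9 * n, by ring⟩
    have h3 : p % 4 = (1 + 18 * n) % 4 := h2
    omega
  · have h2 : p ≡ 1 + 18 * n [MOD (9 * n)] := h1.of_dvd ⟨4, by ring⟩
    have h3 : p % (9 * n) = (1 + 18 * n) % (9 * n) := h2
    rw [h3, show 1 + 18 * n = 1 + (9 * n) * 2 by ring, Nat.add_mul_mod_self_left]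

theorem TwPrime.jac {n p : ℕ} (hn : n % 4 = 1) (h : TwPrime n p) :
    jacobiSym (-(n : ℤ)) p = -1 ∧ jacobiSym (3 * (n : ℤ)) p = -1 := by
  obtain ⟨h4, h9⟩ := h.mods hn
  have hodd : Odd p := Nat.odd_iff.2 (by omega)
  have hA : jacobiSym (n : ℤ) p = 1 := by
    rw [jacobiSym.quadratic_reciprocity_one_mod_four hn hodd]
    have : (p : ℤ) % (n : ℤ) = 1 % (n : ℤ) := by
      have h1 : p ≡ 1 [MOD n] := Nat.ModEq.of_dvd ⟨9, by ring⟩ (h9 : p ≡ 1 [MOD (9 * n)])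
      exact_mod_cast h1
    rw [jacobiSym.mod_left' this, jacobiSym.one_left]
  have h3 : jacobiSym (3 : ℤ) p = -1 := by
    have h0 : jacobiSym ((3 : ℕ) : ℤ) p = - jacobiSym p 3 :=
      jacobiSym.quadratic_reciprocity_three_mod_four (by norm_num) h4
    have : (p : ℤ) % ((3 : ℕ) : ℤ) = 1 % ((3 : ℕ) : ℤ) := by
      have h1 : p ≡ 1 [MOD 3] := Nat.ModEq.of_dvd ⟨3 * n, by ring⟩ (h9 : p ≡ 1 [MOD (9 * n)])
      exact_mod_cast h1
    rw [jacobiSym.mod_left' this, jacobiSym.one_left] at h0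
    exact_mod_cast h0
  refine ⟨?_, ?_⟩
  · rw [jacobiSym.neg _ hodd, hA, ZMod.χ₄_nat_three_mod_four h4]; norm_num
  · rw [jacobiSym.mul_left, h3, hA]; norm_num

theorem modEq_one_of_primes {k m : ℕ} (hm : m ≠ 0) :
    (∀ p, p.Prime → p ∣ m → p ≡ 1 [MOD k]) → m ≡ 1 [MOD k] := by
  induction m using Nat.recOnMul with
  | zero => exact absurd rfl hm
  | one => intro _; rfl
  | prime p hp => intro h; exact h p hp dvd_rfl
  | mul a b iha ihb =>
    intro h
    have ha := iha (left_ne_zero_of_mul hm) fun p hp hd => h p hp (hd.mul_right b)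
    have hb := ihb (right_ne_zero_of_mul hm) fun p hp hd => h p hp (hd.mul_left a)
    exact ha.mul hb

theorem goodTwist_of_goodNum {n m : ℕ} {d0 : ℤ} (hn0 : 0 < n) (hsf : Squarefree (n : ℤ))
    (hd : (d0 = 4 ∧ n % 36 = 1) ∨ (d0 = 1 ∧ n % 36 = 25)) (hm : GoodNum (TwPrime n) m) :
    GoodTwist (n : ℤ) (d0 * m) ∧ IsCubeFree (d0 * m) := by
  have hn4 : n % 4 = 1 := by omega
  have hm0 : m ≠ 0 := hm.1.ne_zero
  have hmod : m ≡ 1 [MOD (9 * n)] := modEq_one_of_primes hm0 fun p hp hd =>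
    ((hm.2 p hp hd).mods hn4).2
  have hm9 : m % 9 = 1 := Nat.ModEq.of_dvd ⟨n, rfl⟩ hmod
  have hmn : m ≡ 1 [MOD n] := Nat.ModEq.of_dvd ⟨9, by ring⟩ hmod
  have hm2 : m % 2 = 1 := by
    by_contra h
    have h2 := (hm.2 2 Nat.prime_two (Nat.dvd_of_mod_eq_zero (by omega))).mods hn4
    omega
  have hcop : IsCoprime (m : ℤ) (n : ℤ) := by
    rw [Nat.isCoprime_iff_coprime]
    have := hmn.gcd_eq
    simpa [Nat.Coprime, Nat.gcd_comm] using this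
  have hcop2 : IsCoprime (2 : ℤ) (n : ℤ) := by
    rw [Int.prime_two.coprime_iff_not_dvd]; omega
  have hd4 : d0 ∣ 4 := by rcases hd with h | h <;> rw [h.1]; norm_num
  have key : ∀ (p : ℤ) (k : ℕ), Prime p → ¬ 2 ∣ p → p ^ k ∣ d0 * m → p ^ k ∣ (m : ℤ) := by
    intro p k hp h2 hdv
    have hc : IsCoprime (2 : ℤ) p := by rwa [Int.prime_two.coprime_iff_not_dvd]
    have hc4 : IsCoprime (p ^ k) (4 : ℤ) := by
      rw [show (4 : ℤ) = 2 ^ 2 by norm_num]; exact hc.symm.pow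
    exact (hc4.of_isCoprime_of_dvd_right hd4).dvd_of_dvd_mul_left hdv
  have keyP : ∀ p : ℤ, Prime p → p ∣ d0 * m → ¬ 2 ∣ p → TwPrime n p.natAbs := by
    intro p hp hdv h2
    have h1 := key p 1 hp h2 (by simpa using hdv)
    refine hm.2 _ (Int.prime_iff_natAbs_prime.1 hp) ?_
    exact Int.natCast_dvd_natCast.1 (by simpa using h1)
  have keysq : ∀ p : ℤ, Prime p → ¬ 2 ∣ p → ¬ p ^ 2 ∣ d0 * m := by
    intro p hp h2 hdv
    have h1 := key p 2 hp h2 hdv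
    have h3 : p.natAbs * p.natAbs ∣ m := by
      apply Int.natCast_dvd_natCast.1
      have : p ^ 2 = ((p.natAbs * p.natAbs : ℕ) : ℤ) := by
        rw [Int.natAbs_mul_self, sq]
      rwa [← this]
    exact (Int.prime_iff_natAbs_prime.1 hp).not_isUnit (hm.1 _ h3)
  refine ⟨⟨by exact_mod_cast hn0, hsf, by omega, by omega, ?_, ?_, ?_, ?_, ?_, ?_, ?_⟩, ?_⟩
  · refine mul_ne_zero ?_ (by exact_mod_cast hm0)
    rcases hd with h | h <;> rw [h.1] <;> norm_num
  · rcases hd with h | h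
    · exact Or.inr ⟨m, by rw [h.1], by omega⟩
    · left; rw [h.1]; omega
  · have h1 : (m : ℤ) ≡ 1 [ZMOD 9] := by
      have : (m : ℤ) % 9 = 1 := by omega
      exact this
    rcases hd with h | h
    · have h2 : (n : ℤ) ≡ 1 [ZMOD 9] := by
        have : (n : ℤ) % 9 = 1 := by omega
        exact this
      have := h2.mul (((Int.ModEq.refl 4).mul h1).pow 2)
      rw [h.1]; exact this
    · have h2 : (n : ℤ) ≡ 7 [ZMOD 9] := by
        have : (n : ℤ) % 9 = 7 := by omega
        exact this
      have := h2.mul (((Int.ModEq.refl 1).mul h1).pow 2)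
      rw [h.1]; exact this
  · refine IsCoprime.mul_left ?_ hcop
    refine IsCoprime.of_isCoprime_of_dvd_left ?_ hd4
    rw [show (4 : ℤ) = 2 ^ 2 by norm_num]; exact hcop2.pow_left
  · intro p hp _ h2; exact keysq p hp h2
  · intro p hp hdv h2 x y hxy
    have ht := keyP p hp hdv h2
    haveI : Fact p.natAbs.Prime := ⟨ht.1⟩
    have := jacobiSym.prime_dvd_of_eq_neg_one (ht.jac hn4).1 (x := x) (y := y)
      (by rw [Int.natAbs_dvd]; convert hxy using 1; ring)
    simpa [Int.natAbs_dvd] using this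
  · intro p hp hdv h2 x y hxy
    have ht := keyP p hp hdv h2
    haveI : Fact p.natAbs.Prime := ⟨ht.1⟩
    have := jacobiSym.prime_dvd_of_eq_neg_one (ht.jac hn4).2 (x := x) (y := y)
      (by rw [Int.natAbs_dvd]; exact hxy)
    simpa [Int.natAbs_dvd] using this
  · intro q hq hdv
    by_cases h2 : q = 2
    · subst h2
      rcases hd with h | h <;> rw [h.1] at hdv <;> norm_num at hdv <;> omega
    · refine keysq q (Nat.prime_iff_prime_int.1 hq) ?_ ((pow_dvd_pow _ (by norm_num)).trans hdv)
      intro h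
      have : 2 ∣ q := by exact_mod_cast h
      exact h2 ((Nat.prime_dvd_prime_iff_eq Nat.prime_two hq).1 this).symm

theorem tw_density {n : ℕ} (hn0 : 0 < n) (hn4 : n % 4 = 1) (hn3 : n % 3 = 1) :
    ∃ ε : ℝ, 0 < ε ∧ ε < 1 ∧ ∃ c : ℝ, 0 < c ∧ ∃ N0 : ℕ, ∀ N : ℕ, N0 ≤ N →
      ∃ s : Finset ℕ, (∀ m ∈ s, 0 < m ∧ m ≤ N ∧ GoodNum (TwPrime n) m) ∧
      c * (N / (Real.log N) ^ ε) ≤ s.card := by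
  classical
  haveI : NeZero (36 * n) := ⟨by omega⟩
  have hu : IsUnit ((1 + 18 * n : ℕ) : ZMod (36 * n)) := by
    rw [ZMod.isUnit_iff_coprime]
    have h1 : Nat.Coprime (1 + 18 * n) 18 := by simp
    have h2 : Nat.Coprime (1 + 18 * n) n := by simp
    have h3 : Nat.Coprime (1 + 18 * n) 2 := h1.coprime_dvd_right ⟨9, rfl⟩
    rw [show 36 * n = 18 * 2 * n by ring]
    exact (h1.mul_right h3).mul_right h2
  obtain ⟨C, hC⟩ := mertens_AP hu
  have hpos : 0 < (36 * n).totient := Nat.totient_pos.2 (by omega)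
  have hM : ∀ N : ℕ, 1 ≤ N → |∑ p ∈ (Finset.Ioc 0 N).filter (TwPrime n), Real.log p / p
      - ((36 * n).totient : ℝ)⁻¹ * Real.log N| ≤ C := by
    intro N hN
    convert hC N hN using 5
    exact Iff.rfl
  obtain ⟨ε, h0, h1, c, hc, N0, h⟩ := density_main (P := TwPrime n) (fun p hp => hp.1)
    (by positivity) (inv_le_one_of_one_le₀ (by exact_mod_cast hpos)) hM
  refine ⟨ε, h0, h1, c, hc, N0, fun N hN => ⟨_, ?_, h N hN⟩⟩
  intro m hm
  simp only [Finset.mem_filter, Finset.mem_Ioc] at hm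
  exact ⟨hm.1.1, hm.1.2, hm.2⟩

end assembly

/-- For a positive square-free integer `A ≡ 1` or `25 (mod 36)` whose imaginary quadratic
field `ℚ(√-A)` has trivial `3`-torsion in its class group (i.e. `dim_𝔽₃ Cl(ℚ(√-A))[3] = 0`),
there are `ε ∈ (0,1)` and `c > 0` such that for all sufficiently large `X`, the number of
cube-free integers `0 < D < X` with `rank E^D(ℚ) = 0` is at least `c·X/(log X)^ε`, where
`E^D : y² = x³ - A·D²` is a cubic twist. -/
theorem cubic_twists_rank_zero_lower_bound
    (A : ℤ) (hApos : 0 < A) (hAsf : Squarefree A)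
    (hAmod : A % 36 = 1 ∨ A % 36 = 25)
    (hcl : Nat.card {x : ClassGroup (NumberField.RingOfIntegers (quadField (-A))) //
      x ^ 3 = 1} = 1) :
    ∃ ε : ℝ, 0 < ε ∧ ε < 1 ∧ ∃ c : ℝ, 0 < c ∧ ∀ᶠ X : ℝ in atTop,
      c * (X / (Real.log X) ^ ε) ≤
        (Nat.card {D : ℤ | 0 < D ∧ (D : ℝ) < X ∧ IsCubeFree D ∧
          mordellRank (-(A * D ^ 2)) = 0} : ℝ) := by
  obtain ⟨n, rfl⟩ : ∃ n : ℕ, A = n := ⟨A.toNat, by omega⟩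
  have hn0 : 0 < n := by exact_mod_cast hApos
  obtain ⟨d0, hd⟩ : ∃ d0 : ℤ, (d0 = 4 ∧ n % 36 = 1) ∨ (d0 = 1 ∧ n % 36 = 25) := by
    rcases hAmod with h | h
    · exact ⟨4, Or.inl ⟨rfl, by omega⟩⟩
    · exact ⟨1, Or.inr ⟨rfl, by omega⟩⟩
  have hdpos : 0 < d0 := by omega
  have hd4 : d0 ≤ 4 := by omega
  obtain ⟨ε, h0, h1, c, hc, N0, h⟩ := tw_density hn0 (by omega) (by omega)
  refine ⟨ε, h0, h1, c / 16, by positivity, ?_⟩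
  filter_upwards [eventually_ge_atTop (16 * ((N0 : ℝ) + 3))] with X hX
  have hXpos : 0 < X := by
    have : (0 : ℝ) ≤ N0 := Nat.cast_nonneg _
    linarith
  set N : ℕ := ⌊X / 8⌋₊ with hNdef
  have hNle : (N : ℝ) ≤ X / 8 := Nat.floor_le (by positivity)
  have hNgt : X / 8 < N + 1 := Nat.lt_floor_add_one _
  have hN0r : (N0 : ℝ) + 3 ≤ N + 0 := by
    have : (0 : ℝ) ≤ N0 := Nat.cast_nonneg _
    linarith
  have hN0 : N0 ≤ N := by
    have : (N0 : ℝ) ≤ N := by linarith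
    exact_mod_cast this
  have hN3 : (3 : ℝ) ≤ N := by
    have : (0 : ℝ) ≤ N0 := Nat.cast_nonneg _
    linarith
  obtain ⟨s, hs, hcard⟩ := h N hN0
  set S : Set ℤ := {D : ℤ | 0 < D ∧ (D : ℝ) < X ∧ IsCubeFree D ∧
          mordellRank (-((n : ℤ) * D ^ 2)) = 0} with hS
  have hfin : S.Finite := by
    refine (Set.finite_Ioc (0 : ℤ) ⌈X⌉).subset ?_
    rintro D ⟨hD0, hDX, -⟩
    refine ⟨hD0, ?_⟩
    have : (D : ℝ) ≤ (⌈X⌉ : ℝ) := hDX.le.trans (Int.le_ceil X)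
    exact_mod_cast this
  have hinj : Function.Injective (fun m : ℕ => d0 * (m : ℤ)) := by
    intro a b hab
    have : (a : ℤ) = b := mul_left_cancel₀ hdpos.ne' hab
    exact_mod_cast this
  have hsub : ((s.image (fun m : ℕ => d0 * (m : ℤ)) : Finset ℤ) : Set ℤ) ⊆ S := by
    intro D hD
    simp only [Finset.coe_image, Set.mem_image, Finset.mem_coe] at hD
    obtain ⟨m, hm, rfl⟩ := hD
    obtain ⟨hm0, hmN, hg⟩ := hs m hm
    obtain ⟨gt, cf⟩ := goodTwist_of_goodNum hn0 hAsf hd hg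
    refine ⟨by positivity, ?_, cf, goodTwist_rank gt hcl⟩
    have e1 : (m : ℝ) ≤ N := by exact_mod_cast hmN
    have e2 : (d0 : ℝ) ≤ 4 := by exact_mod_cast hd4
    have e3 : (0 : ℝ) ≤ m := Nat.cast_nonneg _
    push_cast
    nlinarith
  have hle : s.card ≤ Nat.card S := by
    have e := Set.ncard_le_ncard hsub hfin
    rw [Set.ncard_coe_finset, Finset.card_image_of_injective _ hinj] at e
    exact e
  have hle' : (s.card : ℝ) ≤ (Nat.card S : ℝ) := by exact_mod_cast hle
  refine le_trans ?_ (hcard.trans hle')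
  have hlogN : 0 < Real.log N := Real.log_pos (by linarith)
  have hlog : Real.log N ≤ Real.log X := Real.log_le_log (by linarith) (by linarith)
  have hpw : (Real.log N) ^ ε ≤ (Real.log X) ^ ε := Real.rpow_le_rpow hlogN.le hlog h0.le
  have hpp : 0 < (Real.log N) ^ ε := Real.rpow_pos_of_pos hlogN _
  have : X / 16 / (Real.log X) ^ ε ≤ N / (Real.log N) ^ ε :=
    div_le_div₀ (by positivity) (by linarith) hpp hpw
  calc c / 16 * (X / (Real.log X) ^ ε) = c * (X / 16 / (Real.log X) ^ ε) := by ring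
    _ ≤ _ := by gcongr
end
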